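/- Let S be a finite set and let ⟨S | R⟩ be a classical C'(1/6) presentation that is in addition non-repetitive: no nonempty reduced word of the form ww occurs as a subword of any cyclic permutation of any relator in R. Then every infinite cyclic subgroup of G = ⟨S | R⟩ is strongly contracting in Cay(G,S). -/

import Mathlib

/- Common definitions: words, classical C'(1/6) presentations, word metrics,
   contraction, Morse property, etc. -/

namespace GSC

open Filter

/-- A word over the alphabet `S`: a list of letters with an exponent `±1`
(`true` = the letter, `false` = its formal inverse). -/
abbrev Word (S : Type) := List (S × Bool)

/-- The formal inverse of a word. -/
def wordInv {S : Type} (w : Word S) : Word S := (w.map fun l => (l.1, !l.2)).reverse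

/-- A word is (freely) reduced if no letter is followed by its formal inverse. -/
def Reduced {S : Type} (w : Word S) : Prop :=
  List.Chain' (fun a b => a.1 ≠ b.1 ∨ a.2 = b.2) w

/-- A word is cyclically reduced if its square is reduced. -/
def CyclicallyReduced {S : Type} (w : Word S) : Prop := Reduced (w ++ w)

/-- A piece with respect to a set of relators `R`: a word occurring as a prefix of
two distinct elements of `R`. -/
def IsPiece {S : Type} (R : Set (Word S)) (p : Word S) : Prop :=
  ∃ r₁ ∈ R, ∃ r₂ ∈ R, r₁ ≠ r₂ ∧ p <+: r₁ ∧ p <+: r₂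

/-- Closure of a set of words under inversion and cyclic permutation. -/
def symmClosure {S : Type} (R : Set (Word S)) : Set (Word S) :=
  {w | ∃ r ∈ R, ∃ n : ℕ, w = r.rotate n ∨ w = wordInv (r.rotate n)}

/-- A classical `C'(1/den)` collection of cyclically reduced words: after closing under
inversion and cyclic permutation, every piece `p` contained in a relator `r` satisfies
`den * |p| < |r|`. -/
def CprimeCollection {S : Type} (den : ℕ) (R : Set (Word S)) : Prop :=
  (∀ r ∈ R, CyclicallyReduced r) ∧
  ∀ r ∈ symmClosure R, ∀ p : Word S, p <+: r → IsPiece (symmClosure R) p →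
    den * p.length < r.length

/-- A classical `C'(1/6)` presentation: a set of cyclically reduced relators, closed under
inversion and cyclic permutation, in which every piece contained in a relator `r` has
length `< |r|/6`. -/
structure C6Presentation (S : Type) where
  rels : Set (Word S)
  cyclically_reduced : ∀ r ∈ rels, CyclicallyReduced r
  inv_mem : ∀ r ∈ rels, wordInv r ∈ rels
  rotate_mem : ∀ r ∈ rels, ∀ n : ℕ, r.rotate n ∈ rels
  small_cancellation : ∀ r ∈ rels, ∀ p : Word S, p <+: r → IsPiece rels p →
    6 * p.length < r.length

/-- The element of the free group represented by a word. -/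
def wordVal {S : Type} (w : Word S) : FreeGroup S :=
  (w.map fun l => (FreeGroup.of l.1) ^ (if l.2 then (1 : ℤ) else -1)).prod

/-- The group defined by a `C'(1/6)` presentation. -/
abbrev C6Presentation.Grp {S : Type} (P : C6Presentation S) : Type :=
  PresentedGroup (wordVal '' P.rels)

/-- The generating set of the presented group (the images of the letters of `S`). -/
def C6Presentation.gens {S : Type} (P : C6Presentation S) : Set P.Grp :=
  Set.range fun a : S => (PresentedGroup.of a : P.Grp)

/-- The element of the presented group represented by a word. -/
def C6Presentation.elt {S : Type} (P : C6Presentation S) (w : Word S) : P.Grp :=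
  (w.map fun l => (PresentedGroup.of l.1 : P.Grp) ^ (if l.2 then (1 : ℤ) else -1)).prod

/-- The word length of `g` with respect to a generating set `S ⊆ G`: the least `n`
such that `g` is a product of `n` elements of `S ∪ S⁻¹`. -/
noncomputable def wordLength {G : Type*} [Group G] (S : Set G) (g : G) : ℕ :=
  sInf {n : ℕ | ∃ l : List G, l.length = n ∧ (∀ x ∈ l, x ∈ S ∨ x⁻¹ ∈ S) ∧ l.prod = g}

/-- The word metric on `G` with respect to `S`, as a real-valued function. -/
noncomputable def wdist {G : Type*} [Group G] (S : Set G) (g h : G) : ℝ :=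
  (wordLength S (g⁻¹ * h) : ℝ)

/-- Distance from a point to a subset, in the word metric. -/
noncomputable def setDist {G : Type*} [Group G] (S : Set G) (x : G) (Y : Set G) : ℝ :=
  sInf (wdist S x '' Y)

/-- Closest point projection to a subset `Y`, in the word metric. -/
def proj {G : Type*} [Group G] (S : Set G) (Y : Set G) (x : G) : Set G :=
  {y ∈ Y | wdist S x y = setDist S x Y}

/-- Diameter of a subset, in the word metric. -/
noncomputable def setDiam {G : Type*} [Group G] (S : Set G) (A : Set G) : ℝ :=
  sSup {d : ℝ | ∃ x ∈ A, ∃ y ∈ A, d = wdist S x y}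

/-- Admissibility of a pair of contraction gauges `(ρ₁, ρ₂)`: both non-decreasing and
eventually non-negative, `ρ₁ r ≤ r`, `ρ₁` unbounded, and `ρ₂/ρ₁ → 0` at infinity. -/
def Admissible (ρ₁ ρ₂ : ℝ → ℝ) : Prop :=
  Monotone ρ₁ ∧ Monotone ρ₂ ∧
  (∀ᶠ r in atTop, 0 ≤ ρ₁ r) ∧ (∀ᶠ r in atTop, 0 ≤ ρ₂ r) ∧
  (∀ r : ℝ, ρ₁ r ≤ r) ∧ (∀ M : ℝ, ∃ r : ℝ, M ≤ ρ₁ r) ∧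
  Tendsto (fun r => ρ₂ r / ρ₁ r) atTop (nhds 0)

/-- `Y` is `(ρ₁,ρ₂)`-contracting inside the subspace `X` (with the metric induced by the
word metric of `S`): whenever `x, x' ∈ X` satisfy `d(x,x') ≤ ρ₁(d(x,Y))`, the projections
`π(x) ∪ π(x')` have diameter at most `ρ₂(d(x,Y))`. -/
def ContractingIn {G : Type*} [Group G] (S : Set G) (X Y : Set G) (ρ₁ ρ₂ : ℝ → ℝ) : Prop :=
  Admissible ρ₁ ρ₂ ∧
  ∀ x ∈ X, ∀ x' ∈ X, wdist S x x' ≤ ρ₁ (setDist S x Y) →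
    ∀ y ∈ proj S Y x ∪ proj S Y x', ∀ y' ∈ proj S Y x ∪ proj S Y x',
      wdist S y y' ≤ ρ₂ (setDist S x Y)

/-- `Y` is `(ρ₁,ρ₂)`-contracting in `Cay(G,S)`. -/
def ContractingWith {G : Type*} [Group G] (S : Set G) (ρ₁ ρ₂ : ℝ → ℝ) (Y : Set G) : Prop :=
  ContractingIn S Set.univ Y ρ₁ ρ₂

/-- `Y` is strongly contracting: `(r, C)`-contracting for some constant `C`. -/
def StronglyContracting {G : Type*} [Group G] (S : Set G) (Y : Set G) : Prop :=
  ∃ C : ℝ, ContractingWith S (fun r => r) (fun _ => C) Y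

/-- A sublinear function: non-decreasing, eventually non-negative, `f(r)/r → 0`. -/
def Sublinear (f : ℝ → ℝ) : Prop :=
  Monotone f ∧ (∀ᶠ r in atTop, 0 ≤ f r) ∧ Tendsto (fun r => f r / r) atTop (nhds 0)

/-- `f ⪯ g`: there are constants `C₁, C₂ > 0` and `C₃, C₄ ≥ 0` with
`f(x) ≤ C₁ g(C₂ x + C₃) + C₄` for all `x`. -/
def Preceq (f g : ℝ → ℝ) : Prop :=
  ∃ C₁ C₂ C₃ C₄ : ℝ, 0 < C₁ ∧ 0 < C₂ ∧ 0 ≤ C₃ ∧ 0 ≤ C₄ ∧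
    ∀ x : ℝ, f x ≤ C₁ * g (C₂ * x + C₃) + C₄

/-- `f ≍ g`: `f ⪯ g` and `g ⪯ f`. -/
def Asymp (f g : ℝ → ℝ) : Prop := Preceq f g ∧ Preceq g f

/-- `α ⊆ G` is a geodesic of `Cay(G,S)`: the image of an isometric embedding of a
subinterval of `ℤ` into `(G, d_S)`. -/
def IsGeodesic {G : Type*} [Group G] (S : Set G) (α : Set G) : Prop :=
  ∃ (I : Set ℤ) (γ : ℤ → G), I.OrdConnected ∧
    (∀ m ∈ I, ∀ n ∈ I, wdist S (γ m) (γ n) = |(m : ℝ) - (n : ℝ)|) ∧ α = γ '' I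

/-- `α ⊆ G` is a bi-infinite geodesic of `Cay(G,S)`. -/
def IsBiInfGeodesic {G : Type*} [Group G] (S : Set G) (α : Set G) : Prop :=
  ∃ γ : ℤ → G, (∀ m n : ℤ, wdist S (γ m) (γ n) = |(m : ℝ) - (n : ℝ)|) ∧ α = Set.range γ

/-- `Y` is Morse: there is `μ` such that every `(L,A)`-quasi-geodesic with endpoints on
`Y` stays in the `μ(L,A)`-neighborhood of `Y`. -/
def IsMorse {G : Type*} [Group G] (S : Set G) (Y : Set G) : Prop :=
  ∃ μ : ℝ → ℝ → ℝ, ∀ L A : ℝ, 1 ≤ L → 0 ≤ A →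
    ∀ (q : ℤ → G) (m n : ℤ), m ≤ n → q m ∈ Y → q n ∈ Y →
    (∀ i j : ℤ, m ≤ i → i ≤ n → m ≤ j → j ≤ n →
      L⁻¹ * |(i : ℝ) - (j : ℝ)| - A ≤ wdist S (q i) (q j) ∧
      wdist S (q i) (q j) ≤ L * |(i : ℝ) - (j : ℝ)| + A) →
    ∀ i : ℤ, m ≤ i → i ≤ n → setDist S (q i) Y ≤ μ L A

/-- Two subsets are at finite Hausdorff distance in the word metric. -/
def FinHausdorffDist {G : Type*} [Group G] (S : Set G) (A B : Set G) : Prop :=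
  ∃ ε : ℝ, (∀ a ∈ A, ∃ b ∈ B, wdist S a b ≤ ε) ∧ ∀ b ∈ B, ∃ a ∈ A, wdist S a b ≤ ε

/-- The embedded relator cycle determined by `g ∈ G(Γ)` and a relator `r`:
the set `{g ⋅ p̄ : p a prefix of r}`. -/
def relatorCycle {S : Type} (P : C6Presentation S) (g : P.Grp) (r : Word S) :
    Set P.Grp :=
  {x | ∃ p : Word S, p <+: r ∧ x = g * P.elt p}

/-- A geodesic `α` is locally `(ρ₁,ρ₂)`-contracting: for every embedded relator cycle
`Γ₀` meeting `α`, the set `Γ₀ ∩ α` is `(ρ₁,ρ₂)`-contracting as a subspace of `Γ₀`. -/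
def LocallyContracting {S : Type} (P : C6Presentation S) (α : Set P.Grp)
    (ρ₁ ρ₂ : ℝ → ℝ) : Prop :=
  ∀ (g : P.Grp) (r : Word S), r ∈ P.rels → (relatorCycle P g r ∩ α).Nonempty →
    ContractingIn P.gens (relatorCycle P g r) (relatorCycle P g r ∩ α) ρ₁ ρ₂

/-- The generating set `S ∪ W` of the coned-off space: `W` is the set of elements
represented by subwords of cyclic permutations of relators (equivalently, by prefixes
of relators, since the relator set is closed under cyclic permutation). -/
def conedGens {S : Type} (P : C6Presentation S) : Set P.Grp :=
  P.gens ∪ {x | ∃ r ∈ P.rels, ∃ p : Word S, p <+: r ∧ x = P.elt p}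

/-- The exponential growth rate of `(G,S)`. -/
noncomputable def growthRate {G : Type*} [Group G] (S : Set G) : ℝ :=
  limsup (fun n : ℕ => Real.log (Nat.card {g : G // wordLength S g ≤ n}) / (n : ℝ)) atTop

/-- Quasi-isometry of marked groups `(G,S)` and `(H,T)` via word metrics. -/
def QIsom {G H : Type*} [Group G] [Group H] (S : Set G) (T : Set H) : Prop :=
  ∃ (f : G → H) (L A : ℝ), 1 ≤ L ∧ 0 ≤ A ∧
    (∀ x y : G, L⁻¹ * wdist S x y - A ≤ wdist T (f x) (f y) ∧
      wdist T (f x) (f y) ≤ L * wdist S x y + A) ∧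
    ∀ h : H, ∃ x : G, wdist T (f x) h ≤ A

/-- A subgroup is virtually cyclic if it contains a cyclic subgroup of finite index. -/
def VirtuallyCyclic {G : Type*} [Group G] (E : Subgroup G) : Prop :=
  ∃ g : G, Subgroup.zpowers g ≤ E ∧ ((Subgroup.zpowers g).subgroupOf E).index ≠ 0

end GSC

namespace GSC

section Words

variable {S : Type}

/-- The inverse of a letter. -/
def li (a : S × Bool) : S × Bool := (a.1, !a.2)

@[simp] lemma li_li (a : S × Bool) : li (li a) = a := by simp [li]

lemma li_ne (a : S × Bool) : li a ≠ a := by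
  intro h; have := congrArg Prod.snd h; simp [li] at this

lemma eq_li_comm {a b : S × Bool} : a = li b ↔ b = li a :=
  ⟨fun h => by rw [h, li_li], fun h => by rw [h, li_li]⟩

lemma wordInv_eq (w : Word S) : wordInv w = (w.map li).reverse := rfl

@[simp] lemma wordInv_nil : wordInv ([] : Word S) = [] := rfl

@[simp] lemma wordInv_append (u v : Word S) : wordInv (u ++ v) = wordInv v ++ wordInv u := by
  simp [wordInv_eq]

lemma wordInv_cons (a : S × Bool) (v : Word S) : wordInv (a :: v) = wordInv v ++ [li a] := by
  simp [wordInv_eq]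

@[simp] lemma wordInv_singleton (a : S × Bool) : wordInv [a] = [li a] := rfl

@[simp] lemma wordInv_wordInv (w : Word S) : wordInv (wordInv w) = w := by
  simp [wordInv_eq, Function.comp_def]

@[simp] lemma length_wordInv (w : Word S) : (wordInv w).length = w.length := by
  simp [wordInv_eq]

@[simp] lemma wordInv_eq_nil {w : Word S} : wordInv w = [] ↔ w = [] := by
  simp [wordInv_eq]

lemma reduced_iff {w : Word S} : Reduced w ↔ w.IsChain (fun a b => b ≠ li a) := by
  unfold Reduced
  have : (fun a b : S × Bool => a.1 ≠ b.1 ∨ a.2 = b.2) = fun a b => b ≠ li a := by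
    funext a b
    rcases a with ⟨a, p⟩; rcases b with ⟨b, q⟩
    simp only [li, ne_eq, Prod.mk.injEq, not_and, eq_iff_iff]
    cases p <;> cases q <;> simp [eq_comm]
  rw [this]; rfl

lemma reduced_iff_freeGroup {w : Word S} : Reduced w ↔ FreeGroup.IsReduced w := by
  unfold Reduced FreeGroup.IsReduced
  have : (fun a b : S × Bool => a.1 ≠ b.1 ∨ a.2 = b.2) = fun a b => a.1 = b.1 → a.2 = b.2 := by
    funext a b; simp only [eq_iff_iff]; tauto
  rw [this]; rfl

@[simp] lemma reduced_nil : Reduced ([] : Word S) := by simp [reduced_iff]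

@[simp] lemma reduced_singleton (a : S × Bool) : Reduced [a] := by simp [reduced_iff]

lemma reduced_cons_cons {a b : S × Bool} {w : Word S} :
    Reduced (a :: b :: w) ↔ b ≠ li a ∧ Reduced (b :: w) := by
  simp [reduced_iff]

lemma Reduced.infix {u w : Word S} (h : Reduced w) (hu : u <:+: w) : Reduced u := by
  rw [reduced_iff] at *; exact h.infix hu

lemma Reduced.left {u w : Word S} (h : Reduced (u ++ w)) : Reduced u :=
  h.infix (List.prefix_append u w).isInfix

lemma Reduced.right {u w : Word S} (h : Reduced (u ++ w)) : Reduced w :=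
  h.infix (List.suffix_append u w).isInfix

lemma reduced_append {u v : Word S} :
    Reduced (u ++ v) ↔ Reduced u ∧ Reduced v ∧
      ∀ a ∈ u.getLast?, ∀ b ∈ v.head?, b ≠ li a := by
  simp only [reduced_iff, List.isChain_append]

lemma Reduced.append_overlap {u v w : Word S} (h1 : Reduced (u ++ v)) (h2 : Reduced (v ++ w))
    (hv : v ≠ []) : Reduced (u ++ v ++ w) := by
  rw [reduced_iff] at *
  exact List.IsChain.append_overlap h1 h2 hv

lemma Reduced.wordInv {w : Word S} (h : Reduced w) : Reduced (wordInv w) := by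
  rw [reduced_iff] at *
  rw [wordInv_eq, List.isChain_reverse, List.isChain_map]
  refine List.IsChain.imp ?_ h
  intro a b hab
  simpa [flip, eq_li_comm, eq_comm] using hab

lemma reduced_wordInv {w : Word S} : Reduced (GSC.wordInv w) ↔ Reduced w :=
  ⟨fun h => by simpa using h.wordInv, fun h => h.wordInv⟩

lemma getLast?_wordInv (w : Word S) : (wordInv w).getLast? = w.head?.map li := by
  cases w with
  | nil => rfl
  | cons a w => simp [wordInv_cons]

lemma head?_wordInv (w : Word S) : (wordInv w).head? = w.getLast?.map li := by
  rw [← wordInv_wordInv w, getLast?_wordInv, wordInv_wordInv]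
  cases (GSC.wordInv w).head? <;> simp

lemma IsPrefix.wordInv {u v : Word S} (h : u <+: v) : wordInv u <:+ wordInv v := by
  obtain ⟨t, rfl⟩ := h; simp

lemma IsSuffix.wordInv {u v : Word S} (h : u <:+ v) : wordInv u <+: wordInv v := by
  obtain ⟨t, rfl⟩ := h; simp

lemma IsInfix.wordInv {u v : Word S} (h : u <:+: v) : wordInv u <:+: wordInv v := by
  obtain ⟨t, s, rfl⟩ := h
  refine ⟨GSC.wordInv s, GSC.wordInv t, by simp⟩

lemma cyclicallyReduced_rotate {w : Word S} (h : CyclicallyReduced w) (n : ℕ) :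
    CyclicallyReduced (w.rotate n) := by
  unfold CyclicallyReduced at *
  rcases eq_or_ne w [] with rfl | hw
  · simp
  have h3 : Reduced (w ++ w ++ w) := h.append_overlap h hw
  rw [← List.rotate_mod]
  have hn : n % w.length ≤ w.length := (Nat.mod_lt _ (List.length_pos_iff.2 hw)).le
  rw [List.rotate_eq_drop_append_take hn]
  refine h3.infix ⟨w.take (n % w.length), w.drop (n % w.length), ?_⟩
  have := List.take_append_drop (n % w.length) w
  simp only [← List.append_assoc, this]
  simp only [List.append_assoc, this]

lemma CyclicallyReduced.reduced {w : Word S} (h : CyclicallyReduced w) : Reduced w :=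
  Reduced.left h

lemma exists_reduced_red (w : Word S) : ∃ u, FreeGroup.Red w u ∧ Reduced u := by
  classical
  exact ⟨FreeGroup.reduce w, FreeGroup.reduce.red, reduced_iff_freeGroup.2 (FreeGroup.isReduced_iff_reduce_eq.2 FreeGroup.reduce.idem)⟩

end Words

section Elt

variable {S : Type} (P : C6Presentation S)

lemma wordVal_eq_mk (w : Word S) : wordVal w = FreeGroup.mk w := by
  induction w with
  | nil => rfl
  | cons a w ih =>
    have h : wordVal (a :: w) = (FreeGroup.of a.1) ^ (if a.2 then (1 : ℤ) else -1) * wordVal w := by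
      simp [wordVal]
    rw [h, ih]
    rcases a with ⟨a, b⟩
    cases b
    · simp [FreeGroup.of, FreeGroup.invRev]
    · simp [FreeGroup.of]

lemma elt_eq_mk (w : Word S) : P.elt w = PresentedGroup.mk _ (wordVal w) := by
  unfold C6Presentation.elt wordVal
  rw [map_list_prod, List.map_map]
  congr 1

@[simp] lemma elt_nil : P.elt ([] : Word S) = 1 := by simp [C6Presentation.elt]

@[simp] lemma elt_append (u v : Word S) : P.elt (u ++ v) = P.elt u * P.elt v := by
  simp [C6Presentation.elt]

lemma elt_cons (a : S × Bool) (v : Word S) : P.elt (a :: v) = P.elt [a] * P.elt v := by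
  rw [← elt_append]; rfl

lemma elt_li (a : S × Bool) : P.elt [li a] = (P.elt [a])⁻¹ := by
  rcases a with ⟨a, b⟩
  cases b <;> simp [C6Presentation.elt, li]

@[simp] lemma elt_wordInv (w : Word S) : P.elt (wordInv w) = (P.elt w)⁻¹ := by
  induction w with
  | nil => simp
  | cons a w ih => rw [wordInv_cons, elt_append, ih, elt_li, elt_cons P a w]; simp

lemma elt_rel {r : Word S} (hr : r ∈ P.rels) : P.elt r = 1 := by
  rw [elt_eq_mk]
  exact PresentedGroup.one_of_mem ⟨r, hr, rfl⟩

lemma elt_eq_one_iff (w : Word S) :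
    P.elt w = 1 ↔ FreeGroup.mk w ∈ Subgroup.normalClosure (wordVal '' P.rels) := by
  rw [elt_eq_mk, wordVal_eq_mk]
  exact PresentedGroup.mk_eq_one_iff

lemma elt_red {u v : Word S} (h : FreeGroup.Red u v) : P.elt u = P.elt v := by
  rw [elt_eq_mk, elt_eq_mk, wordVal_eq_mk, wordVal_eq_mk, FreeGroup.Red.exact.2 ⟨v, h, .refl⟩]

lemma exists_elt (g : P.Grp) : ∃ w : Word S, Reduced w ∧ P.elt w = g := by
  obtain ⟨x, rfl⟩ := PresentedGroup.mk_surjective _ g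
  induction x using Quot.inductionOn with
  | h w =>
    obtain ⟨u, hu, hr⟩ := exists_reduced_red w
    exact ⟨u, hr, by rw [← elt_red P hu, elt_eq_mk, wordVal_eq_mk]; rfl⟩

end Elt

section Rels

variable {S : Type} {P : C6Presentation S}

lemma rel_reduced {r : Word S} (hr : r ∈ P.rels) : Reduced r :=
  (P.cyclically_reduced r hr).reduced

lemma rel_rot {u v : Word S} (h : u ++ v ∈ P.rels) : v ++ u ∈ P.rels := by
  have := P.rotate_mem _ h u.length
  rwa [List.rotate_append_length_eq] at this

/-- Two distinct relators have a short common prefix. -/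
lemma piece_lt {r r' u : Word S} (hr : r ∈ P.rels) (hr' : r' ∈ P.rels) (hne : r ≠ r')
    (hu : u <+: r) (hu' : u <+: r') : 6 * u.length < r.length :=
  P.small_cancellation r hr u hu ⟨r, hr, r', hr', hne, hu, hu'⟩

lemma piece_lt_append {u v v' : Word S} (hr : u ++ v ∈ P.rels) (hr' : u ++ v' ∈ P.rels)
    (hne : v ≠ v') : 6 * u.length < (u ++ v).length :=
  piece_lt hr hr' (by simpa using hne) (List.prefix_append _ _) (List.prefix_append _ _)

end Rels

end GSC

namespace GSC

/-- Vertices, labels and edge involution of a diagram whose darts are natural numbers. -/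
structure DartData {S : Type} (P : C6Presentation S) where
  lab : ℕ → S × Bool
  inv : ℕ → ℕ
  src : ℕ → ℕ
  pos : ℕ → P.Grp

section Diagrams

variable {S : Type} {P : C6Presentation S}

/-- The list of darts `l` is a path from `p` to `q`. -/
def DartData.IsPath (d : DartData P) : ℕ → List ℕ → ℕ → Prop
  | p, [], q => p = q
  | p, x :: l, q => d.src x = p ∧ d.IsPath (d.src (d.inv x)) l q

lemma DartData.isPath_append (d : DartData P) {p q : ℕ} {a b : List ℕ} :
    d.IsPath p (a ++ b) q ↔ ∃ m, d.IsPath p a m ∧ d.IsPath m b q := by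
  induction a generalizing p with
  | nil => simp [DartData.IsPath]
  | cons x a ih => simp [DartData.IsPath, ih, and_assoc]

lemma DartData.IsPath.map {d d' : DartData P} {f : ℕ → ℕ} {l : List ℕ} {p q : ℕ}
    (h : d.IsPath p l q)
    (h1 : ∀ x ∈ l, d'.src x = f (d.src x) ∧ d'.src (d'.inv x) = f (d.src (d.inv x))) :
    d'.IsPath (f p) l (f q) := by
  induction l generalizing p with
  | nil => simp only [IsPath] at *; rw [h]
  | cons x l ih =>
    simp only [IsPath] at *
    obtain ⟨h2, h3⟩ := h1 x (by simp)
    refine ⟨by rw [h2, h.1], ?_⟩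
    rw [h3]
    exact ih h.2 fun y hy => h1 y (by simp [hy])

lemma DartData.IsPath.sum {d : DartData P} {φ ψ : ℕ → ℚ} {l : List ℕ} {p q : ℕ}
    (h : d.IsPath p l q) (h1 : ∀ x ∈ l, φ x = ψ (d.src (d.inv x)) - ψ (d.src x)) :
    (l.map φ).sum = ψ q - ψ p := by
  induction l generalizing p with
  | nil => simp only [IsPath] at h; simp [h]
  | cons x l ih =>
    simp only [IsPath] at h
    simp only [List.map_cons, List.sum_cons]
    rw [ih h.2 (fun y hy => h1 y (by simp [hy])), h1 x (by simp), h.1]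
    ring

/-- A diagram with the given boundary cycles of faces: edges are paired up by `inv`, faces are
closed paths, `pos` maps it to the Cayley graph, and the first rational cohomology vanishes. -/
structure DartData.Ok (d : DartData P) (F : List (List ℕ)) : Prop where
  nodup : F.flatten.Nodup
  inv_mem : ∀ x ∈ F.flatten, d.inv x ∈ F.flatten
  inv_inv : ∀ x ∈ F.flatten, d.inv (d.inv x) = x
  lab_inv : ∀ x ∈ F.flatten, d.lab (d.inv x) = li (d.lab x)
  pos_inv : ∀ x ∈ F.flatten, d.pos (d.src (d.inv x)) = d.pos (d.src x) * P.elt [d.lab x]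
  path : ∀ f ∈ F, ∃ p, d.IsPath p f p
  h1 : ∀ φ : ℕ → ℚ, (∀ x ∈ F.flatten, φ (d.inv x) = - φ x) → (∀ f ∈ F, (f.map φ).sum = 0) →
    ∃ ψ : ℕ → ℚ, ∀ x ∈ F.flatten, φ x = ψ (d.src (d.inv x)) - ψ (d.src x)

/-- There is a diagram whose faces have the given boundary labels. -/
def Dia (P : C6Presentation S) (F : List (Word S)) : Prop :=
  ∃ (d : DartData P) (G : List (List ℕ)), d.Ok G ∧ G.map (List.map d.lab) = F

lemma DartData.IsPath.pos {d : DartData P} {F : List (List ℕ)} (hd : d.Ok F) {l : List ℕ} {p q : ℕ}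
    (h : d.IsPath p l q) (hl : ∀ x ∈ l, x ∈ F.flatten) :
    d.pos q = d.pos p * P.elt (l.map d.lab) := by
  induction l generalizing p with
  | nil => simp only [IsPath] at h; simp [h]
  | cons x l ih =>
    simp only [IsPath] at h
    rw [ih h.2 (fun y hy => hl y (by simp [hy])), List.map_cons, elt_cons,
      hd.pos_inv x (hl x (by simp)), h.1, mul_assoc]

lemma DartData.Ok.perm {d : DartData P} {F G : List (List ℕ)} (h : d.Ok F) (hp : F.Perm G) :
    d.Ok G := by
  have hm : ∀ x, x ∈ G.flatten ↔ x ∈ F.flatten := fun x => hp.flatten.mem_iff.symm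
  have hm' : ∀ x, x ∈ G ↔ x ∈ F := fun x => hp.mem_iff.symm
  refine ⟨hp.flatten.nodup_iff.1 h.nodup, ?_, ?_, ?_, ?_, ?_, ?_⟩
  · simpa only [hm] using h.inv_mem
  · simpa only [hm] using h.inv_inv
  · simpa only [hm] using h.lab_inv
  · simpa only [hm] using h.pos_inv
  · simpa only [hm'] using h.path
  · simpa only [hm, hm'] using h.h1

lemma DartData.Ok.rotate {d : DartData P} {a b : List ℕ} {F : List (List ℕ)}
    (h : d.Ok ((a ++ b) :: F)) : d.Ok ((b ++ a) :: F) := by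
  have hm : ∀ x, x ∈ ((b ++ a) :: F).flatten ↔ x ∈ ((a ++ b) :: F).flatten := by
    intro x; simp; tauto
  have hp : ((a ++ b) :: F).flatten.Perm ((b ++ a) :: F).flatten := by
    simp only [List.flatten_cons]
    exact List.Perm.append_right _ List.perm_append_comm
  refine ⟨hp.nodup_iff.1 h.nodup, ?_, ?_, ?_, ?_, ?_, ?_⟩
  · simpa only [hm] using h.inv_mem
  · simpa only [hm] using h.inv_inv
  · simpa only [hm] using h.lab_inv
  · simpa only [hm] using h.pos_inv
  · intro f hf
    rcases List.mem_cons.1 hf with rfl | hf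
    · obtain ⟨p, hp⟩ := h.path _ List.mem_cons_self
      obtain ⟨m, h1, h2⟩ := d.isPath_append.1 hp
      exact ⟨m, d.isPath_append.2 ⟨p, h2, h1⟩⟩
    · exact h.path f (by simp [hf])
  · simp only [hm]
    intro φ h1 h2
    apply h.h1 φ h1
    intro f hf
    rcases List.mem_cons.1 hf with rfl | hf
    · have := h2 _ List.mem_cons_self
      simp only [List.map_append, List.sum_append] at *
      linarith
    · exact h2 f (by simp [hf])

lemma DartData.Ok.drop_nil {d : DartData P} {F : List (List ℕ)}
    (h : d.Ok ([] :: F)) : d.Ok F := by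
  have hm : ([] :: F).flatten = F.flatten := by simp
  refine ⟨hm ▸ h.nodup, hm ▸ h.inv_mem, hm ▸ h.inv_inv, hm ▸ h.lab_inv, hm ▸ h.pos_inv,
    fun f hf => h.path f (by simp [hf]), ?_⟩
  intro φ h1 h2
  rw [← hm] at h1 ⊢
  exact h.h1 φ h1 (by simpa using h2)

lemma DartData.Ok.merge {d : DartData P} {x : ℕ} {A B : List ℕ} {F : List (List ℕ)}
    (h : d.Ok ((x :: A) :: (d.inv x :: B) :: F)) : d.Ok ((A ++ B) :: F) := by
  have hnd := h.nodup
  simp only [List.flatten_cons, List.cons_append] at hnd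
  have hp : (x :: (A ++ d.inv x :: (B ++ F.flatten))).Perm
      (x :: d.inv x :: ((A ++ B) :: F).flatten) := by
    refine List.Perm.cons _ ?_
    simp
  have hnd2 := hp.nodup_iff.1 hnd
  simp only [List.nodup_cons, List.mem_cons, not_or] at hnd2
  set D := ((A ++ B) :: F).flatten with hD
  have hm : ∀ y, y ∈ ((x :: A) :: (d.inv x :: B) :: F).flatten ↔ y = x ∨ y = d.inv x ∨ y ∈ D := by
    intro y
    have := hp.mem_iff (a := y)
    simpa using this
  have hsub : ∀ y ∈ D, y ∈ ((x :: A) :: (d.inv x :: B) :: F).flatten := fun y hy => by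
    rw [hm]; tauto
  have hx : x ∈ ((x :: A) :: (d.inv x :: B) :: F).flatten := by simp
  have hinv : ∀ y ∈ D, d.inv y ∈ D := by
    intro y hy
    have h1 := (hm _).1 (h.inv_mem y (hsub y hy))
    rcases h1 with h1 | h1 | h1
    · exfalso
      have : y = d.inv x := by rw [← h1, h.inv_inv y (hsub y hy)]
      exact hnd2.2.1 (this ▸ hy)
    · exfalso
      have : y = x := by rw [← h.inv_inv y (hsub y hy), h1, h.inv_inv x hx]
      exact hnd2.1.2 (this ▸ hy)
    · exact h1
  refine ⟨hnd2.2.2, hinv, fun y hy => h.inv_inv y (hsub y hy), fun y hy => h.lab_inv y (hsub y hy),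
    fun y hy => h.pos_inv y (hsub y hy), ?_, ?_⟩
  · intro f hf
    rcases List.mem_cons.1 hf with rfl | hf
    · obtain ⟨p, hp1, hp2⟩ := h.path _ List.mem_cons_self
      obtain ⟨q, hq1, hq2⟩ := h.path (d.inv x :: B) (by simp)
      rw [h.inv_inv x hx] at hq2
      refine ⟨d.src (d.inv x), d.isPath_append.2 ⟨p, hp2, ?_⟩⟩
      rw [hp1] at hq2; rw [hq1]; exact hq2
    · exact h.path f (by simp [hf])
  · intro φ h1 h2
    set φ' : ℕ → ℚ := fun y => if y = x then -(A.map φ).sum else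
      if y = d.inv x then (A.map φ).sum else φ y with hφ'
    have hon : ∀ y ∈ D, φ' y = φ y := by
      intro y hy
      have h3 : y ≠ x := fun h => hnd2.1.2 (h ▸ hy)
      have h4 : y ≠ d.inv x := fun h => hnd2.2.1 (h ▸ hy)
      simp [hφ', h3, h4]
    have hne : d.inv x ≠ x := fun h => hnd2.1.1 h.symm
    have hmap : ∀ l : List ℕ, (∀ y ∈ l, y ∈ D) → l.map φ' = l.map φ := fun l hl =>
      List.map_congr_left fun y hy => hon y (hl y hy)
    have hA : A.map φ' = A.map φ := hmap A fun y hy => by simp [hD, hy]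
    have hB : B.map φ' = B.map φ := hmap B fun y hy => by simp [hD, hy]
    have hAB : (A.map φ).sum + (B.map φ).sum = 0 := by
      simpa using h2 _ List.mem_cons_self
    have hx1 : φ' x = -(A.map φ).sum := by simp [hφ']
    have hx2 : φ' (d.inv x) = (A.map φ).sum := by simp [hφ', hne]
    obtain ⟨ψ, hψ⟩ := h.h1 φ' (by
      intro y hy
      rcases (hm y).1 hy with rfl | rfl | hy
      · simp [hφ', hne]
      · rw [h.inv_inv x hx]; simp [hφ', hne]
      · rw [hon y hy, hon _ (hinv y hy), h1 y hy]) (by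
      intro f hf
      simp only [List.mem_cons] at hf
      rcases hf with rfl | rfl | hf
      · rw [List.map_cons, List.sum_cons, hA, hx1, neg_add_cancel]
      · rw [List.map_cons, List.sum_cons, hB, hx2, hAB]
      · rw [hmap f fun y hy => by simp only [hD, List.flatten_cons, List.mem_append]; right
                                  exact List.mem_flatten.2 ⟨f, hf, hy⟩]
        exact h2 f (by simp [hf]))
    exact ⟨ψ, fun y hy => by rw [← hon y hy, hψ y (hsub y hy)]⟩


lemma exists_perm_map {α β : Type*} (f : α → β) {l : List α} {m : List β}
    (h : (l.map f).Perm m) : ∃ l', l.Perm l' ∧ l'.map f = m := by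
  generalize hk : l.map f = k at h
  induction h generalizing l with
  | nil => exact ⟨l, .refl _, hk⟩
  | cons x h ih =>
    obtain ⟨a, l, rfl, rfl, rfl⟩ := List.map_eq_cons_iff.1 hk
    obtain ⟨l', h1, rfl⟩ := ih rfl
    exact ⟨a :: l', h1.cons a, rfl⟩
  | swap x y l₀ =>
    obtain ⟨a, l, rfl, rfl, h2⟩ := List.map_eq_cons_iff.1 hk
    obtain ⟨b, l, rfl, rfl, rfl⟩ := List.map_eq_cons_iff.1 h2
    exact ⟨b :: a :: l, List.Perm.swap _ _ _, rfl⟩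
  | trans h1 h2 ih1 ih2 =>
    obtain ⟨l1, h3, h4⟩ := ih1 hk
    obtain ⟨l2, h5, h6⟩ := ih2 h4
    exact ⟨l2, h3.trans h5, h6⟩

lemma Dia.perm {F G : List (Word S)} (h : Dia P F) (hp : F.Perm G) : Dia P G := by
  obtain ⟨d, F', h1, rfl⟩ := h
  obtain ⟨G', hG, h2⟩ := exists_perm_map _ hp
  exact ⟨d, G', h1.perm hG, h2⟩

lemma dia_cons {l : Word S} {F : List (Word S)} :
    Dia P (l :: F) ↔ ∃ (d : DartData P) (f : List ℕ) (G : List (List ℕ)),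
      d.Ok (f :: G) ∧ f.map d.lab = l ∧ G.map (List.map d.lab) = F := by
  constructor
  · rintro ⟨d, G, h1, h2⟩
    obtain ⟨f, G, rfl, rfl, rfl⟩ := List.map_eq_cons_iff.1 h2
    exact ⟨d, f, G, h1, rfl, rfl⟩
  · rintro ⟨d, f, G, h1, rfl, rfl⟩
    exact ⟨d, f :: G, h1, rfl⟩

lemma Dia.rotate {a b : Word S} {F : List (Word S)} (h : Dia P ((a ++ b) :: F)) :
    Dia P ((b ++ a) :: F) := by
  obtain ⟨d, f, G, h1, h2, rfl⟩ := dia_cons.1 h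
  obtain ⟨f1, f2, rfl, rfl, rfl⟩ := List.map_eq_append_iff.1 h2
  exact dia_cons.2 ⟨d, _, G, h1.rotate, by simp, rfl⟩

lemma Dia.drop_nil {F : List (Word S)} (h : Dia P ([] :: F)) : Dia P F := by
  obtain ⟨d, f, G, h1, h2, rfl⟩ := dia_cons.1 h
  obtain rfl := List.map_eq_nil_iff.1 h2
  exact ⟨d, G, h1.drop_nil, rfl⟩

lemma dia_nil (s : S) : Dia P [[]] :=
  ⟨⟨fun _ => (s, true), id, id, fun _ => 1⟩, [[]], by constructor <;> simp [DartData.IsPath], rfl⟩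

lemma Dia.spur {l : Word S} {F : List (Word S)} (h : Dia P (l :: F)) (s : S × Bool) :
    Dia P ((s :: li s :: l) :: F) := by
  obtain ⟨d, f, G, hd, rfl, rfl⟩ := dia_cons.1 h
  obtain ⟨p, hp⟩ := hd.path _ List.mem_cons_self
  obtain ⟨N, hN⟩ : ∃ N, ∀ x ∈ (f :: G).flatten, x < N := by
    refine ⟨(f :: G).flatten.sum + 1, fun x hx => Nat.lt_succ_of_le (List.single_le_sum (by simp) _ hx)⟩
  obtain ⟨v, hv⟩ : ∃ v, v ≠ p ∧ ∀ x ∈ (f :: G).flatten, d.src x ≠ v := by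
    obtain ⟨v, hv⟩ := Infinite.exists_notMem_finset (insert p ((f :: G).flatten.map d.src).toFinset)
    refine ⟨v, fun h => hv (by simp [h]), fun x hx h => hv ?_⟩
    rw [Finset.mem_insert, List.mem_toFinset, List.mem_map]
    exact Or.inr ⟨x, hx, h⟩
  set D := (f :: G).flatten with hD
  set d' : DartData P :=
    ⟨fun x => if x = N then s else if x = N + 1 then li s else d.lab x,
     fun x => if x = N then N + 1 else if x = N + 1 then N else d.inv x,
     fun x => if x = N then p else if x = N + 1 then v else d.src x,
     fun x => if x = v then d.pos p * P.elt [s] else d.pos x⟩ with hd'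
  have hm : ∀ y, y ∈ ((N :: (N + 1) :: f) :: G).flatten ↔ y = N ∨ y = N + 1 ∨ y ∈ D := by
    intro y; simp [hD]
  have hne : ∀ y ∈ D, y ≠ N ∧ y ≠ N + 1 := fun y hy => by have := hN y hy; omega
  have hlab : ∀ y ∈ D, d'.lab y = d.lab y := fun y hy => by simp [hd', hne y hy]
  have hinv : ∀ y ∈ D, d'.inv y = d.inv y := fun y hy => by simp [hd', hne y hy]
  have hsrc : ∀ y ∈ D, d'.src y = d.src y := fun y hy => by simp [hd', hne y hy]
  have hpath : ∀ {l p q}, (∀ y ∈ l, y ∈ D) → d.IsPath p l q → d'.IsPath p l q := by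
    intro l p q hl h
    refine h.map (f := id) fun x hx => ?_
    rw [hinv x (hl x hx), hsrc x (hl x hx), hsrc _ (hd.inv_mem x (hl x hx))]
    simp
  have hpos : ∀ y ∈ D, d'.pos (d.src y) = d.pos (d.src y) := fun y hy => by
    simp [hd', hv.2 y hy]
  have hN1 : d'.inv N = N + 1 := by simp [hd']
  have hN2 : d'.inv (N + 1) = N := by simp [hd']
  have hN3 : d'.lab N = s := by simp [hd']
  have hN4 : d'.lab (N + 1) = li s := by simp [hd']
  have hN5 : d'.src N = p := by simp [hd']
  have hN6 : d'.src (N + 1) = v := by simp [hd']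
  have hN7 : d'.pos p = d.pos p := by simp [hd', hv.1.symm]
  have hN8 : d'.pos v = d.pos p * P.elt [s] := by simp [hd']
  have hfD : ∀ y ∈ f, y ∈ D := fun y hy => by simp [hD, hy]
  have hgD : ∀ g ∈ G, ∀ y ∈ g, y ∈ D := fun g hg y hy => by
    rw [hD, List.flatten_cons, List.mem_append]; right; exact List.mem_flatten.2 ⟨g, hg, hy⟩
  refine dia_cons.2 ⟨d', N :: (N + 1) :: f, G, ⟨?_, ?_, ?_, ?_, ?_, ?_, ?_⟩, ?_, ?_⟩
  · have : ((N :: (N + 1) :: f) :: G).flatten = N :: (N + 1) :: D := by simp [hD]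
    rw [this, List.nodup_cons, List.nodup_cons]
    refine ⟨?_, fun h => (hne _ h).2 rfl, hd.nodup⟩
    intro h
    rcases List.mem_cons.1 h with h | h
    · omega
    · exact (hne _ h).1 rfl
  · simp only [hm]
    rintro x (rfl | rfl | hx)
    · right; left; exact hN1
    · left; exact hN2
    · right; right; rw [hinv x hx]; exact hd.inv_mem x hx
  · simp only [hm]
    rintro x (rfl | rfl | hx)
    · rw [hN1, hN2]
    · rw [hN2, hN1]
    · rw [hinv x hx, hinv _ (hd.inv_mem x hx), hd.inv_inv x hx]
  · simp only [hm]
    rintro x (rfl | rfl | hx)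
    · rw [hN1, hN3, hN4]
    · rw [hN2, hN3, hN4, li_li]
    · rw [hinv x hx, hlab _ (hd.inv_mem x hx), hlab x hx, hd.lab_inv x hx]
  · simp only [hm]
    rintro x (rfl | rfl | hx)
    · rw [hN1, hN5, hN6, hN3, hN7, hN8]
    · rw [hN2, hN5, hN6, hN4, hN7, hN8, elt_li]; simp
    · rw [hinv x hx, hsrc _ (hd.inv_mem x hx), hsrc x hx, hlab x hx, hpos x hx,
        hpos _ (hd.inv_mem x hx), hd.pos_inv x hx]
  · intro g hg
    rcases List.mem_cons.1 hg with rfl | hg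
    · refine ⟨p, hN5, ?_, ?_⟩
      · rw [hN1]
      · rw [hN2, hN5]; exact hpath hfD hp
    · obtain ⟨q, hq⟩ := hd.path g (by simp [hg])
      exact ⟨q, hpath (hgD g hg) hq⟩
  · simp only [hm]
    intro φ h1 h2
    have hφN : φ (N + 1) = - φ N := by rw [← h1 N (Or.inl rfl), hN1]
    obtain ⟨ψ, hψ⟩ := hd.h1 φ (fun x hx => by rw [← h1 x (Or.inr (Or.inr hx)), hinv x hx]) (by
      intro g hg
      rcases List.mem_cons.1 hg with rfl | hg
      · have := h2 _ List.mem_cons_self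
        simp only [List.map_cons, List.sum_cons, hφN] at this
        linarith
      · exact h2 g (by simp [hg]))
    refine ⟨fun x => if x = v then ψ p + φ N else ψ x, ?_⟩
    rintro x (rfl | rfl | hx)
    · rw [hN1, hN5, hN6]; simp [hv.1.symm]
    · rw [hN2, hN5, hN6]; simp [hv.1.symm, hφN]
    · rw [hinv x hx, hsrc _ (hd.inv_mem x hx), hsrc x hx, hψ x hx]
      simp [hv.2 x hx, hv.2 _ (hd.inv_mem x hx)]
  · simp only [List.map_cons, hN3, hN4]
    rw [List.map_congr_left fun y hy => hlab y (hfD y hy)]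
  · refine List.map_congr_left fun g hg => List.map_congr_left fun y hy => hlab y (hgD g hg y hy)

lemma Dia.pinch {a b : Word S} {F : List (Word S)} (h : Dia P ((a ++ b) :: F))
    (ha : P.elt a = 1) : Dia P (a :: b :: F) := by
  obtain ⟨d, f, G, hd, h2, rfl⟩ := dia_cons.1 h
  obtain ⟨f1, f2, rfl, rfl, rfl⟩ := List.map_eq_append_iff.1 h2
  obtain ⟨u, hu⟩ := hd.path _ List.mem_cons_self
  obtain ⟨v, hu1, hu2⟩ := d.isPath_append.1 hu
  set D := ((f1 ++ f2) :: G).flatten with hD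
  have hm : (f1 :: f2 :: G).flatten = D := by simp [hD]
  have hf1 : ∀ y ∈ f1, y ∈ D := fun y hy => by simp [hD, hy]
  have hf2 : ∀ y ∈ f2, y ∈ D := fun y hy => by simp [hD, hy]
  have hposuv : d.pos v = d.pos u := by
    rw [hu1.pos hd hf1, ha, mul_one]
  set m : ℕ → ℕ := fun x => if x = v then u else x with hmdef
  have hmv : m v = u := by simp [hmdef]
  have hmu : m u = u := by simp [hmdef]
  set d' : DartData P := ⟨d.lab, d.inv, m ∘ d.src, d.pos⟩ with hd'
  have hposm : ∀ x, d.pos (m x) = d.pos x := fun x => by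
    by_cases hx : x = v
    · rw [hx, hmv, hposuv]
    · simp [hmdef, hx]
  have hpath : ∀ {l p q}, d.IsPath p l q → d'.IsPath (m p) l (m q) := by
    intro l p q h
    exact h.map fun x _ => ⟨rfl, rfl⟩
  refine ⟨d', f1 :: f2 :: G, ⟨?_, ?_, ?_, ?_, ?_, ?_, ?_⟩, rfl⟩
  · rw [hm]; exact hd.nodup
  · rw [hm]; exact hd.inv_mem
  · rw [hm]; exact hd.inv_inv
  · rw [hm]; exact hd.lab_inv
  · rw [hm]; intro x hx
    change d.pos (m _) = d.pos (m _) * _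
    rw [hposm, hposm]; exact hd.pos_inv x hx
  · intro g hg
    simp only [List.mem_cons] at hg
    rcases hg with rfl | rfl | hg
    · have := hpath hu1; rw [hmu, hmv] at this; exact ⟨u, this⟩
    · have := hpath hu2; rw [hmu, hmv] at this; exact ⟨u, this⟩
    · obtain ⟨q, hq⟩ := hd.path g (by simp [hg])
      exact ⟨_, hpath hq⟩
  · rw [hm]
    intro φ h1 h2
    obtain ⟨ψ, hψ⟩ := hd.h1 φ h1 (by
      intro g hg
      rcases List.mem_cons.1 hg with rfl | hg
      · have h3 := h2 f1 (by simp)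
        have h4 := h2 f2 (by simp)
        simp [h3, h4]
      · exact h2 g (by simp [hg]))
    have h3 := hu1.sum fun x hx => hψ x (hf1 x hx)
    rw [h2 f1 (by simp)] at h3
    have hψm : ∀ x, ψ (m x) = ψ x := fun x => by
      by_cases hx : x = v
      · rw [hx, hmv]; linarith
      · simp [hmdef, hx]
    refine ⟨ψ, fun x hx => ?_⟩
    change _ = ψ (m _) - ψ (m _)
    rw [hψm, hψm, hψ x hx]

lemma DartData.Ok.zip {d : DartData P} {x y : ℕ} {f : List ℕ} {G : List (List ℕ)}
    (hd : d.Ok ((x :: y :: f) :: G)) (hxy : d.lab y = li (d.lab x)) :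
    ∃ d' : DartData P, d'.lab = d.lab ∧ d'.Ok (f :: G) := by
  have hnd := hd.nodup
  have e1 : ((x :: y :: f) :: G).flatten = x :: y :: (f :: G).flatten := by simp
  obtain ⟨p, hp⟩ := hd.path _ List.mem_cons_self
  set D := (f :: G).flatten with hD
  have hnd := hd.nodup
  have hinv := hd.inv_mem
  have hii := hd.inv_inv
  have hli := hd.lab_inv
  have hpi := hd.pos_inv
  have hh1 := hd.h1
  rw [e1] at hnd hinv hii hli hpi hh1
  simp only [List.mem_cons, List.nodup_cons, not_or] at hnd hinv hii hli hpi hh1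
  obtain ⟨⟨hxy', hxD⟩, hyD, hnd⟩ := hnd
  simp only [DartData.IsPath] at hp
  obtain ⟨hp1, hp2, hp3⟩ := hp
  have hneD : ∀ z ∈ D, z ≠ x ∧ z ≠ y :=
    fun z hz => ⟨fun h => hxD (h ▸ hz), fun h => hyD (h ▸ hz)⟩
  have hxx : d.inv x ≠ x := fun h => li_ne (d.lab x) (by rw [← hli x (by simp), h])
  have hyy : d.inv y ≠ y := fun h => li_ne (d.lab y) (by rw [← hli y (by simp), h])
  have hinvx := hinv x (by simp)
  have hinvy := hinv y (by simp)
  have hiix := hii x (by simp)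
  have hiiy := hii y (by simp)
  set u := d.src x with hu
  set v := d.src (d.inv y) with hv
  have hposuv : d.pos v = d.pos u := by
    rw [hv, hpi y (by simp), hp2, hpi x (by simp), hxy, elt_li]; simp [hu]
  set m : ℕ → ℕ := fun z => if z = v then u else z with hmdef
  have hmv : m v = u := by simp [hmdef]
  have hmu : m u = u := by simp [hmdef]
  have hposm : ∀ z, d.pos (m z) = d.pos z := fun z => by
    by_cases hz : z = v
    · rw [hz, hmv, hposuv]
    · simp [hmdef, hz]
  set i' : ℕ → ℕ := fun z => if z = d.inv x then d.inv y else if z = d.inv y then d.inv x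
    else d.inv z with hi'
  have hi1 : i' (d.inv x) = d.inv y := by simp [hi']
  have hinj : d.inv x ≠ d.inv y := fun h => hxy' (by rw [← hiix, h, hiiy])
  have hi2 : i' (d.inv y) = d.inv x := by simp [hi', hinj.symm]
  have hi3 : ∀ z, z ≠ d.inv x → z ≠ d.inv y → i' z = d.inv z := fun z h1 h2 => by
    simp [hi', h1, h2]
  have key : ∀ z ∈ D, z = d.inv x ∧ d.inv y ∈ D ∨ z = d.inv y ∧ d.inv x ∈ D ∨
      (z ≠ d.inv x ∧ z ≠ d.inv y ∧ d.inv z ∈ D) := by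
    intro z hz
    have h0 := hneD z hz
    by_cases h1 : z = d.inv x
    · left; refine ⟨h1, ?_⟩
      rcases hinvy with h | h | h
      · exact absurd (by rw [h1, ← h, hiiy]) h0.2
      · exact absurd h hyy
      · exact h
    by_cases h2 : z = d.inv y
    · right; left; refine ⟨h2, ?_⟩
      rcases hinvx with h | h | h
      · exact absurd h hxx
      · exact absurd (by rw [h2, ← h, hiix]) h0.1
      · exact h
    right; right
    refine ⟨h1, h2, ?_⟩
    have h5 := hii z (Or.inr (Or.inr hz))
    rcases hinv z (Or.inr (Or.inr hz)) with h | h | h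
    · exact absurd (by rw [← h, h5]) h1
    · exact absurd (by rw [← h, h5]) h2
    · exact h
  have hi'src : ∀ z ∈ D, m (d.src (i' z)) = m (d.src (d.inv z)) := by
    intro z hz
    rcases key z hz with ⟨rfl, _⟩ | ⟨rfl, _⟩ | ⟨h1, h2, _⟩
    · rw [hi1, hiix, ← hu, hmu, ← hv, hmv]
    · rw [hi2, hiiy, hp2]
    · rw [hi3 z h1 h2]
  set d' : DartData P := ⟨d.lab, i', m ∘ d.src, d.pos⟩ with hd'
  have hpath : ∀ {l p q}, (∀ y ∈ l, y ∈ D) → d.IsPath p l q → d'.IsPath (m p) l (m q) := by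
    intro l p q hl h
    exact h.map fun z hz => ⟨rfl, hi'src z (hl z hz)⟩
  have hfD : ∀ y ∈ f, y ∈ D := fun y hy => by simp [hD, hy]
  have hgD : ∀ g ∈ G, ∀ y ∈ g, y ∈ D := fun g hg y hy => by
    rw [hD, List.flatten_cons, List.mem_append]; right; exact List.mem_flatten.2 ⟨g, hg, hy⟩
  refine ⟨d', rfl, hnd, ?_, ?_, ?_, ?_, ?_, ?_⟩
  · intro z hz
    change i' z ∈ D
    rcases key z hz with ⟨rfl, h⟩ | ⟨rfl, h⟩ | ⟨h1, h2, h⟩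
    · rwa [hi1]
    · rwa [hi2]
    · rwa [hi3 z h1 h2]
  · intro z hz
    change i' (i' z) = z
    rcases key z hz with ⟨rfl, h⟩ | ⟨rfl, h⟩ | ⟨h1, h2, h⟩
    · rw [hi1, hi2]
    · rw [hi2, hi1]
    · rw [hi3 z h1 h2, hi3, hii z (Or.inr (Or.inr hz))]
      · intro h3
        exact (hneD z hz).1 (by rw [← hii z (Or.inr (Or.inr hz)), h3, hiix])
      · intro h3
        exact (hneD z hz).2 (by rw [← hii z (Or.inr (Or.inr hz)), h3, hiiy])
  · intro z hz
    change d.lab (i' z) = _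
    rcases key z hz with ⟨rfl, h⟩ | ⟨rfl, h⟩ | ⟨h1, h2, h⟩
    · rw [hi1, hli y (by simp), hxy]; change _ = li (d.lab _); rw [hli x (by simp)]
    · rw [hi2, hli x (by simp)]; change _ = li (d.lab _); rw [hli y (by simp), hxy, li_li]
    · rw [hi3 z h1 h2, hli z (Or.inr (Or.inr hz))]
  · intro z hz
    change d.pos (m (d.src (i' z))) = d.pos (m (d.src z)) * _
    rw [hi'src z hz, hposm, hposm]; exact hpi z (Or.inr (Or.inr hz))
  · intro g hg
    rcases List.mem_cons.1 hg with rfl | hg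
    · have := hpath hfD hp3
      rw [← hp1, hmv, hmu] at this
      exact ⟨_, this⟩
    · obtain ⟨q, hq⟩ := hd.path g (by simp [hg])
      exact ⟨_, hpath (hgD g hg) hq⟩
  · intro φ h1 h2
    change ∀ z ∈ D, φ (i' z) = - φ z at h1
    set φ' : ℕ → ℚ := fun z => if z = x then - φ (d.inv x) else if z = y then φ (d.inv x) else φ z
      with hφ'
    have hφx : φ' x = - φ (d.inv x) := by simp [hφ']
    have hφy : φ' y = φ (d.inv x) := by simp [hφ', Ne.symm hxy']
    have hφD : ∀ z ∈ D, φ' z = φ z := fun z hz => by simp [hφ', hneD z hz]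
    have hmap : ∀ l : List ℕ, (∀ y ∈ l, y ∈ D) → l.map φ' = l.map φ := fun l hl =>
      List.map_congr_left fun y hy => hφD y (hl y hy)
    have hix : φ' (d.inv x) = φ (d.inv x) := by
      rcases hinvx with h | h | h
      · exact absurd h hxx
      · rw [h, hφy, h]
      · exact hφD _ h
    have hxy2 : d.inv x = y → d.inv y = x := fun h => by rw [← h, hiix]
    have hiy : φ' (d.inv y) = - φ (d.inv x) := by
      rcases hinvy with h | h | h
      · rw [h, hφx]
      · exact absurd h hyy
      · rw [hφD _ h]
        have h3 : d.inv x ∈ D := by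
          rcases key _ h with ⟨h4, _⟩ | ⟨_, h4⟩ | ⟨_, h4, _⟩
          · exact absurd h4.symm hinj
          · exact h4
          · exact absurd rfl h4
        rw [← h1 _ h3, hi1]
    have hanti : ∀ z, z = x ∨ z = y ∨ z ∈ D → φ' (d.inv z) = - φ' z := by
      rintro z (rfl | rfl | hz)
      · rw [hix, hφx, neg_neg]
      · rw [hiy, hφy]
      · rcases key z hz with ⟨rfl, h⟩ | ⟨rfl, h⟩ | ⟨h3, h4, h⟩
        · rw [hiix, hix, hφx]
        · rw [hiiy, hiy, hφy, neg_neg]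
        · rw [hφD _ h, hφD z hz, ← h1 z hz, hi3 z h3 h4]
    obtain ⟨ψ, hψ⟩ := hh1 φ' hanti (by
      intro g hg
      rcases hg with rfl | hg
      · have := h2 f List.mem_cons_self
        simp only [List.map_cons, List.sum_cons, hmap f hfD, this, hφx, hφy]
        ring
      · rw [hmap g (hgD g hg)]; exact h2 g (by simp [hg]))
    have h3 := hψ x (by simp)
    have h4 := hψ y (by simp)
    rw [hφx] at h3
    rw [hφy, hp2] at h4
    have hψm : ∀ z, ψ (m z) = ψ z := fun z => by
      by_cases hz : z = v
      · rw [hz, hmv]; rw [← hu] at h3; rw [← hv] at h4; linarith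
      · simp [hmdef, hz]
    refine ⟨ψ, fun z hz => ?_⟩
    change _ = ψ (m (d.src (i' z))) - ψ (m (d.src z))
    rw [hi'src z hz, hψm, hψm, ← hφD z hz, hψ z (Or.inr (Or.inr hz))]

lemma Dia.zip {s : S × Bool} {l : Word S} {F : List (Word S)}
    (h : Dia P ((s :: li s :: l) :: F)) : Dia P (l :: F) := by
  obtain ⟨d, f, G, hd, h2, rfl⟩ := dia_cons.1 h
  obtain ⟨x, f, rfl, hx, h3⟩ := List.map_eq_cons_iff.1 h2
  obtain ⟨y, f, rfl, hy, rfl⟩ := List.map_eq_cons_iff.1 h3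
  obtain ⟨d', h4, h5⟩ := hd.zip (by rw [hx, hy])
  exact dia_cons.2 ⟨d', f, G, h5, by rw [h4], by rw [h4]⟩

lemma Dia.red {l l' : Word S} {F : List (Word S)} (h : Dia P (l :: F)) (hl : FreeGroup.Red l l') :
    Dia P (l' :: F) := by
  induction hl with
  | refl => exact h
  | tail _ hs ih =>
    obtain ⟨⟩ := hs
    rename_i a c x b _
    have h1 := ih.rotate (a := a) (b := (x, b) :: (x, !b) :: c)
    have h2 : Dia P ((c ++ a) :: F) := Dia.zip (s := (x, b)) (by simpa [li] using h1)
    exact h2.rotate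

lemma red_append_wordInv (w l : Word S) : FreeGroup.Red (w ++ wordInv w ++ l) l := by
  induction w generalizing l with
  | nil => exact FreeGroup.Red.refl
  | cons a w ih =>
    rw [wordInv_cons]
    have h1 := (FreeGroup.Red.append_append (FreeGroup.Red.refl (L := [a])) (ih ([li a] ++ l)))
    have h2 : FreeGroup.Red ([a] ++ ([li a] ++ l)) l :=
      FreeGroup.Red.Step.to_red (by
        have := @FreeGroup.Red.Step.not S [] l a.1 a.2
        simpa [li] using this)
    have h3 := h1.trans h2
    simpa using h3

lemma Dia.spurs {l : Word S} {F : List (Word S)} (h : Dia P (l :: F)) (w : Word S) :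
    Dia P ((w ++ wordInv w ++ l) :: F) := by
  induction w generalizing l with
  | nil => simpa
  | cons a w ih =>
    have h1 := h.spur a
    have h2 := ih (l := li a :: (l ++ [a])) (by simpa using h1.rotate (a := [a]) (b := li a :: l))
    have h3 := Dia.rotate (a := (w ++ wordInv w ++ li a :: l)) (b := [a]) (by simpa using h2)
    simpa [wordInv_cons] using h3

/-- `u` can be inserted into the boundary word of any diagram, adding relator faces. -/
def Insertable (P : C6Presentation S) (u : Word S) : Prop :=
  ∀ l F, Dia P (l :: F) → ∃ rs : List (Word S), (∀ r ∈ rs, r ∈ P.rels) ∧ Dia P ((u ++ l) :: (rs ++ F))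

lemma insertable_nil : Insertable P [] := fun l F h => ⟨[], by simp, by simpa⟩

lemma Insertable.append {u v : Word S} (hu : Insertable P u) (hv : Insertable P v) :
    Insertable P (u ++ v) := by
  intro l F h
  obtain ⟨rs, h1, h2⟩ := hv l F h
  obtain ⟨rs', h3, h4⟩ := hu _ _ h2
  refine ⟨rs' ++ rs, ?_, by simpa using h4⟩
  intro r hr
  rcases List.mem_append.1 hr with hr | hr
  exacts [h3 r hr, h1 r hr]

lemma Insertable.conj {u : Word S} (hu : Insertable P u) (g : Word S) :
    Insertable P (g ++ u ++ wordInv g) := by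
  intro l F h
  have h1 := Dia.rotate (a := g) (b := wordInv g ++ l) (by simpa using h.spurs g)
  obtain ⟨rs, h2, h3⟩ := hu _ _ h1
  refine ⟨rs, h2, ?_⟩
  have h4 := Dia.rotate (a := u ++ wordInv g ++ l) (b := g) (by simpa using h3)
  simpa using h4

lemma insertable_rel {r : Word S} (hr : r ∈ P.rels) : Insertable P r := by
  intro l F h
  have h1 := Dia.rotate (a := r) (b := wordInv r ++ l) (by simpa using h.spurs r)
  have h2 := Dia.pinch (a := wordInv r) (b := l ++ r) (by simpa using h1)
    (by rw [elt_wordInv, elt_rel P hr, inv_one])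
  refine ⟨[wordInv r], by simpa using P.inv_mem r hr, ?_⟩
  have h3 := (h2.perm (List.Perm.swap _ _ _)).rotate
  exact h3

lemma exists_insertable {x : FreeGroup S} (hx : x ∈ Subgroup.normalClosure (wordVal '' P.rels)) :
    ∃ W : Word S, FreeGroup.mk W = x ∧ Insertable P W ∧ Insertable P (wordInv W) := by
  induction hx using Subgroup.closure_induction with
  | mem x hx =>
    obtain ⟨y, ⟨r, hr, rfl⟩, hy⟩ := Group.mem_conjugatesOfSet_iff.1 hx
    obtain ⟨g, rfl⟩ := isConj_iff.1 hy
    induction g using Quot.inductionOn with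
    | h w =>
      refine ⟨w ++ r ++ wordInv w, ?_, (insertable_rel hr).conj w,
        by simpa using (insertable_rel (P.inv_mem r hr)).conj w⟩
      have : (FreeGroup.mk w)⁻¹ = FreeGroup.mk (wordInv w) := by rw [FreeGroup.inv_mk]; rfl
      change _ = FreeGroup.mk w * _ * (FreeGroup.mk w)⁻¹
      rw [this, wordVal_eq_mk]; simp
  | one => exact ⟨[], rfl, insertable_nil, insertable_nil⟩
  | mul x y _ _ hx hy =>
    obtain ⟨u, rfl, hu, hu'⟩ := hx
    obtain ⟨v, rfl, hv, hv'⟩ := hy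
    exact ⟨u ++ v, by simp, hu.append hv, by rw [wordInv_append]; exact hv'.append hu'⟩
  | inv x _ hx =>
    obtain ⟨u, rfl, hu, hu'⟩ := hx
    refine ⟨wordInv u, ?_, hu', by simpa⟩
    rw [FreeGroup.inv_mk]; rfl

lemma exists_dia {w : Word S} (hne : w ≠ []) (hr : Reduced w) (hw : P.elt w = 1) :
    ∃ rs : List (Word S), (∀ r ∈ rs, r ∈ P.rels) ∧ Dia P (w :: rs) := by
  obtain ⟨a, w', rfl⟩ := List.exists_cons_of_ne_nil hne
  obtain ⟨W, h1, h2, -⟩ := exists_insertable ((elt_eq_one_iff P _).1 hw)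
  obtain ⟨rs, h3, h4⟩ := h2 _ _ (dia_nil a.1)
  refine ⟨rs, h3, ?_⟩
  obtain ⟨c, hc1, hc2⟩ := FreeGroup.Red.exact.1 h1
  rw [(reduced_iff_freeGroup.1 hr).red_iff_eq] at hc2
  rw [hc2] at hc1
  simpa using (show Dia P (W :: rs) by simpa using h4).red hc1

lemma eq_nil_of_eq_wordInv {u : Word S} (hr : Reduced u) (h : u = wordInv u) : u = [] := by
  induction hn : u.length using Nat.strong_induction_on generalizing u with
  | _ n ih =>
    rcases u with _ | ⟨a, u⟩
    · rfl
    rcases List.eq_nil_or_concat u with rfl | ⟨v, b, rfl⟩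
    · simp only [wordInv_singleton, List.cons.injEq, and_true] at h
      exact absurd h.symm (li_ne a)
    · exfalso
      have e : wordInv (a :: (v ++ [b])) = li b :: (wordInv v ++ [li a]) := by
        simp [wordInv_cons]
      rw [List.concat_eq_append, e] at h
      simp only [List.cons.injEq] at h
      obtain ⟨h1, h2⟩ := h
      have h3 := (List.append_inj' h2 rfl).1
      have hv : v = [] := ih v.length (by simp at hn; omega)
        (hr.infix ⟨[a], [b], by simp⟩) h3 rfl
      subst hv
      rw [List.concat_eq_append] at hr
      have := (reduced_cons_cons.1 (show Reduced [a, b] from hr)).1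
      exact this (eq_li_comm.1 h1)

lemma not_isRotated_wordInv {u : Word S} (hr : CyclicallyReduced u) (h : u ~r wordInv u) :
    u = [] := by
  obtain ⟨n, hn⟩ := h
  rw [← List.rotate_mod] at hn
  rcases eq_or_ne u [] with h0 | h0
  · exact h0
  have hlt : n % u.length ≤ u.length := (Nat.mod_lt _ (List.length_pos_iff.2 h0)).le
  rw [List.rotate_eq_drop_append_take hlt] at hn
  generalize n % u.length = k at *
  have hu := List.take_append_drop k u
  generalize u.take k = a at *
  generalize u.drop k = b at *
  subst hu
  rw [wordInv_append] at hn
  obtain ⟨h1, h2⟩ := List.append_inj hn (by simp)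
  rw [eq_nil_of_eq_wordInv hr.reduced.left h2, eq_nil_of_eq_wordInv hr.reduced.right h1]
  rfl

lemma Ok_rotate_to {d : DartData P} {f g : List ℕ} {F : List (List ℕ)} (h : d.Ok (f :: F))
    (hr : g ~r f) : d.Ok (g :: F) := by
  obtain ⟨n, rfl⟩ := hr.symm
  rw [← List.rotate_mod]
  rcases eq_or_ne f [] with rfl | h0
  · simpa using h
  have hlt : n % f.length ≤ f.length := (Nat.mod_lt _ (List.length_pos_iff.2 h0)).le
  rw [List.rotate_eq_drop_append_take hlt]
  refine DartData.Ok.rotate ?_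
  rwa [List.take_append_drop]

/-- A reduced diagram: the first face has the prescribed label, all other faces are labelled by
relators, and no two adjacent faces cancel. -/
structure DartData.Red (d : DartData P) (w : Word S) (o : List ℕ) (fs : List (List ℕ)) : Prop where
  ok : d.Ok (o :: fs)
  outer : o.map d.lab = w
  ne_nil : ∀ f ∈ fs, f ≠ []
  mem_rels : ∀ f ∈ fs, f.map d.lab ∈ P.rels
  red : ∀ f ∈ fs, ∀ f' ∈ fs, ∀ x A B, (x :: A) ~r f → (d.inv x :: B) ~r f' →
    A.map d.lab ≠ wordInv (B.map d.lab)

theorem exists_red_diagram {w : Word S} (hne : w ≠ []) (hr : Reduced w) (hw : P.elt w = 1) :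
    ∃ (d : DartData P) (o : List ℕ) (fs : List (List ℕ)), d.Red w o fs := by
  classical
  have hex : ∃ n, ∃ rs : List (Word S), rs.length = n ∧ (∀ r ∈ rs, r ∈ P.rels) ∧
      Dia P (w :: rs) := by
    obtain ⟨rs, h1, h2⟩ := exists_dia hne hr hw
    exact ⟨_, rs, rfl, h1, h2⟩
  obtain ⟨rs, h1, h2, h3⟩ := Nat.find_spec hex
  have hmin : ∀ rs' : List (Word S), (∀ r ∈ rs', r ∈ P.rels) → Dia P (w :: rs') →
      rs.length ≤ rs'.length := by
    intro rs' h4 h5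
    rw [h1]
    exact Nat.find_min' hex ⟨rs', rfl, h4, h5⟩
  obtain ⟨d, o, fs, hd, ho, rfl⟩ := dia_cons.1 h3
  have hrel : ∀ f ∈ fs, f.map d.lab ∈ P.rels := fun f hf => h2 _ (List.mem_map_of_mem hf)
  refine ⟨d, o, fs, hd, ho, ?_, hrel, ?_⟩
  · rintro f hf rfl
    obtain ⟨l1, l2, rfl⟩ := List.append_of_mem hf
    have h5 : d.Ok (o :: (l1 ++ l2)) := by
      have h6 : (o :: (l1 ++ [] :: l2)).Perm ([] :: o :: (l1 ++ l2)) :=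
        (List.perm_middle (l₁ := o :: l1))
      exact (hd.perm h6).drop_nil
    have := hmin ((l1 ++ l2).map (List.map d.lab)) (fun r hr => by
      obtain ⟨f, hf, rfl⟩ := List.mem_map.1 hr
      exact hrel f (by simp at hf ⊢; tauto)) (dia_cons.2 ⟨d, o, _, h5, ho, rfl⟩)
    simp at this
  · intro f hf f' hf' x A B hA hB hAB
    have hxm : x ∈ f := hA.mem_iff.1 (by simp)
    have hx'm : d.inv x ∈ f' := hB.mem_iff.1 (by simp)
    have hxD : x ∈ (o :: fs).flatten := List.mem_flatten.2 ⟨f, by simp [hf], hxm⟩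
    have hlab := hd.lab_inv x hxD
    by_cases hff : f = f'
    · subst hff
      have h5 : (x :: A).map d.lab ~r (d.inv x :: B).map d.lab := (hA.trans hB.symm).map _
      have h6 : CyclicallyReduced ((x :: A).map d.lab) := by
        obtain ⟨n, hn⟩ := (hA.map d.lab).symm
        rw [← hn]
        exact cyclicallyReduced_rotate (P.cyclically_reduced _ (hrel f hf)) n
      have h7 : (d.inv x :: B).map d.lab ~r wordInv ((x :: A).map d.lab) := by
        rw [List.map_cons, List.map_cons, wordInv_cons, hAB, wordInv_wordInv, hlab]
        exact List.isRotated_append (l := [li (d.lab x)])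
      have := not_isRotated_wordInv h6 (h5.trans h7)
      simp at this
    · obtain ⟨l, hl⟩ : ∃ l, fs.Perm (f :: f' :: l) := by
        refine ⟨(fs.erase f).erase f', (List.perm_cons_erase hf).trans (List.Perm.cons _ ?_)⟩
        exact List.perm_cons_erase ((List.mem_erase_of_ne (Ne.symm hff)).2 hf')
      have h5 : (o :: fs).Perm (f :: f' :: o :: l) := by
        refine (hl.cons o).trans ?_
        exact (List.Perm.swap _ _ _).trans ((List.Perm.swap _ _ _).cons _)
      have h6 := Ok_rotate_to (hd.perm h5) hA
      have h7 := Ok_rotate_to (h6.perm (List.Perm.swap _ _ _)) hB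
      have h8 := (h7.perm (List.Perm.swap _ _ _)).merge
      have h9 : Dia P ((A.map d.lab ++ B.map d.lab) :: w :: l.map (List.map d.lab)) :=
        ⟨d, _, h8, by simp [ho]⟩
      have h10 := (h9.red (l' := []) (by
        rw [hAB]
        simpa using red_append_wordInv (wordInv (B.map d.lab)) [])).drop_nil
      have := hmin _ (fun r hr => by
        obtain ⟨f, hf, rfl⟩ := List.mem_map.1 hr
        exact hrel f (hl.mem_iff.2 (by simp [hf]))) h10
      rw [List.length_map, List.length_map, hl.length_eq] at this
      simp at this

end Diagrams

end GSC

namespace GSC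

section Euler

variable {S : Type} {P : C6Presentation S}

open Classical in
/-- Extension of a function on positively labelled darts to an antisymmetric function. -/
noncomputable def antiExt (d : DartData P) (E : Finset ℕ) (φ : E → ℚ) (x : ℕ) : ℚ :=
  if hx : x ∈ E then φ ⟨x, hx⟩ else if hx : d.inv x ∈ E then - φ ⟨d.inv x, hx⟩ else 0

theorem DartData.Ok.euler {d : DartData P} {G : List (List ℕ)} (h : d.Ok G)
    (hD : G.flatten ≠ []) :
    G.flatten.length + 4 ≤ 2 * (G.flatten.map d.src).toFinset.card + 2 * G.length := by
  classical
  set D := G.flatten.toFinset with hDdef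
  set E := D.filter (fun x => (d.lab x).2 = true) with hE
  set V := (G.flatten.map d.src).toFinset with hV
  have memD : ∀ x, x ∈ D ↔ x ∈ G.flatten := fun x => List.mem_toFinset
  have memE : ∀ x, x ∈ E ↔ x ∈ G.flatten ∧ (d.lab x).2 = true := fun x => by
    rw [hE, Finset.mem_filter, memD]
  have memV : ∀ x ∈ G.flatten, d.src x ∈ V := fun x hx => by
    rw [hV, List.mem_toFinset]; exact List.mem_map_of_mem hx
  have labinv : ∀ x ∈ G.flatten, (d.lab (d.inv x)).2 = !(d.lab x).2 := fun x hx => by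
    rw [h.lab_inv x hx]; rfl
  have hcard : G.flatten.length = 2 * E.card := by
    have h1 : D.card = G.flatten.length := List.toFinset_card_of_nodup h.nodup
    rw [← h1, ← Finset.card_filter_add_card_filter_not (fun x => (d.lab x).2 = true)]
    have h2 : (D.filter (fun x => ¬ (d.lab x).2 = true)).card = E.card := by
      refine Finset.card_bij' (fun x _ => d.inv x) (fun x _ => d.inv x) ?_ ?_ ?_ ?_
      · intro x hx
        rw [Finset.mem_filter, memD] at hx
        rw [memE]
        exact ⟨h.inv_mem x hx.1, by rw [labinv x hx.1]; simpa using hx.2⟩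
      · intro x hx
        rw [memE] at hx
        rw [Finset.mem_filter, memD]
        exact ⟨h.inv_mem x hx.1, by rw [labinv x hx.1]; simpa using hx.2⟩
      · intro x hx
        rw [Finset.mem_filter, memD] at hx
        exact h.inv_inv x hx.1
      · intro x hx
        rw [memE] at hx
        exact h.inv_inv x hx.1
    rw [h2]; change E.card + E.card = _; omega
  have antis : ∀ φ : E → ℚ, ∀ x ∈ G.flatten,
      antiExt d E φ (d.inv x) = - antiExt d E φ x := by
    intro φ x hx
    unfold antiExt
    have h1 := h.inv_inv x hx
    have h2 := labinv x hx
    have h3 := h.inv_mem x hx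
    by_cases hl : (d.lab x).2 = true
    · have h4 : x ∈ E := (memE x).2 ⟨hx, hl⟩
      have h5 : d.inv x ∉ E := fun h => by
        have := ((memE _).1 h).2; rw [h2, hl] at this; simp at this
      have h6 : d.inv (d.inv x) ∈ E := by rwa [h1]
      rw [dif_neg h5, dif_pos h6, dif_pos h4]
      congr 2; exact Subtype.ext h1
    · have h4 : x ∉ E := fun h => hl ((memE _).1 h).2
      have h5 : d.inv x ∈ E := (memE _).2 ⟨h3, by rw [h2]; simpa using hl⟩
      rw [dif_pos h5, dif_neg h4, dif_pos h5, neg_neg]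
  have onE : ∀ (φ : E → ℚ) (x : E), antiExt d E φ x = φ x := fun φ x => by
    simp [antiExt]
  let δ1 : (E → ℚ) →ₗ[ℚ] (Fin G.length → ℚ) :=
    { toFun := fun φ i => ((G.get i).map (antiExt d E φ)).sum
      map_add' := by
        intro φ ψ
        funext i
        simp only [Pi.add_apply]
        rw [← List.sum_map_add]
        congr 1
        refine List.map_congr_left fun x _ => ?_
        simp only [antiExt, Pi.add_apply]
        split_ifs <;> ring
      map_smul' := by
        intro c φ
        funext i
        simp only [Pi.smul_apply, smul_eq_mul, RingHom.id_apply]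
        rw [← List.sum_map_mul_left]
        congr 1
        refine List.map_congr_left fun x _ => ?_
        simp only [antiExt, Pi.smul_apply, smul_eq_mul]
        split_ifs <;> ring }
  let δ0 : (V → ℚ) →ₗ[ℚ] (E → ℚ) :=
    { toFun := fun ψ x => ψ ⟨d.src (d.inv x), memV _ (h.inv_mem _ ((memE _).1 x.2).1)⟩ -
        ψ ⟨d.src x, memV _ ((memE _).1 x.2).1⟩
      map_add' := by intro φ ψ; funext i; simp only [Pi.add_apply]; ring
      map_smul' := by
        intro c φ; funext i; simp only [Pi.smul_apply, smul_eq_mul, RingHom.id_apply]; ring }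
  have hker : LinearMap.ker δ1 ≤ LinearMap.range δ0 := by
    intro φ hφ
    rw [LinearMap.mem_ker] at hφ
    obtain ⟨ψ, hψ⟩ := h.h1 (antiExt d E φ) (antis φ) (by
      intro f hf
      obtain ⟨i, rfl⟩ := List.mem_iff_get.1 hf
      exact congrFun hφ i)
    refine ⟨fun v => ψ v, ?_⟩
    funext x
    have := hψ x ((memE _).1 x.2).1
    rw [onE] at this
    exact this.symm
  obtain ⟨x0, hx0⟩ := List.exists_mem_of_ne_nil _ hD
  have hr0 : Module.finrank ℚ (LinearMap.range δ0) + 1 ≤ V.card := by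
    have h1 := LinearMap.finrank_range_add_finrank_ker δ0
    rw [Module.finrank_fintype_fun_eq_card, Fintype.card_coe] at h1
    have h2 : 0 < Module.finrank ℚ (LinearMap.ker δ0) := by
      rw [Module.finrank_pos_iff_exists_ne_zero]
      refine ⟨⟨fun _ => 1, ?_⟩, ?_⟩
      · rw [LinearMap.mem_ker]; funext x; simp [δ0]
      · intro h3
        have h4 := congrFun (congrArg Subtype.val h3) ⟨_, memV x0 hx0⟩
        simp at h4
    omega
  have hr1 : Module.finrank ℚ (LinearMap.range δ1) + 1 ≤ G.length := by
    let s : (Fin G.length → ℚ) →ₗ[ℚ] ℚ := ∑ i, LinearMap.proj i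
    have hs : ∀ v, s v = ∑ i, v i := fun v => by simp [s]
    have h1 := LinearMap.finrank_range_add_finrank_ker s
    rw [Module.finrank_fintype_fun_eq_card, Fintype.card_fin] at h1
    have h2 : LinearMap.range δ1 ≤ LinearMap.ker s := by
      rintro _ ⟨φ, rfl⟩
      rw [LinearMap.mem_ker, hs]
      have h3 : ∑ i, δ1 φ i = (G.flatten.map (antiExt d E φ)).sum := by
        change ∑ i : Fin G.length, ((G.get i).map (antiExt d E φ)).sum = _
        rw [List.map_flatten, List.sum_flatten, List.map_map]
        exact Fin.sum_univ_fun_getElem G fun l => (l.map (antiExt d E φ)).sum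
      rw [h3, ← List.sum_toFinset _ h.nodup]
      refine Finset.sum_involution (fun x _ => d.inv x) ?_ ?_ ?_ ?_
      · intro x hx
        rw [antis φ x (List.mem_toFinset.1 hx)]; ring
      · intro x hx _ h5
        refine li_ne (d.lab x) ?_
        rw [← h.lab_inv x (List.mem_toFinset.1 hx), h5]
      · intro x hx
        exact List.mem_toFinset.2 (h.inv_mem x (List.mem_toFinset.1 hx))
      · intro x hx
        exact h.inv_inv x (List.mem_toFinset.1 hx)
    have h4 := Submodule.finrank_mono h2
    have h5 : 0 < Module.finrank ℚ (LinearMap.range s) := by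
      have hG : 0 < G.length := by
        rcases G with _ | ⟨a, G⟩
        · simp at hD
        · simp
      rw [Module.finrank_pos_iff_exists_ne_zero]
      refine ⟨⟨1, Pi.single ⟨0, hG⟩ 1, by rw [hs]; simp⟩, ?_⟩
      intro h6; have := congrArg Subtype.val h6; simp at this
    omega
  have h2 := LinearMap.finrank_range_add_finrank_ker δ1
  rw [Module.finrank_fintype_fun_eq_card, Fintype.card_coe] at h2
  have h3 := Submodule.finrank_mono hker
  omega

end Euler

section Next

/-- The permutation of darts sending each dart to its successor in its face. -/
def nxt (G : List (List ℕ)) : Equiv.Perm ℕ := (G.map List.formPerm).prod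

lemma nxt_of_notMem {G : List (List ℕ)} {x : ℕ} (hx : x ∉ G.flatten) : nxt G x = x := by
  induction G with
  | nil => rfl
  | cons f G ih =>
    simp only [List.flatten_cons, List.mem_append, not_or] at hx
    have : nxt (f :: G) = f.formPerm * nxt G := by simp [nxt]
    rw [this, Equiv.Perm.mul_apply, ih hx.2, List.formPerm_apply_of_notMem hx.1]

lemma nxt_apply {G : List (List ℕ)} (h : G.flatten.Nodup) {f : List ℕ} (hf : f ∈ G) {x : ℕ}
    (hx : x ∈ f) : nxt G x = f.formPerm x := by
  induction G with
  | nil => simp at hf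
  | cons g G ih =>
    have : nxt (g :: G) = g.formPerm * nxt G := by simp [nxt]
    rw [this, Equiv.Perm.mul_apply]
    simp only [List.flatten_cons, List.nodup_append] at h
    obtain ⟨h1, h2, h3⟩ := h
    rcases List.mem_cons.1 hf with rfl | hf
    · rw [nxt_of_notMem]
      exact fun h4 => h3 x hx x h4 rfl
    · rw [ih h2 hf]
      refine List.formPerm_apply_of_notMem fun h4 => ?_
      refine h3 _ h4 (f.formPerm x) (List.mem_flatten.2 ⟨f, hf, ?_⟩) rfl
      exact List.formPerm_apply_mem_of_mem hx

variable {G : List (List ℕ)} {f : List ℕ} {x : ℕ}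

lemma face_nodup (h : G.flatten.Nodup) (hf : f ∈ G) : f.Nodup := (List.nodup_flatten.1 h).1 f hf

lemma nxt_mem (h : G.flatten.Nodup) (hf : f ∈ G) (hx : x ∈ f) : nxt G x ∈ f := by
  rw [nxt_apply h hf hx]; exact List.formPerm_apply_mem_of_mem hx

lemma nxt_pow_mem (h : G.flatten.Nodup) (hf : f ∈ G) (hx : x ∈ f) (n : ℕ) : (nxt G ^ n) x ∈ f := by
  induction n with
  | zero => simpa
  | succ n ih => rw [pow_succ', Equiv.Perm.mul_apply]; exact nxt_mem h hf ih

lemma nxt_pow (h : G.flatten.Nodup) (hf : f ∈ G) (hx : x ∈ f) (n : ℕ) : (nxt G ^ n) x = (f.formPerm ^ n) x := by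
  induction n with
  | zero => simp
  | succ n ih =>
    rw [pow_succ', Equiv.Perm.mul_apply, nxt_apply h hf (nxt_pow_mem h hf hx n), ih, pow_succ',
      Equiv.Perm.mul_apply]

lemma nxt_pow_getElem (h : G.flatten.Nodup) (hf : f ∈ G) (i n : ℕ) (hi : i < f.length) :
    (nxt G ^ n) f[i] = f[(i + n) % f.length]'(Nat.mod_lt _ (by omega)) := by
  rw [nxt_pow h hf (List.getElem_mem hi), List.formPerm_pow_apply_getElem _ (face_nodup h hf)]

lemma nxt_pow_length (h : G.flatten.Nodup) (hf : f ∈ G) (hx : x ∈ f) : (nxt G ^ f.length) x = x := by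
  obtain ⟨i, hi, rfl⟩ := List.getElem_of_mem hx
  rw [nxt_pow_getElem h hf]
  simp [Nat.mod_eq_of_lt hi]

/-- The face `f` read from its dart `x` on. -/
lemma rot_isRotated (h : G.flatten.Nodup) (hf : f ∈ G) (hx : x ∈ f) :
    (List.range f.length).map (fun j => (nxt G ^ j) x) ~r f := by
  obtain ⟨i, hi, rfl⟩ := List.getElem_of_mem hx
  refine List.IsRotated.symm ⟨i, ?_⟩
  apply List.ext_getElem
  · simp
  · intro j h1 h2
    rw [List.getElem_rotate]
    simp only [List.getElem_map, List.getElem_range]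
    rw [nxt_pow_getElem h hf]
    congr 2; rw [add_comm]

lemma nxt_pow_inj (h : G.flatten.Nodup) (hf : f ∈ G) (hx : x ∈ f) {i j : ℕ} (hi : i < f.length) (hj : j < f.length)
    (hij : (nxt G ^ i) x = (nxt G ^ j) x) : i = j := by
  have h1 : ((List.range f.length).map (fun j => (nxt G ^ j) x)).Nodup :=
    (rot_isRotated h hf hx).nodup_iff.2 (face_nodup h hf)
  have := (List.nodup_iff_injective_getElem.1 h1) (a₁ := ⟨i, by simpa⟩) (a₂ := ⟨j, by simpa⟩)
    (by simpa using hij)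
  simpa using this

lemma exists_pow_eq (h : G.flatten.Nodup) (hf : f ∈ G) {y : ℕ} (hx : x ∈ f) (hy : y ∈ f) : ∃ j < f.length, (nxt G ^ j) x = y := by
  have := (rot_isRotated h hf hx).mem_iff.2 hy
  simpa using this

lemma nxt_inv_mem (h : G.flatten.Nodup) (hf : f ∈ G) (hx : x ∈ f) : (nxt G).symm x ∈ f := by
  have h0 : 0 < f.length := List.length_pos_of_mem hx
  have : (nxt G).symm x = (nxt G ^ (f.length - 1)) x := by
    rw [Equiv.symm_apply_eq, ← Equiv.Perm.mul_apply, ← pow_succ', Nat.sub_add_cancel h0,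
      nxt_pow_length h hf hx]
  rw [this]; exact nxt_pow_mem h hf hx _

end Next

section Next2

variable {S : Type} {P : C6Presentation S}

lemma IsPath_consec {d : DartData P} {l : List ℕ} {p q : ℕ} (h : d.IsPath p l q) (i : ℕ)
    (hi : i + 1 < l.length) : d.src (l[i+1]) = d.src (d.inv l[i]) := by
  induction l generalizing p i with
  | nil => simp at hi
  | cons x l ih =>
    rcases i with _ | i
    · rcases l with _ | ⟨y, l⟩
      · simp at hi
      · exact h.2.1
    · exact ih h.2 i (by simpa using hi)

lemma DartData.Ok.src_nxt {d : DartData P} {G : List (List ℕ)} (h : d.Ok G) {x : ℕ}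
    (hx : x ∈ G.flatten) : d.src (nxt G x) = d.src (d.inv x) := by
  obtain ⟨f, hf, hxf⟩ := List.mem_flatten.1 hx
  obtain ⟨p, hp⟩ := h.path f hf
  obtain ⟨i, hi, rfl⟩ := List.getElem_of_mem hxf
  have h1 := nxt_pow_getElem h.nodup hf i 1 hi
  rw [pow_one] at h1
  rw [h1]
  by_cases h2 : i + 1 < f.length
  · simp only [Nat.mod_eq_of_lt h2]
    exact IsPath_consec hp i h2
  · have h3 : i + 1 = f.length := by omega
    simp only [h3, Nat.mod_self]
    obtain ⟨g, y, rfl⟩ : ∃ g y, f = g ++ [y] := by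
      rcases List.eq_nil_or_concat f with rfl | ⟨g, y, rfl⟩
      · simp at hi
      · exact ⟨g, y, by simp⟩
    obtain ⟨m, hm1, hm2, hm3⟩ := d.isPath_append.1 hp
    have h4 : i = g.length := by simp at h3; omega
    subst h4
    simp only [List.getElem_append_right (le_refl _), Nat.sub_self, List.getElem_cons_zero]
    simp only [DartData.IsPath] at hm3
    rw [hm3]
    rcases g with _ | ⟨z, g⟩
    · exact hp.1
    · exact hp.1

end Next2

end GSC

namespace GSC

section Count

variable {S : Type} {P : C6Presentation S} {d : DartData P} {w : Word S} {o : List ℕ}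
  {fs : List (List ℕ)}

/-- The prefixes of `w` represent distinct elements. -/
def SimpleWord (P : C6Presentation S) (w : Word S) : Prop :=
  ∀ i < w.length, ∀ j < w.length, P.elt (w.take i) = P.elt (w.take j) → i = j

lemma mem_flatten_of {G : List (List ℕ)} {f : List ℕ} (hf : f ∈ G) {x : ℕ} (hx : x ∈ f) :
    x ∈ G.flatten := List.mem_flatten.2 ⟨f, hf, hx⟩

lemma DartData.Red.length_outer (h : d.Red w o fs) : o.length = w.length := by
  rw [← h.outer, List.length_map]

lemma DartData.Red.src_injOn (h : d.Red w o fs) (hs : SimpleWord P w) {x y : ℕ} (hx : x ∈ o)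
    (hy : y ∈ o) (hxy : d.src x = d.src y) : x = y := by
  obtain ⟨p, hp⟩ := h.ok.path o (by simp)
  have key : ∀ k (hk : k < o.length), d.pos (d.src o[k]) = d.pos p * P.elt (w.take k) := by
    intro k hk
    have h1 : o = o.take k ++ o[k] :: o.drop (k + 1) := by
      rw [List.cons_getElem_drop_succ, List.take_append_drop]
    rw [h1, d.isPath_append] at hp
    obtain ⟨m, h2, h3⟩ := hp
    simp only [DartData.IsPath] at h3
    rw [h3.1, h2.pos h.ok, ← h.outer, List.map_take]
    intro x hx
    exact mem_flatten_of (by simp : o ∈ o :: fs) (List.mem_of_mem_take hx)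
  obtain ⟨i, hi, rfl⟩ := List.getElem_of_mem hx
  obtain ⟨j, hj, rfl⟩ := List.getElem_of_mem hy
  have h1 := key i hi
  rw [hxy, key j hj] at h1
  have := hs j (by rw [← h.length_outer]; exact hj) i (by rw [← h.length_outer]; exact hi)
    (mul_left_cancel h1)
  subst this; rfl

lemma DartData.Red.inv_outer (h : d.Red w o fs) (hr : Reduced w) (hs : SimpleWord P w) {y : ℕ}
    (hy : y ∈ o) : d.inv y ∉ o := by
  intro hi
  have ho : o ∈ o :: fs := by simp
  have hn := h.ok.nodup
  have h1 : d.inv y = nxt (o :: fs) y := h.src_injOn hs hi (nxt_mem hn ho hy)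
    (h.ok.src_nxt (mem_flatten_of ho hy)).symm
  have h2 : y = nxt (o :: fs) (d.inv y) := by
    refine h.src_injOn hs hy (nxt_mem hn ho hi) ?_
    rw [h.ok.src_nxt (mem_flatten_of ho hi), h.ok.inv_inv y (mem_flatten_of ho hy)]
  have hlab := h.ok.lab_inv y (mem_flatten_of ho hy)
  have hle : o.length ≤ 2 := by
    by_contra! hlt
    have := nxt_pow_inj hn ho hy (i := 0) (j := 2) (by omega) hlt
      (by rw [pow_two, Equiv.Perm.mul_apply, ← h1, ← h2]; rfl)
    omega
  have hne : d.inv y ≠ y := by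
    intro h3; rw [h3] at hlab; exact li_ne _ hlab.symm
  have hw := h.outer
  match o, hle with
  | [], _ => simp at hy
  | [a], _ =>
    simp only [List.mem_singleton] at hy hi
    exact hne (hi.trans hy.symm)
  | [a, b], _ =>
    rw [← hw] at hr
    simp only [List.map_cons, List.map_nil, reduced_cons_cons] at hr
    simp only [List.mem_cons, List.not_mem_nil, or_false] at hy hi
    rcases hy with rfl | rfl
    · rcases hi with hi | hi
      · exact hne hi
      · rw [hi] at hlab; exact hr.1 hlab
    · rcases hi with hi | hi
      · rw [hi] at hlab; exact hr.1 (eq_li_comm.1 hlab)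
      · exact hne hi

/-- The label of a face read from a given dart. -/
def rdFrom (d : DartData P) (G : List (List ℕ)) (f : List ℕ) (x : ℕ) : Word S :=
  (List.range f.length).map fun j => d.lab ((nxt G ^ j) x)

lemma rdFrom_mem (h : d.Red w o fs) {f : List ℕ} (hf : f ∈ fs) {x : ℕ} (hx : x ∈ f) :
    rdFrom d (o :: fs) f x ∈ P.rels := by
  obtain ⟨k, hk⟩ := rot_isRotated h.ok.nodup (List.mem_cons_of_mem o hf) hx
  have h1 : (rdFrom d (o :: fs) f x).rotate k = f.map d.lab := by
    have h2 := congrArg (List.map d.lab) hk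
    rw [List.map_rotate, List.map_map] at h2
    exact h2
  have h2 : rdFrom d (o :: fs) f x ~r f.map d.lab := ⟨k, h1⟩
  obtain ⟨k', hk'⟩ := h2.symm
  rw [← hk']
  exact P.rotate_mem _ (h.mem_rels f hf) _

lemma rdFrom_length (d : DartData P) (G : List (List ℕ)) (f : List ℕ) (x : ℕ) :
    (rdFrom d G f x).length = f.length := by simp [rdFrom]

lemma face_pos {f : List ℕ} {x : ℕ} (hx : x ∈ f) : 0 < f.length := List.length_pos_of_mem hx

lemma DartData.Red.mem_face (h : d.Red w o fs) {x : ℕ} (hx : x ∈ (o :: fs).flatten) (hxo : x ∉ o) :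
    ∃ f ∈ fs, x ∈ f := by
  obtain ⟨f, hf, hxf⟩ := List.mem_flatten.1 hx
  rcases List.mem_cons.1 hf with rfl | hf
  · exact absurd hxf hxo
  · exact ⟨f, hf, hxf⟩

lemma DartData.Red.nxt_ne (h : d.Red w o fs) (hr : Reduced w) (hs : SimpleWord P w) {x : ℕ}
    (hx : x ∈ (o :: fs).flatten) : nxt (o :: fs) (d.inv x) ≠ x := by
  intro hc
  have hix := h.ok.inv_mem x hx
  have hlab := h.ok.lab_inv x hx
  by_cases hio : d.inv x ∈ o
  · have := h.inv_outer hr hs hio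
    rw [h.ok.inv_inv x hx] at this
    exact this (by rw [← hc]; exact nxt_mem h.ok.nodup (by simp) hio)
  · obtain ⟨f, hf, hxf⟩ := h.mem_face hix hio
    have h1 := rdFrom_mem h hf hxf
    have h2 := (P.cyclically_reduced _ h1)
    have hpos := face_pos hxf
    obtain ⟨n, hn⟩ : ∃ n, f.length = n + 1 := ⟨f.length - 1, by omega⟩
    unfold CyclicallyReduced at h2
    cases n with
    | zero =>
      have hp := nxt_pow_length h.ok.nodup (List.mem_cons_of_mem o hf) hxf
      rw [hn] at hp
      rw [zero_add, pow_one, hc] at hp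
      rw [← hp] at hlab; exact li_ne _ hlab.symm
    | succ n =>
      have h3 : ∃ l, rdFrom d (o :: fs) f (d.inv x) = d.lab (d.inv x) :: d.lab x :: l := by
        refine ⟨(List.range n).map fun j => d.lab ((nxt (o :: fs) ^ (j + 2)) (d.inv x)), ?_⟩
        unfold rdFrom
        rw [hn, List.range_succ_eq_map, List.range_succ_eq_map]
        simp [hc, Function.comp_def]
      obtain ⟨l, hl⟩ := h3
      rw [hl] at h2
      simp only [List.cons_append, reduced_cons_cons] at h2
      exact h2.1 (eq_li_comm.1 hlab)

/-- The dart `x` starts at a vertex of degree two. -/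
def Flat (d : DartData P) (G : List (List ℕ)) (x : ℕ) : Prop :=
  nxt G (d.inv x) = d.inv ((nxt G).symm x)

lemma nxt_mem_flatten {G : List (List ℕ)} (hn : G.flatten.Nodup) {x : ℕ} (hx : x ∈ G.flatten) :
    nxt G x ∈ G.flatten := by
  obtain ⟨f, hf, hxf⟩ := List.mem_flatten.1 hx
  exact mem_flatten_of hf (nxt_mem hn hf hxf)

lemma flat_of_vperm {G : List (List ℕ)} (h : d.Ok G) {x : ℕ} (hx : x ∈ G.flatten)
    (h2 : nxt G (d.inv (nxt G (d.inv x))) = x) : Flat d G x := by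
  unfold Flat
  rw [← h2]
  simp only [Equiv.symm_apply_apply]
  rw [h2, h.inv_inv _ (nxt_mem_flatten h.nodup (h.inv_mem x hx))]

lemma countP_eq_card {l : List ℕ} (hl : l.Nodup) (p : ℕ → Prop) [DecidablePred p] :
    l.countP (fun x => p x) = (l.toFinset.filter p).card := by
  rw [List.countP_eq_length_filter, ← List.toFinset_card_of_nodup (hl.filter _)]
  congr 1; ext x; simp

open Classical in
lemma DartData.Red.count_vertices (h : d.Red w o fs) (hr : Reduced w) (hs : SimpleWord P w) :
    6 * ((o :: fs).flatten.map d.src).toFinset.card ≤ 2 * (o :: fs).flatten.length +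
      (o :: fs).flatten.countP (fun x => Flat d (o :: fs) x) := by
  set G := o :: fs with hG
  set D := G.flatten.toFinset with hD
  have hDl : D.card = G.flatten.length := List.toFinset_card_of_nodup h.ok.nodup
  have hF : G.flatten.countP (fun x => Flat d G x) = (D.filter (fun x => Flat d G x)).card := by
    rw [hD, countP_eq_card h.ok.nodup]
  set V := (G.flatten.map d.src).toFinset with hV
  have memD : ∀ x, x ∈ D ↔ x ∈ G.flatten := fun x => List.mem_toFinset
  have hmap : ∀ x ∈ D, d.src x ∈ V := fun x hx => by
    rw [hV, List.mem_toFinset]; exact List.mem_map_of_mem ((memD x).1 hx)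
  rw [hF, ← hDl, Finset.card_eq_sum_card_fiberwise hmap,
    Finset.card_eq_sum_card_fiberwise (s := D.filter (fun x => Flat d G x)) (t := V)
      (f := d.src) (fun x hx => hmap x (Finset.mem_filter.1 hx).1), Finset.mul_sum,
    ← Finset.sum_add_distrib, mul_comm, ← smul_eq_mul, ← Finset.sum_const]
  refine Finset.sum_le_sum fun v hv => ?_
  set A := D.filter (fun x => d.src x = v) with hA
  have memA : ∀ x, x ∈ A ↔ x ∈ G.flatten ∧ d.src x = v := fun x => by
    rw [hA, Finset.mem_filter, memD]
  obtain ⟨x, hx, hxv⟩ := List.mem_map.1 (List.mem_toFinset.1 hv)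
  have vp : ∀ z ∈ A, nxt G (d.inv z) ∈ A ∧ nxt G (d.inv z) ≠ z := by
    intro z hz
    rw [memA] at hz
    have hi := h.ok.inv_mem z hz.1
    refine ⟨(memA _).2 ⟨nxt_mem_flatten h.ok.nodup hi, ?_⟩, h.nxt_ne hr hs hz.1⟩
    rw [h.ok.src_nxt hi, h.ok.inv_inv z hz.1, hz.2]
  have hxA : x ∈ A := (memA x).2 ⟨hx, hxv⟩
  by_cases h3 : 3 ≤ A.card
  · omega
  have h2 : 2 ≤ A.card := by
    have := Finset.one_lt_card.2 ⟨x, hxA, _, (vp x hxA).1, (vp x hxA).2.symm⟩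
    omega
  have hfl : ∀ z ∈ A, Flat d G z := by
    intro z hz
    refine flat_of_vperm h.ok ((memA z).1 hz).1 ?_
    by_contra hne
    have h4 := vp _ (vp z hz).1
    have h5 : ({z, nxt G (d.inv z), nxt G (d.inv (nxt G (d.inv z)))} : Finset ℕ) ⊆ A := by
      intro u hu
      simp only [Finset.mem_insert, Finset.mem_singleton] at hu
      rcases hu with rfl | rfl | rfl
      · exact hz
      · exact (vp _ hz).1
      · exact h4.1
    have h6 := Finset.card_le_card h5
    rw [Finset.card_eq_three.2 ⟨_, _, _, (vp z hz).2.symm, Ne.symm hne, h4.2.symm, rfl⟩] at h6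
    exact h3 h6
  have h7 : (D.filter (fun x => Flat d G x)).filter (fun x => d.src x = v) = A := by
    rw [hA]; ext z
    simp only [Finset.mem_filter]
    constructor
    · rintro ⟨⟨a, b⟩, c⟩; exact ⟨a, c⟩
    · rintro ⟨a, c⟩
      exact ⟨⟨a, hfl z ((memA z).2 ⟨(memD z).1 a, c⟩)⟩, c⟩
  rw [h7]
  omega

lemma DartData.Red.flat_of_outer (h : d.Red w o fs) (hs : SimpleWord P w) {f : List ℕ}
    (hf : f ∈ fs) {x : ℕ} (hx : x ∈ f) (h1 : d.inv x ∈ o)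
    (h2 : d.inv ((nxt (o :: fs)).symm x) ∈ o) : Flat d (o :: fs) x := by
  have hfG := List.mem_cons_of_mem o hf
  refine h.src_injOn hs (nxt_mem h.ok.nodup (by simp) h1) h2 ?_
  rw [h.ok.src_nxt (mem_flatten_of (by simp : o ∈ o :: fs) h1),
    h.ok.inv_inv x (mem_flatten_of hfG hx),
    ← h.ok.src_nxt (mem_flatten_of hfG (nxt_inv_mem h.ok.nodup hfG hx)), Equiv.apply_symm_apply]

lemma mem_of_nxt_mem {G : List (List ℕ)} (hn : G.flatten.Nodup) {f : List ℕ} (hf : f ∈ G) {x : ℕ}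
    (hx : nxt G x ∈ f) : x ∈ f := by
  have := nxt_inv_mem hn hf hx
  rwa [Equiv.symm_apply_apply] at this

lemma DartData.Red.not_flat_exit (h : d.Red w o fs) {x : ℕ} (h1 : d.inv x ∉ o)
    (h2 : d.inv ((nxt (o :: fs)).symm x) ∈ o) : ¬ Flat d (o :: fs) x := by
  intro hc
  rw [← hc] at h2
  exact h1 (mem_of_nxt_mem h.ok.nodup (by simp) h2)

lemma DartData.Red.not_flat_entry (h : d.Red w o fs) {x : ℕ} (h1 : d.inv x ∈ o)
    (h2 : d.inv ((nxt (o :: fs)).symm x) ∉ o) : ¬ Flat d (o :: fs) x := by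
  intro hc
  rw [← hc] at h2
  exact h2 (nxt_mem h.ok.nodup (by simp) h1)

lemma DartData.Red.flat_outer_iff (h : d.Red w o fs) (hs : SimpleWord P w) {y : ℕ} (hy : y ∈ o) :
    Flat d (o :: fs) y ↔ d.inv (nxt (o :: fs) (d.inv y)) ∈ o := by
  have ho : o ∈ o :: fs := by simp
  have hyG := mem_flatten_of ho hy
  have hp := nxt_inv_mem h.ok.nodup ho hy
  have hz := nxt_mem_flatten h.ok.nodup (h.ok.inv_mem y hyG)
  unfold Flat
  constructor
  · intro hc
    rw [hc, h.ok.inv_inv _ (mem_flatten_of ho hp)]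
    exact hp
  · intro hc
    have h1 : nxt (o :: fs) (d.inv (nxt (o :: fs) (d.inv y))) = y := by
      refine h.src_injOn hs (nxt_mem h.ok.nodup ho hc) hy ?_
      rw [h.ok.src_nxt (mem_flatten_of ho hc), h.ok.inv_inv _ hz,
        h.ok.src_nxt (h.ok.inv_mem y hyG), h.ok.inv_inv _ hyG]
    exact flat_of_vperm h.ok hyG h1

end Count

end GSC

namespace GSC

section Count

variable {S : Type} {P : C6Presentation S} {d : DartData P} {w : Word S} {o : List ℕ}
  {fs : List (List ℕ)}

lemma getElem_wordInv (l : Word S) (j : ℕ) (hj : j < (wordInv l).length) :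
    (wordInv l)[j] = li (l[l.length - 1 - j]'(by rw [length_wordInv] at hj; omega)) := by
  simp [wordInv, li]

lemma getElem_rdFrom (G : List (List ℕ)) (f : List ℕ) (x j : ℕ)
    (hj : j < (rdFrom d G f x).length) : (rdFrom d G f x)[j] = d.lab ((nxt G ^ j) x) := by
  simp [rdFrom]

lemma nxt_pow_symm_mem {G : List (List ℕ)} (hn : G.flatten.Nodup) {f : List ℕ} (hf : f ∈ G)
    {x : ℕ} (j : ℕ) (hx : (nxt G ^ j) x ∈ f) : x ∈ f := by
  induction j generalizing x with
  | zero => simpa using hx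
  | succ j ih =>
    rw [pow_succ, Equiv.Perm.mul_apply] at hx
    exact mem_of_nxt_mem hn hf (ih hx)

/-- A run of degree two vertices along an inner face is shorter than a sixth of the face. -/
lemma DartData.Red.chain (h : d.Red w o fs) {f : List ℕ} (hf : f ∈ fs) {x : ℕ} (hx : x ∈ f)
    (hno : d.inv x ∉ o) (m : ℕ)
    (hfl : ∀ j, 1 ≤ j → j < m → Flat d (o :: fs) ((nxt (o :: fs) ^ j) x)) :
    6 * m < f.length := by
  set σ := nxt (o :: fs) with hσ
  have hfG := List.mem_cons_of_mem o hf
  have hn := h.ok.nodup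
  have hxG := mem_flatten_of hfG hx
  obtain ⟨f', hf', hb⟩ := h.mem_face (h.ok.inv_mem x hxG) hno
  have hfG' := List.mem_cons_of_mem o hf'
  have hpow : ∀ j < m, (σ ^ j) (d.inv ((σ ^ j) x)) = d.inv x := by
    intro j
    induction j with
    | zero => intro _; simp
    | succ j ih =>
      intro hj
      have h1 := hfl (j + 1) (by omega) hj
      unfold Flat at h1
      rw [← hσ] at h1
      rw [pow_succ σ j, Equiv.Perm.mul_apply, ← pow_succ, h1, pow_succ' σ j,
        Equiv.Perm.mul_apply, Equiv.symm_apply_apply]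
      exact ih (by omega)
  have hlf := face_pos hx
  have hlf' := face_pos hb
  have key : ∀ m' ≤ m, 1 ≤ m' → m' ≤ f.length → m' ≤ f'.length →
      6 * m' < f.length ∧ 6 * m' < f'.length := by
    intro m' hm' h0 h1 h2
    set ρ := rdFrom d (o :: fs) f x with hρ
    set ρ' := rdFrom d (o :: fs) f' (σ (d.inv x)) with hρ'
    have hρm : ρ ∈ P.rels := rdFrom_mem h hf hx
    have hρm' : wordInv ρ' ∈ P.rels := P.inv_mem _ (rdFrom_mem h hf' (nxt_mem hn hfG' hb))
    have hlρ : ρ.length = f.length := rdFrom_length ..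
    have hlρ' : (wordInv ρ').length = f'.length := by rw [length_wordInv]; exact rdFrom_length ..
    have htake : ρ.take m' = (wordInv ρ').take m' := by
      apply List.ext_getElem
      · simp only [List.length_take]; omega
      · intro j hj hj'
        have hjm : j < m' := by simp only [List.length_take] at hj; omega
        rw [List.getElem_take, List.getElem_take, getElem_wordInv, getElem_rdFrom, getElem_rdFrom]
        have hc := hpow j (by omega)
        have hxj : (σ ^ j) x ∈ (o :: fs).flatten :=
          mem_flatten_of hfG (nxt_pow_mem hn hfG hx j)
        have hcf : d.inv ((σ ^ j) x) ∈ f' := nxt_pow_symm_mem hn hfG' j (by rw [← hσ, hc]; exact hb)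
        have h3 : (nxt (o :: fs) ^ (ρ'.length - 1 - j)) (σ (d.inv x)) = d.inv ((σ ^ j) x) := by
          rw [← Equiv.Perm.mul_apply, ← hσ, ← pow_succ, ← hc, ← Equiv.Perm.mul_apply, ← pow_add]
          have : ρ'.length - 1 - j + 1 + j = f'.length := by
            rw [length_wordInv] at hlρ'; omega
          rw [this]
          exact nxt_pow_length hn hfG' hcf
        rw [h3, h.ok.lab_inv _ hxj, li_li]
    have hne : ρ ≠ wordInv ρ' := by
      intro heq
      obtain ⟨n, hn1⟩ : ∃ n, f.length = n + 1 := ⟨f.length - 1, by omega⟩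
      obtain ⟨n', hn2⟩ : ∃ n, f'.length = n + 1 := ⟨f'.length - 1, by omega⟩
      have hA := rot_isRotated hn hfG hx
      have hB := rot_isRotated hn hfG' hb
      rw [hn1, List.range_succ_eq_map, List.map_cons, List.map_map] at hA
      rw [hn2, List.range_succ_eq_map, List.map_cons, List.map_map] at hB
      simp only [pow_zero, Equiv.Perm.one_apply] at hA hB
      refine h.red f hf f' hf' x _ _ hA hB ?_
      have e1 : ρ = d.lab x :: List.map d.lab
          (List.map ((fun j => (nxt (o :: fs) ^ j) x) ∘ Nat.succ) (List.range n)) := by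
        rw [hρ, rdFrom, hn1, List.range_succ_eq_map]
        simp [Function.comp_def]
      have e2 : ρ' = List.map d.lab (List.map ((fun j => (nxt (o :: fs) ^ j) (d.inv x)) ∘ Nat.succ)
          (List.range n')) ++ [d.lab (d.inv x)] := by
        rw [hρ', rdFrom, hn2, List.range_succ]
        have := nxt_pow_length hn hfG' hb
        rw [hn2, pow_succ, Equiv.Perm.mul_apply] at this
        simp [Function.comp_def, pow_succ, hσ, this]
      rw [e1, e2, wordInv_append] at heq
      simp only [wordInv_singleton, List.cons_append, List.nil_append, List.cons.injEq] at heq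
      exact heq.2
    have p1 : ρ.take m' <+: ρ := List.take_prefix _ _
    have p2 : ρ.take m' <+: wordInv ρ' := by rw [htake]; exact List.take_prefix _ _
    have l1 := piece_lt hρm hρm' hne p1 p2
    have l2 := piece_lt hρm' hρm hne.symm p2 p1
    rw [List.length_take, hlρ] at l1
    rw [List.length_take, hlρ, hlρ'] at l2
    omega
  by_contra hcon
  have := key (min m (min f.length f'.length)) (by omega) (by omega) (by omega) (by omega)
  omega

open Classical in
/-- Number of darts of `f` on the inner part starting at a vertex of degree at least three. -/
lemma DartData.Red.cover (h : d.Red w o fs) {f : List ℕ} (hf : f ∈ fs) :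
    6 * f.countP (fun x => d.inv x ∉ o) ≤
      f.countP (fun x => d.inv x ∉ o ∧ ¬ Flat d (o :: fs) x) * (f.length - 1) := by
  have hfG := List.mem_cons_of_mem o hf
  have hn := h.ok.nodup
  have hfn : f.Nodup := face_nodup hn hfG
  set σ := nxt (o :: fs) with hσ
  rw [countP_eq_card hfn, countP_eq_card hfn]
  set N := f.toFinset.filter (fun x => d.inv x ∉ o) with hN
  set T := f.toFinset.filter (fun x => d.inv x ∉ o ∧ ¬ Flat d (o :: fs) x) with hT
  have h1 : N ⊆ T.biUnion (fun t => (Finset.range ((f.length - 1) / 6)).image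
      (fun j => (σ ^ j) t)) := by
    intro x hx
    rw [hN, Finset.mem_filter, List.mem_toFinset] at hx
    have hex : ∃ j, ¬ (d.inv ((σ ^ j).symm x) ∉ o ∧ Flat d (o :: fs) ((σ ^ j).symm x)) := by
      by_contra! hall
      have hy : (σ ^ f.length).symm x ∈ f := nxt_pow_symm_mem hn hfG f.length
        (by rw [← hσ, Equiv.apply_symm_apply]; exact hx.1)
      have := h.chain hf hy (hall _).1 f.length (fun j _ hj => by
        have := (hall (f.length - j)).2
        convert this using 1
        rw [← hσ, Equiv.eq_symm_apply, ← Equiv.Perm.mul_apply, ← pow_add,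
          Nat.sub_add_cancel hj.le, Equiv.apply_symm_apply])
      omega
    set j := Nat.find hex with hj
    have hj1 := Nat.find_spec hex
    have hj2 : ∀ i < j, d.inv ((σ ^ i).symm x) ∉ o ∧ Flat d (o :: fs) ((σ ^ i).symm x) :=
      fun i hi => by simpa using Nat.find_min hex hi
    rw [← hj] at hj1
    set t := (σ ^ j).symm x with ht
    have htx : (σ ^ j) t = x := Equiv.apply_symm_apply _ _
    have htf : t ∈ f := nxt_pow_symm_mem hn hfG j (by rw [← hσ, htx]; exact hx.1)
    have hto : d.inv t ∉ o := by
      intro hto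
      rcases Nat.eq_zero_or_pos j with h0 | h0
      · rw [ht, h0] at hto; exact hx.2 hto
      · have h2 := hj2 (j - 1) (by omega)
        have h3 : (nxt (o :: fs)).symm ((σ ^ (j - 1)).symm x) = t := by
          rw [Equiv.symm_apply_eq, Equiv.symm_apply_eq, ← hσ, ← Equiv.Perm.mul_apply,
            ← pow_succ, Nat.sub_add_cancel h0, htx]
        exact h.not_flat_exit h2.1 (by rw [h3]; exact hto) h2.2
    have htn : ¬ Flat d (o :: fs) t := fun hc => hj1 ⟨hto, hc⟩
    have hlen := h.chain hf htf hto (j + 1) (fun i hi hi' => by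
      have := (hj2 (j - i) (by omega)).2
      convert this using 1
      rw [← hσ, Equiv.eq_symm_apply, ← Equiv.Perm.mul_apply, ← pow_add,
        Nat.sub_add_cancel (by omega), htx])
    rw [Finset.mem_biUnion]
    refine ⟨t, ?_, ?_⟩
    · rw [hT, Finset.mem_filter, List.mem_toFinset]; exact ⟨htf, hto, htn⟩
    · rw [Finset.mem_image]
      exact ⟨j, by rw [Finset.mem_range]; omega, htx⟩
  have h2 := Finset.card_le_card h1
  have h3 := Finset.card_biUnion_le_card_mul T (fun t => (Finset.range ((f.length - 1) / 6)).image
      (fun j => (σ ^ j) t)) ((f.length - 1) / 6) (fun t _ => by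
        refine Finset.card_image_le.trans ?_
        rw [Finset.card_range])
  have h4 : 6 * ((f.length - 1) / 6) ≤ f.length - 1 := Nat.mul_div_le _ _
  calc 6 * N.card ≤ 6 * (T.card * ((f.length - 1) / 6)) := by omega
    _ = T.card * (6 * ((f.length - 1) / 6)) := by ring
    _ ≤ _ := Nat.mul_le_mul_left _ h4

end Count

end GSC

namespace GSC

section Count

variable {S : Type} {P : C6Presentation S} {d : DartData P} {w : Word S} {o : List ℕ}
  {fs : List (List ℕ)}

lemma flat_pow {G : List (List ℕ)} {x j : ℕ}
    (hfl : ∀ i, 1 ≤ i → i ≤ j → Flat d G ((nxt G ^ i) x)) :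
    (nxt G ^ j) (d.inv ((nxt G ^ j) x)) = d.inv x := by
  induction j with
  | zero => simp
  | succ j ih =>
    have h1 := hfl (j + 1) (by omega) le_rfl
    unfold Flat at h1
    rw [pow_succ (nxt G) j, Equiv.Perm.mul_apply, ← pow_succ, h1, pow_succ' (nxt G) j,
      Equiv.Perm.mul_apply, Equiv.symm_apply_apply]
    exact ih fun i h1 h2 => hfl i h1 (by omega)

lemma DartData.Red.arc_read (h : d.Red w o fs) {f : List ℕ} (hf : f ∈ fs) {x : ℕ} (hx : x ∈ f)
    {m : ℕ} (h1 : 1 ≤ m) (hm : m ≤ f.length)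
    (hfl : ∀ j, 1 ≤ j → j < m → Flat d (o :: fs) ((nxt (o :: fs) ^ j) x)) :
    (∀ j < m, (nxt (o :: fs) ^ j) (d.inv ((nxt (o :: fs) ^ (m - 1)) x)) =
      d.inv ((nxt (o :: fs) ^ (m - 1 - j)) x)) ∧
    ∃ ρ ∈ P.rels, ρ.length = f.length ∧ ∀ j < m, ρ[j]? =
      some (d.lab ((nxt (o :: fs) ^ j) (d.inv ((nxt (o :: fs) ^ (m - 1)) x)))) := by
  have hfG := List.mem_cons_of_mem o hf
  have hn := h.ok.nodup
  have key : ∀ j < m, (nxt (o :: fs) ^ j) (d.inv ((nxt (o :: fs) ^ (m - 1)) x)) =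
      d.inv ((nxt (o :: fs) ^ (m - 1 - j)) x) := by
    intro j hj
    have := flat_pow (d := d) (G := o :: fs) (x := (nxt (o :: fs) ^ (m - 1 - j)) x) (j := j)
      (fun i h1 h2 => by
        rw [← Equiv.Perm.mul_apply, ← pow_add]
        exact hfl _ (by omega) (by omega))
    rw [← Equiv.Perm.mul_apply, ← pow_add] at this
    rwa [show j + (m - 1 - j) = m - 1 by omega] at this
  refine ⟨key, _, P.inv_mem _ (rdFrom_mem h hf (nxt_pow_mem hn hfG hx m)), ?_, ?_⟩
  · rw [length_wordInv, rdFrom_length]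
  · intro j hj
    rw [List.getElem?_eq_getElem (by rw [length_wordInv, rdFrom_length]; omega), getElem_wordInv,
      getElem_rdFrom, key j hj, h.ok.lab_inv _ (mem_flatten_of hfG (nxt_pow_mem hn hfG hx _)),
      rdFrom_length, ← Equiv.Perm.mul_apply, ← pow_add,
      show f.length - 1 - j + m = (m - 1 - j) + f.length by omega, pow_add,
      Equiv.Perm.mul_apply, nxt_pow_length hn hfG hx]

lemma DartData.Red.arc_len (h : d.Red w o fs) {f : List ℕ} (hf : f ∈ fs) {x : ℕ} (hx : x ∈ f)
    {m : ℕ} (h1 : 1 ≤ m) (hm : m ≤ f.length)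
    (hfl : ∀ j, 1 ≤ j → j < m → Flat d (o :: fs) ((nxt (o :: fs) ^ j) x))
    (hy : d.inv ((nxt (o :: fs) ^ (m - 1)) x) ∈ o) : m ≤ o.length := by
  have hfG := List.mem_cons_of_mem o hf
  have hn := h.ok.nodup
  by_contra! hlt
  have hpos := face_pos hy
  have h2 := (h.arc_read hf hx h1 hm hfl).1 _ hlt
  rw [nxt_pow_length hn (by simp) hy] at h2
  have h3 := congrArg d.inv h2
  rw [h.ok.inv_inv _ (mem_flatten_of hfG (nxt_pow_mem hn hfG hx _)),
    h.ok.inv_inv _ (mem_flatten_of hfG (nxt_pow_mem hn hfG hx _))] at h3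
  have := nxt_pow_inj hn hfG hx (by omega) (by omega) h3
  omega

lemma DartData.Red.all_outer (h : d.Red w o fs) (hs : SimpleWord P w) {f : List ℕ} (hf : f ∈ fs)
    (hall : ∀ x ∈ f, d.inv x ∈ o) : w ∈ P.rels := by
  have hfG := List.mem_cons_of_mem o hf
  have hn := h.ok.nodup
  obtain ⟨x, hx⟩ := List.exists_mem_of_ne_nil f (h.ne_nil f hf)
  have hpos := face_pos hx
  have hfl : ∀ j, Flat d (o :: fs) ((nxt (o :: fs) ^ j) x) := fun j => by
    have := nxt_pow_mem hn hfG hx j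
    exact h.flat_of_outer hs hf this (hall _ this) (hall _ (nxt_inv_mem hn hfG this))
  have hyo := hall _ (nxt_pow_mem hn hfG hx (f.length - 1))
  have hle := h.arc_len hf hx hpos le_rfl (fun j _ _ => hfl j) hyo
  obtain ⟨hk, ρ, hρ, hl, hr⟩ := h.arc_read hf hx hpos le_rfl (fun j _ _ => hfl j)
  set y := d.inv ((nxt (o :: fs) ^ (f.length - 1)) x) with hy
  have heq : o.length = f.length := by
    by_contra hne
    have h1 := hk (f.length - 1) (by omega)
    have h2 : Flat d (o :: fs) x := hfl 0
    have h3 : (nxt (o :: fs)).symm x = (nxt (o :: fs) ^ (f.length - 1)) x := by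
      rw [Equiv.symm_apply_eq, ← Equiv.Perm.mul_apply, ← pow_succ', Nat.sub_add_cancel hpos,
        nxt_pow_length hn hfG hx]
    unfold Flat at h2
    rw [Nat.sub_self, pow_zero, Equiv.Perm.one_apply] at h1
    rw [h3, ← hy, ← h1, ← Equiv.Perm.mul_apply, ← pow_succ', Nat.sub_add_cancel hpos] at h2
    have := nxt_pow_inj hn (by simp : o ∈ o :: fs) hyo (i := f.length) (j := 0) (by omega)
      (by omega) (by simpa using h2)
    omega
  have hρe : ρ = rdFrom d (o :: fs) o y := by
    apply List.ext_getElem?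
    intro j
    by_cases hj : j < f.length
    · rw [hr j hj, List.getElem?_eq_getElem (by rw [rdFrom_length]; omega), getElem_rdFrom]
    · rw [List.getElem?_eq_none (by omega), List.getElem?_eq_none (by rw [rdFrom_length]; omega)]
  obtain ⟨k, hk⟩ := rot_isRotated hn (by simp : o ∈ o :: fs) hyo
  have h2 := congrArg (List.map d.lab) hk
  rw [List.map_rotate, List.map_map, h.outer] at h2
  rw [← h2]
  rw [hρe] at hρ
  exact P.rotate_mem _ hρ k

/-- The budget collected along the outer part of a face. -/
noncomputable def outSum (d : DartData P) (o : List ℕ) (β : ℕ → ℕ) (x : ℕ) : ℕ :=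
  if d.inv x ∈ o then β (o.idxOf (d.inv x)) else 0

/-- Arcs of relators on the cyclic word `w` cover enough of the budget `β`. -/
def CycArcs (P : C6Presentation S) (w : Word S) (β : ℕ → ℕ) : Prop :=
  ∀ a < w.length, ∀ m, 1 ≤ m → m ≤ w.length → ∀ ρ ∈ P.rels, ∀ i, 1 ≤ i → i ≤ 3 →
    ((w ++ w).drop a).take m <+: ρ → (6 - i) * ρ.length < 6 * m →
    4 - i ≤ ∑ j ∈ Finset.Ico 1 m, β ((a + j) % w.length)

open Classical in
lemma DartData.Red.face_ineq (h : d.Red w o fs) (hs : SimpleWord P w)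
    (hw : w ∉ P.rels) {β : ℕ → ℕ} (harc : CycArcs P w β) {f : List ℕ} (hf : f ∈ fs) :
    6 ≤ f.countP (fun x => ¬ Flat d (o :: fs) x) +
      f.countP (fun x => d.inv x ∈ o ∧ d.inv (nxt (o :: fs) x) ∉ o) +
      (f.map (outSum d o β)).sum := by
  have hfG := List.mem_cons_of_mem o hf
  have hn := h.ok.nodup
  have hfn : f.Nodup := face_nodup hn hfG
  have hcov := h.cover hf
  set σ := nxt (o :: fs) with hσ
  rw [countP_eq_card hfn, countP_eq_card hfn] at hcov
  rw [countP_eq_card hfn, countP_eq_card hfn]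
  set F := f.toFinset with hF
  have memF : ∀ x, x ∈ F ↔ x ∈ f := fun x => List.mem_toFinset
  set A := F.filter (fun x => ¬ Flat d (o :: fs) x) with hA
  set T := F.filter (fun x => d.inv x ∉ o ∧ ¬ Flat d (o :: fs) x) with hT
  set Ex := F.filter (fun x => d.inv x ∈ o ∧ d.inv (σ x) ∉ o) with hEx
  set En := F.filter (fun x => d.inv x ∉ o ∧ d.inv (σ x) ∈ o) with hEn
  have hpos : 0 < f.length := List.length_pos_of_ne_nil (h.ne_nil f hf)
  have σF : ∀ x ∈ F, σ x ∈ F := fun x hx => (memF _).2 (nxt_mem hn hfG ((memF _).1 hx))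
  have hcard : Ex.card = En.card := by
    have h1 : ∑ x ∈ F, (if d.inv (σ x) ∈ o then (1 : ℤ) else 0) =
        ∑ x ∈ F, (if d.inv x ∈ o then (1 : ℤ) else 0) := by
      refine Finset.sum_bij (fun x _ => σ x) σF (fun x _ y _ hxy => σ.injective hxy) ?_
        (fun x _ => rfl)
      intro y hy
      exact ⟨σ.symm y, (memF _).2 (nxt_inv_mem hn hfG ((memF _).1 hy)), by simp⟩
    have h2 : ∑ x ∈ F, ((if d.inv x ∈ o ∧ d.inv (σ x) ∉ o then (1 : ℤ) else 0) -
        (if d.inv x ∉ o ∧ d.inv (σ x) ∈ o then (1 : ℤ) else 0)) =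
        ∑ x ∈ F, ((if d.inv x ∈ o then (1 : ℤ) else 0) - if d.inv (σ x) ∈ o then (1 : ℤ) else 0) := by
      refine Finset.sum_congr rfl fun x _ => ?_
      by_cases h1 : d.inv x ∈ o <;> by_cases h2 : d.inv (σ x) ∈ o <;> simp [h1, h2]
    rw [Finset.sum_sub_distrib, Finset.sum_sub_distrib, h1, sub_self, Finset.sum_boole,
      Finset.sum_boole, sub_eq_zero] at h2
    exact_mod_cast h2
  have hTE : Ex.card ≤ T.card := by
    refine Finset.card_le_card_of_injOn σ ?_ (σ.injective.injOn)
    intro x hx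
    rw [Finset.mem_coe, hEx, Finset.mem_filter] at hx
    rw [Finset.mem_coe, hT, Finset.mem_filter]
    exact ⟨σF x hx.1, hx.2.2, h.not_flat_exit hx.2.2 (by rw [← hσ, Equiv.symm_apply_apply]; exact hx.2.1)⟩
  have hAT : T.card + En.card ≤ A.card := by
    have h1 : (En.image σ).card = En.card := Finset.card_image_of_injective _ σ.injective
    rw [← h1, ← Finset.card_union_of_disjoint]
    · refine Finset.card_le_card ?_
      intro x hx
      rw [Finset.mem_union] at hx
      rw [hA, Finset.mem_filter]
      rcases hx with hx | hx
      · rw [hT, Finset.mem_filter] at hx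
        exact ⟨hx.1, hx.2.2⟩
      · obtain ⟨z, hz, rfl⟩ := Finset.mem_image.1 hx
        rw [hEn, Finset.mem_filter] at hz
        exact ⟨σF z hz.1, h.not_flat_entry hz.2.2
          (by rw [← hσ, Equiv.symm_apply_apply]; exact hz.2.1)⟩
    · rw [Finset.disjoint_left]
      intro x hx hx'
      obtain ⟨z, hz, rfl⟩ := Finset.mem_image.1 hx'
      rw [hEn, Finset.mem_filter] at hz
      rw [hT, Finset.mem_filter] at hx
      exact hx.2.1 hz.2.2
  by_cases hno : ∀ x ∈ f, d.inv x ∉ o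
  · have h1 : F.filter (fun x => d.inv x ∉ o) = F :=
      Finset.filter_true_of_mem fun x hx => hno x ((memF x).1 hx)
    rw [h1, hF, List.toFinset_card_of_nodup hfn] at hcov
    have : 6 ≤ T.card := by
      by_contra! hlt
      have : T.card * (f.length - 1) ≤ 5 * (f.length - 1) := Nat.mul_le_mul_right _ (by omega)
      omega
    omega
  push Not at hno
  obtain ⟨u, huf, huo⟩ := hno
  by_cases hall : ∀ x ∈ f, d.inv x ∈ o
  · exact absurd (h.all_outer hs hf hall) hw
  push Not at hall
  obtain ⟨v, hvf, hvo⟩ := hall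
  have hEne : 1 ≤ En.card := by
    obtain ⟨k, hk, hkv⟩ := exists_pow_eq hn hfG hvf huf
    rw [← hσ] at hkv
    have hex : ∃ k, d.inv ((σ ^ k) v) ∈ o := ⟨k, by rw [hkv]; exact huo⟩
    have h1 := Nat.find_spec hex
    rcases Nat.eq_zero_or_pos (Nat.find hex) with h0 | h0
    · rw [h0] at h1; exact absurd h1 hvo
    · have h2 := Nat.find_min hex (m := Nat.find hex - 1) (by omega)
      refine Finset.card_pos.2 ⟨(σ ^ (Nat.find hex - 1)) v, ?_⟩
      rw [hEn, Finset.mem_filter, memF]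
      refine ⟨nxt_pow_mem hn hfG hvf _, h2, ?_⟩
      rw [← Equiv.Perm.mul_apply, ← pow_succ', Nat.sub_add_cancel h0]
      exact h1
  by_cases he2 : 2 ≤ En.card
  · omega
  by_cases hT4 : 4 ≤ T.card
  · omega
  obtain ⟨x2, hx2⟩ := Finset.card_eq_one.1 (show En.card = 1 by omega)
  have hx2m : x2 ∈ En := by rw [hx2]; simp
  rw [hEn, Finset.mem_filter, memF] at hx2m
  obtain ⟨hx2f, hx2o, hx0o⟩ := hx2m
  set x := σ x2 with hx
  have hxf : x ∈ f := nxt_mem hn hfG hx2f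
  have hx2e : (σ ^ (f.length - 1)) x = x2 := by
    rw [hx, ← Equiv.Perm.mul_apply, ← pow_succ, Nat.sub_add_cancel hpos,
      nxt_pow_length hn hfG hx2f]
  clear_value x
  have hex : ∃ k, d.inv ((σ ^ k) x) ∉ o := ⟨f.length - 1, by rw [hx2e]; exact hx2o⟩
  obtain ⟨m, hm, hmin⟩ : ∃ m, d.inv ((σ ^ m) x) ∉ o ∧ ∀ k < m, d.inv ((σ ^ k) x) ∈ o :=
    ⟨Nat.find hex, Nat.find_spec hex, fun k hk => by simpa using Nat.find_min hex hk⟩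
  have hm1 : 1 ≤ m := by
    by_contra h0
    rw [show m = 0 by omega] at hm
    exact hm hx0o
  have hmL : m < f.length := by
    by_contra! hle
    have := hmin (f.length - 1) (by omega)
    rw [hx2e] at this; exact hx2o this
  have hafter : ∀ j, m ≤ j → j < f.length → d.inv ((σ ^ j) x) ∉ o := by
    intro j hj
    induction j, hj using Nat.le_induction with
    | base => exact fun _ => hm
    | succ j hj ih =>
      intro hjl hc
      have h1 : (σ ^ j) x ∈ En := by
        rw [hEn, Finset.mem_filter, memF]
        refine ⟨nxt_pow_mem hn hfG hxf _, ih (by omega), ?_⟩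
        rwa [← Equiv.Perm.mul_apply, ← pow_succ']
      rw [hx2, Finset.mem_singleton, ← hx2e] at h1
      have := nxt_pow_inj hn hfG hxf (by omega) (by omega) h1
      omega
  have hNcard : (F.filter (fun x => d.inv x ∉ o)).card = f.length - m := by
    have h1 : F.filter (fun x => d.inv x ∉ o) = (Finset.Ico m f.length).image (fun j => (σ ^ j) x) := by
      ext z
      rw [Finset.mem_filter, memF, Finset.mem_image]
      constructor
      · rintro ⟨hz, hzo⟩
        obtain ⟨j, hj, rfl⟩ := exists_pow_eq hn hfG hxf hz
        refine ⟨j, ?_, rfl⟩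
        rw [Finset.mem_Ico]
        refine ⟨?_, hj⟩
        by_contra! hlt
        exact hzo (hmin j hlt)
      · rintro ⟨j, hj, rfl⟩
        rw [Finset.mem_Ico] at hj
        exact ⟨nxt_pow_mem hn hfG hxf _, hafter j hj.1 hj.2⟩
    rw [h1, Finset.card_image_of_injOn, Nat.card_Ico]
    intro i hi j hj hij
    rw [Finset.mem_coe, Finset.mem_Ico] at hi hj
    exact nxt_pow_inj hn hfG hxf hi.2 hj.2 hij
  rw [hNcard] at hcov
  have hfl : ∀ j, 1 ≤ j → j < m → Flat d (o :: fs) ((σ ^ j) x) := by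
    intro j hj1 hjm
    refine h.flat_of_outer hs hf (nxt_pow_mem hn hfG hxf _) (hmin j hjm) ?_
    have := hmin (j - 1) (by omega)
    convert this using 2
    rw [Equiv.symm_apply_eq, ← hσ, ← Equiv.Perm.mul_apply, ← pow_succ', Nat.sub_add_cancel hj1]
  have hyo := hmin (m - 1) (by omega)
  have hmn := h.arc_len hf hxf hm1 hmL.le hfl hyo
  obtain ⟨hk, ρ, hρ, hl, hrd⟩ := h.arc_read hf hxf hm1 hmL.le hfl
  rw [← hσ] at hk hrd
  set y := d.inv ((σ ^ (m - 1)) x) with hy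
  have hT1 : 1 ≤ T.card := by omega
  have hon := h.length_outer
  have hidx : o.idxOf y < o.length := List.idxOf_lt_length_of_mem hyo
  have hyk : ∀ j, (σ ^ j) y = o[(o.idxOf y + j) % o.length]'(Nat.mod_lt _ (by omega)) := by
    intro j
    have := nxt_pow_getElem hn (by simp : o ∈ o :: fs) (o.idxOf y) j hidx
    rwa [List.getElem_idxOf] at this
  have hon' : o.Nodup := face_nodup hn (by simp)
  have hpre : ((w ++ w).drop (o.idxOf y)).take m <+: ρ := by
    rw [List.prefix_iff_eq_take]
    apply List.ext_getElem?
    intro j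
    by_cases hj : j < m
    · rw [List.getElem?_take_of_lt hj, List.getElem?_take_of_lt (by
        simp only [List.length_take, List.length_drop, List.length_append]; omega), hrd j hj,
        List.getElem?_drop, hyk j]
      have h3 : ∀ k, k < 2 * w.length → (hw0 : 0 < w.length) → (w ++ w)[k]? = some (w[k % w.length]'(Nat.mod_lt _ hw0)) := by
        intro k hk hw0
        by_cases hkw : k < w.length
        · rw [List.getElem?_append_left hkw, List.getElem?_eq_getElem hkw]
          congr 2; exact (Nat.mod_eq_of_lt hkw).symm
        · rw [List.getElem?_append_right (by omega), List.getElem?_eq_getElem (by omega)]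
          congr 2
          rw [Nat.mod_eq_sub_mod (by omega), Nat.mod_eq_of_lt (by omega)]
      rw [h3 _ (by omega) (by omega)]
      congr 1
      have h4 : ∀ k (hk : k < w.length), w[k] = d.lab (o[k]'(by omega)) := by
        intro k hk
        simp only [← h.outer, List.getElem_map]
      rw [h4]
      simp only [hon]
    · rw [List.getElem?_eq_none (by rw [List.length_take]; omega),
        List.getElem?_eq_none (by
          simp only [List.length_take, List.length_drop, List.length_append]; omega)]
  have harc1 := harc (o.idxOf y) (by omega) m hm1 (by omega) ρ hρ T.card hT1 (by omega) hpre (by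
    rw [hl]
    have h5 : T.card * (f.length - 1) < T.card * f.length :=
      Nat.mul_lt_mul_of_pos_left (by omega) (by omega)
    have h6 : 6 * (f.length - m) < T.card * f.length := lt_of_le_of_lt hcov h5
    rw [Nat.sub_mul]
    omega)
  have hsum : ∑ j ∈ Finset.Ico 1 m, β ((o.idxOf y + j) % w.length) ≤ (f.map (outSum d o β)).sum := by
    rw [← List.sum_toFinset _ hfn]
    have h7 : ∀ j ∈ Finset.Ico 1 m, β ((o.idxOf y + j) % w.length) =
        outSum d o β ((σ ^ (m - 1 - j)) x) := by
      intro j hj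
      rw [Finset.mem_Ico] at hj
      rw [outSum, if_pos (hmin _ (by omega)), ← hk j hj.2, hyk, ← hon]
      congr 1
      rw [hon'.idxOf_getElem]
    rw [Finset.sum_congr rfl h7]
    rw [← Finset.sum_image (f := outSum d o β) (g := fun j => (σ ^ (m - 1 - j)) x)]
    · refine Finset.sum_le_sum_of_subset ?_
      intro z hz
      obtain ⟨j, _, rfl⟩ := Finset.mem_image.1 hz
      exact (memF _).2 (nxt_pow_mem hn hfG hxf _)
    · intro i hi j hj hij
      rw [Finset.mem_coe, Finset.mem_Ico] at hi hj
      have := nxt_pow_inj hn hfG hxf (by omega) (by omega) hij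
      omega
  omega

end Count

end GSC

namespace GSC

section Count

variable {S : Type} {P : C6Presentation S} {w : Word S}

open Classical in
/-- Combinatorial Gauss-Bonnet for a simple closed word: if every arc of a relator along the
boundary collects enough of the budget `β`, then the total budget is at least `6`. -/
theorem six_le_budget_simple (hne : w ≠ []) (hr : Reduced w) (hw : P.elt w = 1)
    (hs : SimpleWord P w) (hrel : w ∉ P.rels) {β : ℕ → ℕ} (harc : CycArcs P w β) :
    6 ≤ ∑ k ∈ Finset.range w.length, β k := by
  obtain ⟨d, o, fs, h⟩ := exists_red_diagram hne hr hw
  have hn := h.ok.nodup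
  have ho : o ∈ o :: fs := by simp
  have hon : o.Nodup := face_nodup hn ho
  have hfn : fs.flatten.Nodup := by
    rw [List.flatten_cons, List.nodup_append] at hn
    exact hn.2.1
  have hfG : ∀ x ∈ fs.flatten, x ∈ (o :: fs).flatten := fun x hx => by
    rw [List.flatten_cons]; exact List.mem_append_right _ hx
  have hlen := h.length_outer
  have hpos : 0 < w.length := List.length_pos_of_ne_nil hne
  have hD : (o :: fs).flatten ≠ [] := by
    intro hc
    have := congrArg List.length hc
    rw [List.flatten_cons, List.length_append] at this
    simp only [List.length_nil] at this
    omega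
  have e1 := h.ok.euler hD
  have e2 := h.count_vertices hr hs
  have e3 : (o :: fs).flatten.countP (fun x => Flat d (o :: fs) x) +
      (o :: fs).flatten.countP (fun x => ¬ Flat d (o :: fs) x) = (o :: fs).flatten.length := by
    have := List.length_eq_countP_add_countP (fun x => decide (Flat d (o :: fs) x))
      (l := (o :: fs).flatten)
    rw [this]
    congr 2
    ext x; simp
  have e4 : (o :: fs).flatten.countP (fun x => ¬ Flat d (o :: fs) x) =
      o.countP (fun x => ¬ Flat d (o :: fs) x) +
        (fs.map (List.countP fun x => ¬ Flat d (o :: fs) x)).sum := by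
    rw [List.flatten_cons, List.countP_append, List.countP_flatten]
  have e5 : fs.flatten.countP (fun x => d.inv x ∈ o ∧ d.inv (nxt (o :: fs) x) ∉ o) ≤
      o.countP (fun x => ¬ Flat d (o :: fs) x) := by
    rw [countP_eq_card hon, countP_eq_card hfn]
    refine Finset.card_le_card_of_injOn d.inv ?_ ?_
    · intro x hx
      rw [Finset.mem_coe, Finset.mem_filter, List.mem_toFinset] at hx
      rw [Finset.mem_coe, Finset.mem_filter, List.mem_toFinset, h.flat_outer_iff hs hx.2.1,
        h.ok.inv_inv x (hfG x hx.1)]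
      exact hx.2
    · intro x hx y hy hxy
      rw [Finset.mem_coe, Finset.mem_filter, List.mem_toFinset] at hx hy
      have := congrArg d.inv hxy
      rwa [h.ok.inv_inv _ (hfG _ hx.1), h.ok.inv_inv _ (hfG _ hy.1)] at this
  have e6 : 6 * fs.length ≤ (fs.map fun f => f.countP (fun x => ¬ Flat d (o :: fs) x) +
      f.countP (fun x => d.inv x ∈ o ∧ d.inv (nxt (o :: fs) x) ∉ o) +
      (f.map (outSum d o β)).sum).sum := by
    have h1 := List.card_nsmul_le_sum (fs.map fun f => f.countP (fun x => ¬ Flat d (o :: fs) x) +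
      f.countP (fun x => d.inv x ∈ o ∧ d.inv (nxt (o :: fs) x) ∉ o) +
      (f.map (outSum d o β)).sum) 6 (by
        intro y hy
        obtain ⟨f, hf, rfl⟩ := List.mem_map.1 hy
        exact h.face_ineq hs hrel harc hf)
    rw [List.length_map, smul_eq_mul, mul_comm] at h1
    exact h1
  rw [List.sum_map_add, List.sum_map_add] at e6
  rw [List.countP_flatten] at e5
  have e7 : (fs.map fun f => (f.map (outSum d o β)).sum).sum ≤ ∑ k ∈ Finset.range w.length, β k := by
    have h1 : (fs.map fun f => (f.map (outSum d o β)).sum).sum =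
        (fs.flatten.map (outSum d o β)).sum := by
      rw [List.map_flatten, List.sum_flatten, List.map_map]; rfl
    rw [h1, ← List.sum_toFinset _ hfn]
    have h2 : ∑ x ∈ fs.flatten.toFinset, outSum d o β x =
        ∑ x ∈ fs.flatten.toFinset.filter (fun x => d.inv x ∈ o), β (o.idxOf (d.inv x)) := by
      rw [Finset.sum_filter]; rfl
    rw [h2, ← Finset.sum_image (f := β) (g := fun x => o.idxOf (d.inv x))]
    · refine Finset.sum_le_sum_of_subset ?_
      intro k hk
      obtain ⟨x, hx, rfl⟩ := Finset.mem_image.1 hk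
      rw [Finset.mem_filter] at hx
      rw [Finset.mem_range, ← hlen]
      exact List.idxOf_lt_length_of_mem hx.2
    · intro x hx y hy hxy
      rw [Finset.mem_coe, Finset.mem_filter, List.mem_toFinset] at hx hy
      have h3 : d.inv x = d.inv y := (List.idxOf_inj hx.2).1 hxy
      have := congrArg d.inv h3
      rwa [h.ok.inv_inv _ (hfG _ hx.1), h.ok.inv_inv _ (hfG _ hy.1)] at this
  have e8 : (o :: fs).length = fs.length + 1 := rfl
  omega

end Count

end GSC

namespace GSC

section Closed

variable {S : Type} {P : C6Presentation S} {w : Word S}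

/-- Arcs of relators inside the interval `[a, b]` of `W` cover enough of the budget `β`. -/
def LinArcs (P : C6Presentation S) (W : Word S) (β : ℕ → ℕ) (a b : ℕ) : Prop :=
  ∀ s m, a ≤ s → 1 ≤ m → s + m ≤ b → ∀ ρ ∈ P.rels, ∀ i, 1 ≤ i → i ≤ 3 →
    (W.drop s).take m <+: ρ → (6 - i) * ρ.length < 6 * m →
    4 - i ≤ ∑ j ∈ Finset.Ico 1 m, β (s + j)

lemma elt_sub (P : C6Presentation S) (W : Word S) {a b : ℕ} (hab : a ≤ b) :
    P.elt (W.take b) = P.elt (W.take a) * P.elt ((W.drop a).take (b - a)) := by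
  rw [← elt_append]
  congr 1
  rw [← List.take_add, Nat.add_sub_cancel' hab]

lemma sum_Ico_shift (β : ℕ → ℕ) (s m : ℕ) :
    ∑ j ∈ Finset.Ico 1 m, β (s + j) = ∑ k ∈ Finset.Ico (s + 1) (s + m), β k := by
  rw [Finset.sum_Ico_add (fun k => β k) 1 m s, Nat.add_comm 1 s, Nat.add_comm m s]

theorem three_le_budget {W : Word S} (hr : Reduced W) {β : ℕ → ℕ} {a b : ℕ} (hab : a < b)
    (hb : b ≤ W.length) (hcl : P.elt (W.take a) = P.elt (W.take b)) (harc : LinArcs P W β a b) :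
    3 ≤ ∑ k ∈ Finset.Ico (a + 1) b, β k := by
  induction hn : b - a using Nat.strong_induction_on generalizing a b with
  | _ n ih =>
  by_cases hmin : ∃ a' b', a ≤ a' ∧ a' < b' ∧ b' ≤ b ∧ b' - a' < n ∧
      P.elt (W.take a') = P.elt (W.take b')
  · obtain ⟨a', b', h1, h2, h3, h4, h5⟩ := hmin
    refine (ih (b' - a') h4 h2 (h3.trans hb) h5 ?_ rfl).trans ?_
    · intro s m hs hm hsm
      exact harc s m (h1.trans hs) hm (hsm.trans h3)
    · exact Finset.sum_le_sum_of_subset (Finset.Ico_subset_Ico (by omega) h3)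
  push Not at hmin
  set u := (W.drop a).take n with hu
  have hlen : u.length = n := by rw [hu, List.length_take, List.length_drop]; omega
  have hured : Reduced u := hr.infix ((List.take_prefix _ _).isInfix.trans (List.drop_suffix _ _).isInfix)
  have hune : u ≠ [] := by intro h; rw [h] at hlen; simp at hlen; omega
  have hsub : ∀ i ≤ n, P.elt (W.take (a + i)) = P.elt (W.take a) * P.elt (u.take i) := by
    intro i hi
    rw [elt_sub P W (Nat.le_add_right a i), Nat.add_sub_cancel_left, hu, List.take_take,
      Nat.min_eq_left hi]
  have hu1 : P.elt u = 1 := by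
    have := hsub n le_rfl
    rw [show a + n = b by omega, ← hcl, ← hlen, List.take_length] at this
    exact (mul_eq_left.1 this.symm)
  have hsimp : SimpleWord P u := by
    have key : ∀ i j, i < j → j < u.length → P.elt (u.take i) ≠ P.elt (u.take j) := by
      intro i j hij hj heq
      refine hmin (a + i) (a + j) (by omega) (by omega) (by omega) (by omega) ?_
      rw [hsub i (by omega), hsub j (by omega), heq]
    intro i hi j hj heq
    rcases lt_trichotomy i j with h | h | h
    · exact absurd heq (key i j h hj)
    · exact h
    · exact absurd heq.symm (key j i h hi)
  by_cases hrel : u ∈ P.rels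
  · have := harc a n le_rfl (by omega) (by omega) u hrel 1 le_rfl (by omega) (by rw [← hu])
      (by rw [hlen]; omega)
    rw [sum_Ico_shift, show a + n = b by omega] at this
    exact this
  set β' : ℕ → ℕ := fun k => if k = 0 then 3 else β (a + k) with hβ'
  have h6 := six_le_budget_simple hune hured hu1 hsimp hrel (β := β') (by
    intro s hs m hm hmn ρ hρ i hi hi3 hpre hlt
    rw [hlen] at hs hmn ⊢
    by_cases hsm : s + m ≤ n
    · have h1 := harc (a + s) m (by omega) hm (by omega) ρ hρ i hi hi3 (by
        have : (W.drop (a + s)).take m = ((u ++ u).drop s).take m := by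
          rw [List.drop_append_of_le_length (by omega), List.take_append_of_le_length
            (by rw [List.length_drop]; omega), hu, List.drop_take, List.take_take, List.drop_drop,
            Nat.min_eq_left (by omega)]
        rw [this]; exact hpre) hlt
      refine h1.trans (le_of_eq (Finset.sum_congr rfl fun j hj => ?_))
      rw [Finset.mem_Ico] at hj
      rw [hβ', Nat.mod_eq_of_lt (by omega)]
      simp only [Nat.add_eq_zero_iff]
      rw [if_neg (by omega), Nat.add_assoc]
    · have h1 : β' ((s + (n - s)) % n) ≤ ∑ j ∈ Finset.Ico 1 m, β' ((s + j) % n) :=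
        Finset.single_le_sum (f := fun j => β' ((s + j) % n)) (fun _ _ => Nat.zero_le _)
          (by rw [Finset.mem_Ico]; omega)
      have h2 : β' 0 = 3 := by simp [hβ']
      rw [Nat.add_sub_cancel' (by omega), Nat.mod_self, h2] at h1
      omega)
  rw [hlen] at h6
  obtain ⟨n', rfl⟩ : ∃ n', n = n' + 1 := ⟨n - 1, by omega⟩
  rw [Finset.sum_range_succ'] at h6
  have h7 : ∑ k ∈ Finset.range n', β' (k + 1) = ∑ k ∈ Finset.Ico (a + 1) b, β k := by
    rw [Finset.sum_Ico_eq_sum_range, show b - (a + 1) = n' by omega]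
    refine Finset.sum_congr rfl fun k _ => ?_
    simp only [hβ']
    rw [if_neg (by omega)]
    congr 1; omega
  rw [h7] at h6
  simp only [hβ', if_pos] at h6
  omega

theorem six_le_budget (hne : w ≠ []) (hr : CyclicallyReduced w) (hw : P.elt w = 1)
    (hrel : w ∉ P.rels) {β : ℕ → ℕ} (harc : CycArcs P w β) :
    6 ≤ ∑ k ∈ Finset.range w.length, β k := by
  by_cases hs : SimpleWord P w
  · exact six_le_budget_simple hne hr.reduced hw hs hrel harc
  have hs' : ∃ i j, i < j ∧ j < w.length ∧ P.elt (w.take i) = P.elt (w.take j) := by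
    by_contra! hc
    refine hs fun i hi j hj heq => ?_
    rcases lt_trichotomy i j with h | h | h
    · exact absurd heq (hc i j h hj)
    · exact h
    · exact absurd heq.symm (hc j i h hi)
  obtain ⟨i, j, hij, hj, heq⟩ := hs'
  set n := w.length with hn
  have hln : (w ++ w).length = 2 * n := by rw [List.length_append]; omega
  have hlin : ∀ a b, b ≤ 2 * n → b ≤ a + n → LinArcs P (w ++ w) (fun k => β (k % n)) a b := by
    intro a b hb hba s m hs hm hsm ρ hρ i hi hi3 hpre hlt
    by_cases hsn : s < n
    · exact harc s hsn m hm (by omega) ρ hρ i hi hi3 hpre hlt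
    · have h1 := harc (s - n) (by omega) m hm (by omega) ρ hρ i hi hi3 (by
        have : ((w ++ w).drop (s - n)).take m = ((w ++ w).drop s).take m := by
          have h2 : (w ++ w).drop s = w.drop (s - n) := by
            rw [List.drop_append, List.drop_eq_nil_of_le (by omega), List.nil_append]
          rw [h2, List.drop_append_of_le_length (by omega), List.take_append_of_le_length
            (by rw [List.length_drop]; omega)]
        rw [this]; exact hpre) hlt
      refine h1.trans (le_of_eq (Finset.sum_congr rfl fun j _ => ?_))
      change β ((s - n + j) % n) = β ((s + j) % n)
      congr 1
      rw [show s + j = s - n + j + n by omega, Nat.add_mod_right]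
  have t1 : ∀ k ≤ n, (w ++ w).take k = w.take k := fun k hk =>
    List.take_append_of_le_length hk
  have l1 := three_le_budget (P := P) (W := w ++ w) hr hij (by omega)
    (by rw [t1 i (by omega), t1 j hj.le, heq]) (hlin i j (by omega) (by omega))
  have l2 := three_le_budget (P := P) (W := w ++ w) hr (a := j) (b := n + i) (by omega) (by omega)
    (by rw [t1 j hj.le, hn, List.take_length_add_append, elt_append, hw, one_mul, heq])
    (hlin j (n + i) (by omega) (by omega))
  have s1 : ∑ k ∈ Finset.Ico (i + 1) j, β (k % n) = ∑ k ∈ Finset.Ico (i + 1) j, β k :=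
    Finset.sum_congr rfl fun k hk => by
      rw [Finset.mem_Ico] at hk; rw [Nat.mod_eq_of_lt (by omega)]
  have s2 : ∑ k ∈ Finset.Ico (j + 1) (n + i), β (k % n) =
      ∑ k ∈ Finset.Ico (j + 1) n, β k + ∑ k ∈ Finset.Ico 0 i, β k := by
    rw [← Finset.sum_Ico_consecutive _ (show j + 1 ≤ n by omega) (Nat.le_add_right n i)]
    congr 1
    · exact Finset.sum_congr rfl fun k hk => by
        rw [Finset.mem_Ico] at hk; rw [Nat.mod_eq_of_lt (by omega)]
    · have := Finset.sum_Ico_add (fun k => β (k % n)) 0 i n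
      rw [Nat.zero_add, Nat.add_comm i n] at this
      rw [← this]
      exact Finset.sum_congr rfl fun k hk => by
        rw [Finset.mem_Ico] at hk; rw [Nat.add_mod_left, Nat.mod_eq_of_lt (by omega)]
  rw [s1] at l1
  rw [s2] at l2
  have s3 : ∑ k ∈ Finset.range n, β k = ∑ k ∈ Finset.Ico 0 i, β k + ∑ k ∈ Finset.Ico i j, β k +
      ∑ k ∈ Finset.Ico j n, β k := by
    rw [Finset.sum_Ico_consecutive _ (Nat.zero_le _) hij.le,
      Finset.sum_Ico_consecutive _ (Nat.zero_le _) hj.le, Finset.range_eq_Ico]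
  have s4 : ∑ k ∈ Finset.Ico (i + 1) j, β k ≤ ∑ k ∈ Finset.Ico i j, β k :=
    Finset.sum_le_sum_of_subset (Finset.Ico_subset_Ico (by omega) le_rfl)
  have s5 : ∑ k ∈ Finset.Ico (j + 1) n, β k ≤ ∑ k ∈ Finset.Ico j n, β k :=
    Finset.sum_le_sum_of_subset (Finset.Ico_subset_Ico (by omega) le_rfl)
  omega

end Closed

end GSC

namespace GSC

section Violators

variable {S : Type} {P : C6Presentation S}

/-- More than half of a relator inside a segment. -/
def Viol1 (P : C6Presentation S) (z : Word S) : Prop :=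
  ∃ ρ ∈ P.rels, ∃ u, u <:+: z ∧ u <+: ρ ∧ 3 * ρ.length < 6 * u.length

/-- More than two thirds of a relator across one junction. -/
def Viol2 (P : C6Presentation S) (z₀ z₁ : Word S) : Prop :=
  ∃ ρ ∈ P.rels, ∃ u v, u ≠ [] ∧ v ≠ [] ∧ u <:+ z₀ ∧ v <+: z₁ ∧ u ++ v <+: ρ ∧
    4 * ρ.length < 6 * (u.length + v.length)

/-- More than five sixths of a relator across two junctions. -/
def Viol3 (P : C6Presentation S) (z₀ z₁ z₂ : Word S) : Prop :=
  ∃ ρ ∈ P.rels, ∃ u v, u ≠ [] ∧ v ≠ [] ∧ u <:+ z₀ ∧ v <+: z₂ ∧ u ++ z₁ ++ v <+: ρ ∧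
    5 * ρ.length < 6 * (u.length + z₁.length + v.length)

lemma viol_of_arc {z₀ z₁ z₂ r ρ : Word S} {a m b : ℕ} (hρ : ρ ∈ P.rels)
    (hX : ((z₀ ++ (z₁ ++ (z₂ ++ r))).drop a).take m <+: ρ) (ha : a < z₀.length)
    (hlt : (3 + b) * ρ.length < 6 * m) (h1 : z₀.length < a + m → 1 ≤ b)
    (h2 : z₀.length + z₁.length < a + m → 2 ≤ b)
    (h3 : a + m ≤ z₀.length + z₁.length + z₂.length) :
    Viol1 P z₀ ∨ Viol2 P z₀ z₁ ∨ Viol3 P z₀ z₁ z₂ := by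
  rw [List.drop_append_of_le_length ha.le] at hX
  have hl0 : (z₀.drop a).length = z₀.length - a := List.length_drop
  by_cases c1 : a + m ≤ z₀.length
  · left
    rw [List.take_append_of_le_length (by omega)] at hX
    refine ⟨ρ, hρ, _, (List.take_prefix _ _).isInfix.trans (List.drop_suffix a _).isInfix, hX, ?_⟩
    rw [List.length_take, hl0, Nat.min_eq_left (by omega)]
    exact lt_of_le_of_lt (Nat.mul_le_mul_right _ (by omega)) hlt
  push Not at c1
  have hne : z₀.drop a ≠ [] := by intro h; rw [h] at hl0; simp at hl0; omega
  rw [List.take_append, List.take_of_length_le (by omega), hl0] at hX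
  by_cases c2 : a + m ≤ z₀.length + z₁.length
  · right; left
    rw [List.take_append_of_le_length (by omega)] at hX
    have hl1 : (z₁.take (m - (z₀.length - a))).length = m - (z₀.length - a) := by
      rw [List.length_take, Nat.min_eq_left (by omega)]
    refine ⟨ρ, hρ, _, _, hne, ?_, List.drop_suffix _ _, List.take_prefix _ _, hX, ?_⟩
    · intro h; rw [h] at hl1; simp at hl1; omega
    · rw [hl0, hl1, show z₀.length - a + (m - (z₀.length - a)) = m by omega]
      exact lt_of_le_of_lt (Nat.mul_le_mul_right _ (by have := h1 c1; omega)) hlt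
  push Not at c2
  right; right
  rw [List.take_append, List.take_of_length_le (l := z₁) (by omega),
    List.take_append_of_le_length (by omega), ← List.append_assoc] at hX
  have hl1 : (z₂.take (m - (z₀.length - a) - z₁.length)).length =
      m - (z₀.length - a) - z₁.length := by
    rw [List.length_take, Nat.min_eq_left (by omega)]
  refine ⟨ρ, hρ, _, _, hne, ?_, List.drop_suffix _ _, List.take_prefix _ _, hX, ?_⟩
  · intro h; rw [h] at hl1; simp at hl1; omega
  · rw [hl0, hl1, show z₀.length - a + z₁.length + (m - (z₀.length - a) - z₁.length) = m by omega]
    exact lt_of_le_of_lt (Nat.mul_le_mul_right _ (by have := h2 c2; omega)) hlt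

lemma exists_between {J : ℕ → ℕ} (h0 : J 0 = 0) {a N : ℕ} (h : a < J N) :
    ∃ s < N, J s ≤ a ∧ a < J (s + 1) := by
  induction N with
  | zero => omega
  | succ N ih =>
    by_cases hN : a < J N
    · obtain ⟨s, hs, h1⟩ := ih hN
      exact ⟨s, by omega, h1⟩
    · exact ⟨N, by omega, by omega, h⟩

theorem exists_viol_cyc {z : ℕ → Word S} (hz : ∀ l, z (l + 5) = z l)
    (hne : z 0 ++ (z 1 ++ (z 2 ++ (z 3 ++ z 4))) ≠ [])
    (hr : CyclicallyReduced (z 0 ++ (z 1 ++ (z 2 ++ (z 3 ++ z 4)))))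
    (hw : P.elt (z 0 ++ (z 1 ++ (z 2 ++ (z 3 ++ z 4)))) = 1)
    (hrel : z 0 ++ (z 1 ++ (z 2 ++ (z 3 ++ z 4))) ∉ P.rels) :
    ∃ s < 5, Viol1 P (z s) ∨ Viol2 P (z s) (z (s + 1)) ∨ Viol3 P (z s) (z (s + 1)) (z (s + 2)) := by
  by_contra! hno
  set w := z 0 ++ (z 1 ++ (z 2 ++ (z 3 ++ z 4))) with hwdef
  set n := w.length with hn
  have hpos : 0 < n := List.length_pos_of_ne_nil hne
  set J : ℕ → ℕ := fun l => ∑ i ∈ Finset.range l, (z i).length with hJ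
  have hJs : ∀ l, J (l + 1) = J l + (z l).length := fun l => Finset.sum_range_succ _ _
  have hJ0 : J 0 = 0 := rfl
  have hJ5 : J 5 = n := by
    rw [hn, hwdef]
    simp only [List.length_append, hJs, hJ0]
    omega
  have hJp : ∀ l, J (l + 5) = J l + n := by
    intro l
    induction l with
    | zero => rw [hJ0, Nat.zero_add, Nat.zero_add, hJ5]
    | succ l ih =>
      rw [show l + 1 + 5 = l + 5 + 1 by omega, hJs, ih, hz, hJs]; omega
  have hJm : Monotone J := monotone_nat_of_le_succ fun l => by rw [hJs]; omega
  have hJmod : ∀ l, J l % n = J (l % 5) % n := by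
    intro l
    induction l using Nat.strong_induction_on with
    | _ l ih =>
      by_cases h : l < 5
      · rw [Nat.mod_eq_of_lt h]
      · have h1 := hJp (l - 5)
        rw [Nat.sub_add_cancel (by omega)] at h1
        rw [h1, Nat.add_mod_right, ih (l - 5) (by omega)]
        congr 2; omega
  set β : ℕ → ℕ := fun k => ∑ l ∈ Finset.range 5, if k = J l % n then 1 else 0 with hβ
  have htot : ∑ k ∈ Finset.range n, β k = 5 := by
    rw [hβ, Finset.sum_comm]
    have : ∀ l ∈ Finset.range 5, ∑ k ∈ Finset.range n, (if k = J l % n then 1 else 0) = 1 := by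
      intro l _
      rw [Finset.sum_ite_eq', if_pos (Finset.mem_range.2 (Nat.mod_lt _ hpos))]
    rw [Finset.sum_congr rfl this]; simp
  have h6 := six_le_budget (P := P) hne hr hw hrel (β := β) (by
    intro a ha m hm hmn ρ hρ i hi hi3 hpre hlt
    obtain ⟨s, hs, hsa, has⟩ := exists_between hJ0 (hJ5 ▸ ha : a < J 5)
    by_contra! hsum
    rw [← hn] at hsum
    have hcount : ∀ t ≤ 3, J (s + t) < a + m →
        t ≤ ∑ j ∈ Finset.Ico 1 m, β ((a + j) % n) := by
      intro t ht hJt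
      rw [hβ, Finset.sum_comm]
      have h1 : ∑ l ∈ (Finset.Ico 1 (t + 1)).image (fun l => (s + l) % 5), 1 ≤
          ∑ l ∈ Finset.range 5, ∑ j ∈ Finset.Ico 1 m,
            (if (a + j) % n = J l % n then 1 else 0) := by
        refine (Finset.sum_le_sum ?_).trans (Finset.sum_le_sum_of_subset ?_)
        · intro l hl
          obtain ⟨l', hl', rfl⟩ := Finset.mem_image.1 hl
          rw [Finset.mem_Ico] at hl'
          have g1 : J (s + 1) ≤ J (s + l') := hJm (by omega)
          have g2 : J (s + l') ≤ J (s + t) := hJm (by omega)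
          have g3 := Finset.single_le_sum (f := fun j => if (a + j) % n = J ((s + l') % 5) % n
            then 1 else 0) (s := Finset.Ico 1 m) (fun _ _ => Nat.zero_le _)
            (show J (s + l') - a ∈ Finset.Ico 1 m by rw [Finset.mem_Ico]; omega)
          refine le_trans ?_ g3
          rw [Nat.add_sub_cancel' (by omega), hJmod, if_pos rfl]
        · intro l hl
          obtain ⟨l', hl', rfl⟩ := Finset.mem_image.1 hl
          exact Finset.mem_range.2 (Nat.mod_lt _ (by omega))
      rw [Finset.sum_const, smul_eq_mul, mul_one, Finset.card_image_of_injOn, Nat.card_Ico] at h1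
      · simpa using h1
      · intro x hx y hy hxy
        rw [Finset.mem_coe, Finset.mem_Ico] at hx hy
        simp only at hxy
        omega
    have hww : w ++ w = (z 0 ++ (z 1 ++ (z 2 ++ (z 3 ++ (z 4 ++ (z 5 ++ (z 6 ++ (z 7 ++
        (z 8 ++ z 9))))))))) := by
      rw [hwdef, show z 5 = z 0 from hz 0, show z 6 = z 1 from hz 1, show z 7 = z 2 from hz 2,
        show z 8 = z 3 from hz 3, show z 9 = z 4 from hz 4]
      simp only [List.append_assoc]
    have hd : ∃ r, (w ++ w).drop (J s) = z s ++ (z (s + 1) ++ (z (s + 2) ++ r)) := by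
      have dl : ∀ u v : Word S, ∀ k, (u ++ v).drop (u.length + k) = v.drop k := fun u v k =>
        List.drop_length_add_append ..
      rw [hww]
      interval_cases s <;> simp only [hJs, hJ0, Nat.zero_add, Nat.add_assoc, dl,
        List.drop_left', List.drop_zero, Nat.reduceAdd]
      all_goals exact ⟨_, rfl⟩
    obtain ⟨r, hd⟩ := hd
    have hda : (w ++ w).drop a = (z s ++ (z (s + 1) ++ (z (s + 2) ++ r))).drop (a - J s) := by
      rw [← hd, List.drop_drop, Nat.add_sub_cancel' hsa]
    rw [hda] at hpre
    have e1 := hJs s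
    have e2 := hJs (s + 1)
    have e3 := hJs (s + 2)
    have c1 := hcount 1 (by omega)
    have c2 := hcount 2 (by omega)
    have c3 := hcount 3 (by omega)
    have e4 : s + 2 + 1 = s + 3 := rfl
    have e5 : s + 1 + 1 = s + 2 := rfl
    rw [e4] at e3
    rw [e5] at e2
    obtain ⟨n1, n2, n3⟩ := hno s hs
    have := viol_of_arc (b := 3 - i) hρ hpre (by omega)
      (by rwa [show 3 + (3 - i) = 6 - i by omega]) (by omega) (by omega) (by
        by_contra! hc
        have := c3 (by omega)
        omega)
    rcases this with h | h | h
    · exact n1 h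
    · exact n2 h
    · exact n3 h)
  rw [htot] at h6
  omega

theorem exists_viol_lin {z₀ z₁ z₂ : Word S} (hne : z₀ ++ (z₁ ++ z₂) ≠ [])
    (hr : Reduced (z₀ ++ (z₁ ++ z₂))) (hw : P.elt (z₀ ++ (z₁ ++ z₂)) = 1) :
    Viol1 P z₀ ∨ Viol1 P z₁ ∨ Viol1 P z₂ ∨ Viol2 P z₀ z₁ ∨ Viol2 P z₁ z₂ ∨ Viol3 P z₀ z₁ z₂ := by
  by_contra! hno
  obtain ⟨n1, n2, n3, n4, n5, n6⟩ := hno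
  set w := z₀ ++ (z₁ ++ z₂) with hwdef
  have hlen : w.length = z₀.length + (z₁.length + z₂.length) := by
    rw [hwdef, List.length_append, List.length_append]
  have hpos : 0 < w.length := List.length_pos_of_ne_nil hne
  set β : ℕ → ℕ := fun k => (if k = z₀.length then 1 else 0) +
    (if k = z₀.length + z₁.length then 1 else 0) with hβ
  have hle : ∀ I : Finset ℕ, ∑ k ∈ I, β k = (if z₀.length ∈ I then 1 else 0) +
      (if z₀.length + z₁.length ∈ I then 1 else 0) := by
    intro I
    rw [hβ, Finset.sum_add_distrib, Finset.sum_ite_eq', Finset.sum_ite_eq']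
  have h3 := three_le_budget (P := P) (W := w) hr (β := β) hpos le_rfl
    (by rw [List.take_zero, List.take_length, hw, elt_nil]) (by
    intro a m _ hm ham ρ hρ i hi hi3 hpre hlt
    by_contra! hsum
    rw [sum_Ico_shift, hle] at hsum
    simp only [Finset.mem_Ico] at hsum
    have hlt' : (3 + (3 - i)) * ρ.length < 6 * m := by rwa [show 3 + (3 - i) = 6 - i by omega]
    by_cases c1 : a < z₀.length
    · have := viol_of_arc (z₀ := z₀) (z₁ := z₁) (z₂ := z₂) (r := []) (b := 3 - i) hρ
        (by simpa [hwdef] using hpre) c1 hlt'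
        (by intro h; rw [if_pos ⟨by omega, h⟩] at hsum; omega)
        (by intro h; rw [if_pos ⟨by omega, by omega⟩, if_pos ⟨by omega, by omega⟩] at hsum; omega)
        (by omega)
      tauto
    · have hd1 : w.drop a = (z₁ ++ z₂).drop (a - z₀.length) := by
        rw [hwdef, List.drop_append, List.drop_eq_nil_of_le (by omega), List.nil_append]
      by_cases c2 : a < z₀.length + z₁.length
      · have := viol_of_arc (z₀ := z₁) (z₁ := z₂) (z₂ := []) (r := []) (b := 3 - i)
          (a := a - z₀.length) hρ
          (by rw [hd1] at hpre; simpa using hpre) (by omega) hlt'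
          (by intro h; split_ifs at hsum <;> omega)
          (by omega) (by simp; omega)
        rcases this with h | h | ⟨_, _, _, v, _, hv, _, hv', _⟩
        · exact n2 h
        · exact n5 h
        · exact hv (List.prefix_nil.1 hv')
      · have hd2 : w.drop a = z₂.drop (a - z₀.length - z₁.length) := by
          rw [hd1, List.drop_append, List.drop_eq_nil_of_le (by omega), List.nil_append]
        have := viol_of_arc (z₀ := z₂) (z₁ := []) (z₂ := []) (r := []) (b := 3 - i)
          (a := a - z₀.length - z₁.length) hρ
          (by rw [hd2] at hpre; simpa using hpre) (by omega) hlt'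
          (by omega) (by simp; omega) (by simp; omega)
        rcases this with h | ⟨_, _, _, v, _, hv, _, hv', _⟩ | ⟨_, _, _, v, _, hv, _, hv', _⟩
        · exact n3 h
        · exact hv (List.prefix_nil.1 hv')
        · exact hv (List.prefix_nil.1 hv'))
  rw [hle] at h3
  split_ifs at h3 <;> omega

end Violators

end GSC

namespace GSC

section Ladders

variable {S : Type} {P : C6Presentation S}

lemma exists_viol_five {z₀ z₁ z₂ z₃ z₄ : Word S}
    (hne : z₀ ++ (z₁ ++ (z₂ ++ (z₃ ++ z₄))) ≠ [])
    (hr : CyclicallyReduced (z₀ ++ (z₁ ++ (z₂ ++ (z₃ ++ z₄)))))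
    (hw : P.elt (z₀ ++ (z₁ ++ (z₂ ++ (z₃ ++ z₄)))) = 1)
    (hrel : z₀ ++ (z₁ ++ (z₂ ++ (z₃ ++ z₄))) ∉ P.rels) :
    (Viol1 P z₀ ∨ Viol2 P z₀ z₁ ∨ Viol3 P z₀ z₁ z₂) ∨
    (Viol1 P z₁ ∨ Viol2 P z₁ z₂ ∨ Viol3 P z₁ z₂ z₃) ∨
    (Viol1 P z₂ ∨ Viol2 P z₂ z₃ ∨ Viol3 P z₂ z₃ z₄) ∨
    (Viol1 P z₃ ∨ Viol2 P z₃ z₄ ∨ Viol3 P z₃ z₄ z₀) ∨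
    (Viol1 P z₄ ∨ Viol2 P z₄ z₀ ∨ Viol3 P z₄ z₀ z₁) := by
  obtain ⟨s, hs, h⟩ := exists_viol_cyc (P := P)
    (z := fun l => [z₀, z₁, z₂, z₃, z₄].getD (l % 5) []) (by intro l; simp) hne hr hw hrel
  interval_cases s
  · exact Or.inl h
  · exact Or.inr (Or.inl h)
  · exact Or.inr (Or.inr (Or.inl h))
  · exact Or.inr (Or.inr (Or.inr (Or.inl h)))
  · exact Or.inr (Or.inr (Or.inr (Or.inr h)))

/-- No relator has more than half of its length inside `z`. -/
def SDehn (P : C6Presentation S) (z : Word S) : Prop :=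
  ∀ ρ ∈ P.rels, ∀ u, u <:+: z → u <+: ρ → 2 * u.length ≤ ρ.length

/-- No relator has more than two thirds of its length across the junction of `z₀` and `z₁`. -/
def PairOK (P : C6Presentation S) (z₀ z₁ : Word S) : Prop :=
  ∀ ρ ∈ P.rels, ∀ u v, u <:+ z₀ → v <+: z₁ → u ++ v <+: ρ →
    3 * (u.length + v.length) ≤ 2 * ρ.length

/-- A short arc of a relator, possibly empty. -/
def Arc6 (P : C6Presentation S) (c : Word S) : Prop :=
  c = [] ∨ ∃ m, c ++ m ∈ P.rels ∧ 6 * c.length < (c ++ m).length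

lemma rel_inv_rot {u t : Word S} (h : u ++ t ∈ P.rels) : wordInv u ++ wordInv t ∈ P.rels := by
  have := P.inv_mem _ h
  rw [wordInv_append] at this
  exact rel_rot this

lemma SDehn.infix {z z' : Word S} (h : SDehn P z) (hz : z' <:+: z) : SDehn P z' :=
  fun ρ hρ u hu => h ρ hρ u (hu.trans hz)

lemma SDehn.inv {z : Word S} (h : SDehn P z) : SDehn P (wordInv z) := by
  rintro _ hρ u hu ⟨t, rfl⟩
  have h1 := IsInfix.wordInv hu
  rw [wordInv_wordInv] at h1
  have := h _ (rel_inv_rot hρ) _ h1 (List.prefix_append _ _)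
  simpa [length_wordInv] using this

lemma SDehn.nil : SDehn P [] := by
  intro ρ _ u hu _
  rw [List.infix_nil.1 hu]; simp

lemma PairOK.inv {z₀ z₁ : Word S} (h : PairOK P z₀ z₁) : PairOK P (wordInv z₁) (wordInv z₀) := by
  rintro _ hρ u v hu hv ⟨t, rfl⟩
  have h1 := IsSuffix.wordInv hu
  have h2 := IsPrefix.wordInv hv
  rw [wordInv_wordInv] at h1 h2
  have h3 := rel_inv_rot hρ
  rw [wordInv_append] at h3
  have := h _ h3 _ _ h2 h1 (List.prefix_append _ _)
  simp only [List.length_append, length_wordInv] at this ⊢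
  omega

lemma PairOK.mono {z₀ z₁ z₀' z₁' : Word S} (h : PairOK P z₀ z₁) (h0 : z₀' <:+ z₀)
    (h1 : z₁' <+: z₁) : PairOK P z₀' z₁' :=
  fun ρ hρ u v hu hv => h ρ hρ u v (hu.trans h0) (hv.trans h1)

lemma PairOK.nil_left {z : Word S} (h : SDehn P z) : PairOK P [] z := by
  intro ρ hρ u v hu hv huv
  rw [List.suffix_nil.1 hu] at huv ⊢
  have := h ρ hρ v hv.isInfix huv
  simp only [List.length_nil]; omega

lemma Arc6.lt {c u ρ : Word S} (h : Arc6 P c) (hu : u ≠ []) (huc : u <:+: c) (hρ : ρ ∈ P.rels)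
    (huρ : u <+: ρ) : 6 * u.length < ρ.length := by
  rcases h with rfl | ⟨m, hm, hlt⟩
  · exact absurd (List.infix_nil.1 huc) hu
  obtain ⟨a, b, rfl⟩ := huc
  have h1 : u ++ ((b ++ m) ++ a) ∈ P.rels := by
    have : a ++ (u ++ (b ++ m)) ∈ P.rels := by simpa using hm
    simpa using rel_rot this
  by_cases he : u ++ ((b ++ m) ++ a) = ρ
  · rw [← he]; simp only [List.length_append] at hlt ⊢; omega
  · exact piece_lt hρ h1 (Ne.symm he) huρ (List.prefix_append _ _)

lemma Arc6.prefix {c c' : Word S} (h : Arc6 P (c ++ c')) : Arc6 P c := by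
  rcases h with h | ⟨m, hm, hlt⟩
  · exact Or.inl (List.append_eq_nil_iff.1 h).1
  · refine Or.inr ⟨c' ++ m, by simpa using hm, ?_⟩
    simp only [List.length_append] at hlt ⊢; omega

lemma Arc6.lt_inv {c u ρ : Word S} (h : Arc6 P c) (hu : u ≠ []) (huc : u <:+: wordInv c)
    (hρ : ρ ∈ P.rels) (huρ : u <+: ρ) : 6 * u.length < ρ.length := by
  obtain ⟨t, rfl⟩ := huρ
  have h1 := IsInfix.wordInv huc
  rw [wordInv_wordInv] at h1
  have := h.lt (by simpa using hu) h1 (rel_inv_rot hρ) (List.prefix_append _ _)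
  simpa [length_wordInv] using this

/-- Words all of whose nonempty common parts with relators are short. -/
def Bd1 (P : C6Presentation S) (c : Word S) : Prop :=
  ∀ ρ ∈ P.rels, ∀ u, u ≠ [] → u <:+: c → u <+: ρ → 6 * u.length < ρ.length

lemma Arc6.bd1 {c : Word S} (h : Arc6 P c) : Bd1 P c := fun _ hρ _ hu huc hp => h.lt hu huc hρ hp
lemma Arc6.bd1_inv {c : Word S} (h : Arc6 P c) : Bd1 P (wordInv c) :=
  fun _ hρ _ hu huc hp => h.lt_inv hu huc hρ hp

lemma SDehn.not_viol1 {z : Word S} (h : SDehn P z) : ¬ Viol1 P z := by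
  rintro ⟨ρ, hρ, u, hu, hp, hlt⟩
  have := h ρ hρ u hu hp
  omega

lemma Bd1.sdehn {z : Word S} (h : Bd1 P z) : SDehn P z := by
  intro ρ hρ u hu hp
  by_cases h0 : u = []
  · subst h0; simp
  · have := h ρ hρ u h0 hu hp; omega

lemma PairOK.not_viol2 {z₀ z₁ : Word S} (h : PairOK P z₀ z₁) : ¬ Viol2 P z₀ z₁ := by
  rintro ⟨ρ, hρ, u, v, -, -, hu, hv, hp, hlt⟩
  have := h ρ hρ u v hu hv hp
  omega

lemma pairOK_of_bd1_right {z₀ z₁ : Word S} (h0 : SDehn P z₀) (h1 : Bd1 P z₁) : PairOK P z₀ z₁ := by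
  rintro _ hρ u v hu hv ⟨t, rfl⟩
  have e1 := h0 _ hρ u hu.isInfix ⟨v ++ t, by simp⟩
  by_cases hv0 : v = []
  · subst hv0; simp only [List.length_append, List.length_nil] at e1 ⊢; omega
  rw [List.append_assoc] at hρ
  have e2 := h1 _ (rel_rot hρ) v hv0 hv.isInfix ⟨t ++ u, by simp⟩
  simp only [List.length_append] at e1 e2 ⊢; omega

lemma pairOK_of_bd1_left {z₀ z₁ : Word S} (h0 : Bd1 P z₀) (h1 : SDehn P z₁) : PairOK P z₀ z₁ := by
  rintro _ hρ u v hu hv ⟨t, rfl⟩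
  rw [List.append_assoc] at hρ
  have e2 := h1 _ (rel_rot hρ) v hv.isInfix ⟨t ++ u, by simp⟩
  by_cases hu0 : u = []
  · subst hu0; simp only [List.length_append, List.length_nil] at e2 ⊢; omega
  have e1 := h0 _ hρ u hu0 hu.isInfix ⟨v ++ t, by simp⟩
  simp only [List.length_append] at e1 e2 ⊢; omega

lemma PairOK.not_viol3_right {z₀ z₁ z₂ : Word S} (h : PairOK P z₀ z₁) (h2 : Bd1 P z₂) :
    ¬ Viol3 P z₀ z₁ z₂ := by
  rintro ⟨_, hρ, u, v, -, hv0, hu, hv, ⟨t, rfl⟩, hlt⟩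
  have e1 := h _ hρ u z₁ hu List.prefix_rfl ⟨v ++ t, by simp⟩
  have : v ++ (t ++ (u ++ z₁)) ∈ P.rels := by
    have := rel_rot (u := u ++ z₁) (v := v ++ t) (by simpa using hρ)
    simpa using this
  have e2 := h2 _ this v hv0 hv.isInfix (List.prefix_append _ _)
  simp only [List.length_append] at e1 e2 hlt; omega

lemma PairOK.not_viol3_left {z₀ z₁ z₂ : Word S} (h0 : Bd1 P z₀) (h : PairOK P z₁ z₂) :
    ¬ Viol3 P z₀ z₁ z₂ := by
  rintro ⟨_, hρ, u, v, hu0, -, hu, hv, ⟨t, rfl⟩, hlt⟩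
  have e1 := h0 _ hρ u hu0 hu.isInfix ⟨z₁ ++ v ++ t, by simp⟩
  have : z₁ ++ v ++ (t ++ u) ∈ P.rels := by
    have := rel_rot (u := u) (v := z₁ ++ (v ++ t)) (by simpa using hρ)
    simpa using this
  have e2 := h _ this z₁ v List.suffix_rfl hv (List.prefix_append _ _)
  simp only [List.length_append] at e1 e2 hlt; omega

lemma not_viol2_nil_right {z : Word S} : ¬ Viol2 P z [] := by
  rintro ⟨_, _, _, v, _, hv, _, hv', _⟩
  exact hv (List.prefix_nil.1 hv')

lemma not_viol2_nil_left {z : Word S} : ¬ Viol2 P [] z := by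
  rintro ⟨_, _, u, _, hu, _, hu', _⟩
  exact hu (List.suffix_nil.1 hu')

lemma not_viol3_nil_right {z z' : Word S} : ¬ Viol3 P z z' [] := by
  rintro ⟨_, _, _, v, _, hv, _, hv', _⟩
  exact hv (List.prefix_nil.1 hv')

lemma not_viol3_nil_left {z z' : Word S} : ¬ Viol3 P [] z z' := by
  rintro ⟨_, _, u, _, hu, _, hu', _⟩
  exact hu (List.suffix_nil.1 hu')

/-- A concatenation of two Dehn words whose junction is not too bad. -/
def Seg (P : C6Presentation S) (p : Word S) : Prop :=
  ∃ p₁ p₂, p = p₁ ++ p₂ ∧ SDehn P p₁ ∧ SDehn P p₂ ∧ PairOK P p₁ p₂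

lemma SDehn.seg {p : Word S} (h : SDehn P p) : Seg P p :=
  ⟨[], p, rfl, SDehn.nil, h, PairOK.nil_left h⟩

lemma Seg.inv {p : Word S} (h : Seg P p) : Seg P (wordInv p) := by
  obtain ⟨p₁, p₂, rfl, h1, h2, h3⟩ := h
  exact ⟨_, _, wordInv_append _ _, h2.inv, h1.inv, h3.inv⟩

lemma Seg.right {x p : Word S} (h : Seg P (x ++ p)) : Seg P p := by
  obtain ⟨p₁, p₂, he, h1, h2, h3⟩ := h
  rcases List.append_eq_append_iff.1 he with ⟨a, rfl, rfl⟩ | ⟨a, rfl, rfl⟩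
  · exact ⟨a, p₂, rfl, h1.infix (List.suffix_append _ _).isInfix, h2,
      h3.mono (List.suffix_append _ _) List.prefix_rfl⟩
  · exact (h2.infix (List.suffix_append _ _).isInfix).seg

lemma cyclicallyReduced_of {A B c d : Word S} (hA : A ≠ []) (hB : B ≠ [])
    (h1 : Reduced (A ++ (c ++ B))) (h2 : Reduced (B ++ (d ++ A))) :
    CyclicallyReduced (A ++ (c ++ (B ++ d))) := by
  have e1 : Reduced ((A ++ c) ++ B) := by simpa using h1
  have e2 := e1.append_overlap h2 hB
  have e3 : Reduced ((A ++ (c ++ (B ++ d))) ++ A) := by simpa using e2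
  have e4 : Reduced (A ++ (c ++ (B ++ d))) := e3.left
  exact e3.append_overlap e4 hA |> fun h => by
    unfold CyclicallyReduced; simpa using h

lemma no_triangle {p₁ p₂ c : Word S} (hr : Reduced (p₁ ++ (p₂ ++ c))) (h1 : SDehn P p₁)
    (h2 : SDehn P p₂) (h3 : PairOK P p₁ p₂) (hc : Arc6 P c)
    (he : P.elt (p₁ ++ (p₂ ++ c)) = 1) : p₁ ++ (p₂ ++ c) = [] := by
  by_contra hne
  rcases exists_viol_lin hne hr he with h | h | h | h | h | h
  · exact h1.not_viol1 h
  · exact h2.not_viol1 h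
  · exact hc.bd1.sdehn.not_viol1 h
  · exact h3.not_viol2 h
  · exact (pairOK_of_bd1_right h2 hc.bd1).not_viol2 h
  · exact h3.not_viol3_right hc.bd1 h

end Ladders
end GSC

namespace GSC

section Ladders

variable {S : Type} {P : C6Presentation S}

/-- A segment cannot have its endpoints joined by two short relator arcs. -/
lemma Seg.no_gap {p c c' : Word S} (hs : Seg P p) (hp : p ≠ []) (hc : Arc6 P c) (hc' : Arc6 P c')
    (r1 : Reduced (wordInv p ++ c)) (r3 : Reduced (p ++ c'))
    (he : P.elt p * P.elt c' = P.elt c) : False := by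
  induction c using List.reverseRecOn generalizing c' with
  | nil =>
    obtain ⟨p₁, p₂, rfl, h1, h2, h3⟩ := hs
    rw [List.append_assoc] at r3
    have := no_triangle r3 h1 h2 h3 hc' (by
      rw [← List.append_assoc, elt_append, he, elt_nil])
    rw [← List.append_assoc] at this
    exact hp (List.append_eq_nil_iff.1 this).1
  | append_singleton c a ih =>
    rcases List.eq_nil_or_concat' c' with rfl | ⟨d, b, rfl⟩
    · obtain ⟨p₁, p₂, rfl, h1, h2, h3⟩ := hs
      rw [wordInv_append, List.append_assoc] at r1
      have := no_triangle r1 h2.inv h1.inv h3.inv hc (by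
        rw [← List.append_assoc, ← wordInv_append, elt_append, ← he, elt_wordInv, elt_nil]; simp)
      simp at this
    by_cases hab : a = b
    · subst hab
      refine ih hc.prefix hc'.prefix ?_ ?_ ?_
      · rw [← List.append_assoc] at r1; exact r1.left
      · rw [← List.append_assoc] at r3; exact r3.left
      · rw [elt_append, elt_append, ← mul_assoc] at he
        exact mul_right_cancel he
    · have hcyc : CyclicallyReduced (wordInv p ++ ([] ++ ((c ++ [a]) ++ wordInv (d ++ [b])))) := by
        refine cyclicallyReduced_of (by simpa using hp) (by simp) (by simpa using r1) ?_
        have e1 : Reduced ((c ++ [a]) ++ wordInv (d ++ [b])) := by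
          refine reduced_append.2 ⟨r1.right, r3.right.wordInv, ?_⟩
          intro x hx y hy
          simp at hx hy
          subst hx hy
          rw [Ne, eq_li_comm, li_li]
          exact hab
        have e2 : Reduced (wordInv (d ++ [b]) ++ wordInv p) := by
          rw [← wordInv_append]; exact r3.wordInv
        have := e1.append_overlap e2 (by simp)
        simpa using this
      obtain ⟨p₁, p₂, rfl, h1, h2, h3⟩ := hs
      set c₁ := c ++ [a] with hc1
      set c₂ := d ++ [b] with hc2
      have hform : wordInv (p₁ ++ p₂) ++ ([] ++ (c₁ ++ wordInv c₂)) =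
          wordInv p₂ ++ (wordInv p₁ ++ (c₁ ++ ([] ++ wordInv c₂))) := by simp
      rw [hform] at hcyc
      by_cases hrel : wordInv p₂ ++ (wordInv p₁ ++ (c₁ ++ ([] ++ wordInv c₂))) ∈ P.rels
      · have l1 := h3.inv _ hrel (wordInv p₂) (wordInv p₁) List.suffix_rfl List.prefix_rfl
          ⟨c₁ ++ wordInv c₂, by simp⟩
        have hrel2 : (wordInv p₂ ++ wordInv p₁) ++ (c₁ ++ wordInv c₂) ∈ P.rels := by
          simpa using hrel
        have hrel3 := rel_rot hrel2
        rw [List.append_assoc] at hrel3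
        have l2 := hc.lt (by simp [hc1]) List.infix_rfl hrel3 (List.prefix_append _ _)
        have l3 := hc'.lt_inv (by simp [hc2]) List.infix_rfl (rel_rot hrel3) ⟨_, by simp; rfl⟩
        simp only [List.length_append, List.length_nil] at l1 l2 l3
        omega
      · have b1 := hc.bd1
        have b2 := hc'.bd1_inv
        rcases exists_viol_five (by simp [hc1]) hcyc (by
            rw [← hform]
            simp only [elt_append, elt_wordInv, elt_nil, ← he]; group) hrel with
          (h|h|h)|(h|h|h)|(h|h|h)|(h|h|h)|(h|h|h)
        · exact h2.inv.not_viol1 h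
        · exact h3.inv.not_viol2 h
        · exact h3.inv.not_viol3_right b1 h
        · exact h1.inv.not_viol1 h
        · exact (pairOK_of_bd1_right h1.inv b1).not_viol2 h
        · exact not_viol3_nil_right h
        · exact b1.sdehn.not_viol1 h
        · exact not_viol2_nil_right h
        · have : PairOK P [] (wordInv c₂) := PairOK.nil_left b2.sdehn
          exact this.not_viol3_left b1 h
        · exact SDehn.nil.not_viol1 h
        · exact not_viol2_nil_left h
        · exact not_viol3_nil_left h
        · exact b2.sdehn.not_viol1 h
        · exact (pairOK_of_bd1_left b2 h2.inv).not_viol2 h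
        · exact h3.inv.not_viol3_left b2 h

/-- The cells of a ladder: shared edges, and relators with most of their boundary on the two
sides. -/
def Cell (P : C6Presentation S) (x y c₁ c₂ : Word S) : Prop :=
  (∃ a, x = [a] ∧ y = [a] ∧ c₁ = [] ∧ c₂ = []) ∨
  (x ++ (c₂ ++ (wordInv y ++ wordInv c₁)) ∈ P.rels ∧
    4 * (x.length + c₂.length + y.length + c₁.length) < 6 * (x.length + y.length))

lemma Cell.elt_eq {x y c₁ c₂ : Word S} (h : Cell P x y c₁ c₂) :
    P.elt x * P.elt c₂ = P.elt c₁ * P.elt y := by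
  rcases h with ⟨a, rfl, rfl, rfl, rfl⟩ | ⟨h, -⟩
  · simp [elt_nil]
  · have := elt_rel P h
    simp only [elt_append, elt_wordInv, ← mul_assoc] at this
    rw [mul_inv_eq_one, mul_inv_eq_iff_eq_mul] at this
    exact this

lemma Cell.inv {x y c₁ c₂ : Word S} (h : Cell P x y c₁ c₂) :
    Cell P (wordInv x) (wordInv y) c₂ c₁ := by
  rcases h with ⟨a, rfl, rfl, rfl, rfl⟩ | ⟨h, hlt⟩
  · exact Or.inl ⟨li a, by simp, by simp, rfl, rfl⟩
  · refine Or.inr ⟨?_, by simp only [length_wordInv]; omega⟩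
    have := rel_inv_rot h
    simpa using this

/-- The edge `k` of `p` belongs to a cell of a ladder between `p` and `Q`, where `c` joins the
start of `p` to the start of `Q`. -/
def Cov (P : C6Presentation S) (p Q c : Word S) (k : ℕ) : Prop :=
  ∃ A x B A' y B' c₁ c₂, p = A ++ (x ++ B) ∧ Q = A' ++ (y ++ B') ∧ A.length ≤ k ∧
    k < A.length + x.length ∧ P.elt A * P.elt c₁ = P.elt c * P.elt A' ∧ Cell P x y c₁ c₂

lemma Cov.rev {p Q c c' : Word S} {k : ℕ} (h : Cov P (wordInv p) (wordInv Q) c' (p.length - 1 - k))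
    (hk : k < p.length) (he : P.elt p * P.elt c' = P.elt c * P.elt Q) : Cov P p Q c k := by
  obtain ⟨A, x, B, A', y, B', c₁, c₂, hp, hQ, h1, h2, h3, h4⟩ := h
  have hl := congrArg List.length hp
  simp only [length_wordInv, List.length_append] at hl
  have hp' : p = wordInv B ++ (wordInv x ++ wordInv A) := by
    rw [← wordInv_wordInv p, hp]; simp
  have hQ' : Q = wordInv B' ++ (wordInv y ++ wordInv A') := by
    rw [← wordInv_wordInv Q, hQ]; simp
  refine ⟨wordInv B, wordInv x, wordInv A, wordInv B', wordInv y, wordInv A', c₂, c₁, hp', hQ',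
    by rw [length_wordInv]; omega, by rw [length_wordInv, length_wordInv]; omega, ?_, h4.inv⟩
  have h5 := h4.elt_eq
  rw [hp', hQ'] at he
  simp only [elt_append, elt_wordInv] at he ⊢
  have e1 : P.elt c₂ = (P.elt x)⁻¹ * (P.elt c₁ * P.elt y) := by rw [← h5]; group
  have e2 : P.elt c₁ = (P.elt A)⁻¹ * (P.elt c' * P.elt A') := by rw [← h3]; group
  have e3 : P.elt c' = P.elt A * P.elt x * P.elt B * (P.elt c *
      ((P.elt B')⁻¹ * ((P.elt y)⁻¹ * (P.elt A')⁻¹))) := by rw [← he]; group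
  rw [e1, e2, e3]; group

lemma Cov.prepend {p Q c cn x₀ y₀ : Word S} {k : ℕ} (h : Cov P p Q cn k)
    (he : P.elt x₀ * P.elt cn = P.elt c * P.elt y₀) :
    Cov P (x₀ ++ p) (y₀ ++ Q) c (x₀.length + k) := by
  obtain ⟨A, x, B, A', y, B', c₁, c₂, rfl, rfl, h1, h2, h3, h4⟩ := h
  refine ⟨x₀ ++ A, x, B, y₀ ++ A', y, B', c₁, c₂, by simp, by simp,
    by simp only [List.length_append]; omega, by simp only [List.length_append]; omega, ?_, h4⟩
  rw [elt_append, elt_append, mul_assoc, h3, ← mul_assoc, he, mul_assoc]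

/-- Two words joined at both ends by short relator arcs. -/
structure Lad (P : C6Presentation S) (p Q c c' : Word S) : Prop where
  red_p : Reduced p
  seg : Seg P p
  red_Q : Reduced Q
  dehn : SDehn P Q
  arc : Arc6 P c
  arc' : Arc6 P c'
  elt_eq : P.elt p * P.elt c' = P.elt c * P.elt Q
  r1 : Reduced (wordInv p ++ c)
  r2 : Reduced (c ++ Q)
  r3 : Reduced (p ++ c')
  r4 : Reduced (c' ++ wordInv Q)

lemma Lad.rev {p Q c c' : Word S} (h : Lad P p Q c c') :
    Lad P (wordInv p) (wordInv Q) c' c where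
  red_p := h.red_p.wordInv
  seg := h.seg.inv
  red_Q := h.red_Q.wordInv
  dehn := h.dehn.inv
  arc := h.arc'
  arc' := h.arc
  elt_eq := by
    have := h.elt_eq
    rw [elt_wordInv, elt_wordInv, inv_mul_eq_iff_eq_mul, ← mul_assoc, eq_mul_inv_iff_mul_eq, this]
  r1 := by rw [wordInv_wordInv]; exact h.r3
  r2 := h.r4
  r3 := h.r1
  r4 := by rw [wordInv_wordInv]; exact h.r2

/-- A first cell of a ladder. -/
def Step (P : C6Presentation S) (p Q c : Word S) : Prop :=
  ∃ x X y Y cn, p = x ++ X ∧ Q = y ++ Y ∧ x ≠ [] ∧ Cell P x y c cn ∧ Arc6 P cn ∧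
    Reduced (wordInv X ++ cn) ∧ Reduced (cn ++ Y)

lemma Lad.advance {x X y Y c c' cn : Word S} (h : Lad P (x ++ X) (y ++ Y) c c')
    (hcell : Cell P x y c cn) (ha : Arc6 P cn) (h1 : Reduced (wordInv X ++ cn))
    (h2 : Reduced (cn ++ Y)) : Lad P X Y cn c' where
  red_p := h.red_p.right
  seg := h.seg.right
  red_Q := h.red_Q.right
  dehn := h.dehn.infix (List.suffix_append _ _).isInfix
  arc := ha
  arc' := h.arc'
  elt_eq := by
    have e := h.elt_eq
    rw [elt_append, elt_append, ← mul_assoc, ← hcell.elt_eq, mul_assoc, mul_assoc] at e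
    exact mul_left_cancel e
  r1 := h1
  r2 := h2
  r3 := by have := h.r3; rw [List.append_assoc] at this; exact this.right
  r4 := by
    have := h.r4
    rw [wordInv_append, ← List.append_assoc] at this
    exact this.left

lemma exists_cons_of_not_reduced {X Y : Word S} (hX : Reduced X) (hY : Reduced Y)
    (h : ¬ Reduced (wordInv X ++ Y)) : ∃ a X' Y', X = a :: X' ∧ Y = a :: Y' := by
  cases X with
  | nil => exact absurd (by simpa using hY) h
  | cons a X =>
    cases Y with
    | nil => exact absurd (by simpa using hX.wordInv) h
    | cons b Y =>
      refine ⟨a, X, Y, rfl, ?_⟩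
      by_contra hab
      refine h (reduced_append.2 ⟨hX.wordInv, hY, ?_⟩)
      intro c hc d hd
      rw [getLast?_wordInv] at hc
      simp at hc hd
      subst hc hd
      rw [li_li]
      rintro rfl
      exact hab rfl

/-- Push a relator along both sides as far as possible. -/
lemma exists_max_cell {c : Word S} (n : ℕ) : ∀ (cn x X y Y : Word S), cn.length ≤ n →
    Reduced X → Reduced Y → wordInv x ++ (c ++ (y ++ wordInv cn)) ∈ P.rels →
    ∃ x₂ X₂ y₂ Y₂ cn₂, x ++ X = x₂ ++ X₂ ∧ y ++ Y = y₂ ++ Y₂ ∧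
      wordInv x₂ ++ (c ++ (y₂ ++ wordInv cn₂)) ∈ P.rels ∧ x.length ≤ x₂.length ∧
      x₂.length + y₂.length + cn₂.length = x.length + y.length + cn.length ∧
      cn₂.length ≤ cn.length ∧ Reduced (wordInv X₂ ++ cn₂) ∧ Reduced (cn₂ ++ Y₂) := by
  induction n with
  | zero =>
    intro cn x X y Y hn hX hY h
    have : cn = [] := List.length_eq_zero_iff.1 (by omega)
    subst this
    exact ⟨x, X, y, Y, [], rfl, rfl, h, le_rfl, rfl, le_rfl, by simpa using hX.wordInv,
      by simpa using hY⟩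
  | succ n ih =>
    intro cn x X y Y hn hX hY h
    have hcn : Reduced (wordInv cn) := (rel_reduced h).right.right.right
    by_cases h1 : Reduced (wordInv X ++ cn)
    · by_cases h2 : Reduced (cn ++ Y)
      · exact ⟨x, X, y, Y, cn, rfl, rfl, h, le_rfl, rfl, le_rfl, h1, h2⟩
      · obtain ⟨a, d, Y', hd, rfl⟩ := exists_cons_of_not_reduced hcn hY
          (by rwa [wordInv_wordInv])
        have hl := congrArg List.length hd
        rw [length_wordInv, List.length_cons] at hl
        obtain ⟨x₂, X₂, y₂, Y₂, cn₂, e1, e2, e3, e4, e5, e6, e7⟩ :=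
          ih (wordInv d) x X (y ++ [a]) Y' (by rw [length_wordInv]; omega) hX
            (by exact Reduced.right (u := [a]) hY) (by rw [hd] at h; simpa using h)
        rw [length_wordInv, List.length_append, List.length_singleton] at e5
        rw [length_wordInv] at e6
        exact ⟨x₂, X₂, y₂, Y₂, cn₂, e1, by rw [← e2]; simp, e3, e4, by omega, by omega, e7⟩
    · obtain ⟨a, X', d, rfl, rfl⟩ := exists_cons_of_not_reduced hX (reduced_wordInv.1 hcn) h1
      rw [List.length_cons] at hn
      obtain ⟨x₂, X₂, y₂, Y₂, cn₂, e1, e2, e3, e4, e5, e6, e7⟩ :=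
        ih d (x ++ [a]) X' y Y (by omega) (by exact Reduced.right (u := [a]) hX) hY (by
          rw [wordInv_cons] at h
          have h' : (wordInv x ++ (c ++ (y ++ wordInv d))) ++ [li a] ∈ P.rels := by simpa using h
          simpa using rel_rot h')
      rw [List.length_append, List.length_singleton] at e4 e5
      rw [List.length_cons]
      exact ⟨x₂, X₂, y₂, Y₂, cn₂, by rw [← e1]; simp, e2, e3, by omega, by omega, by omega, e7⟩

lemma Lad.edge_step {p Q c c' : Word S} (h : Lad P p Q c c') (hr : ¬ Reduced (wordInv p ++ (c ++ Q))) :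
    Step P p Q c := by
  have hc : c = [] := by
    by_contra hc
    have := h.r1.append_overlap h.r2 hc
    exact hr (by simpa using this)
  subst hc
  obtain ⟨a, X, Y, rfl, rfl⟩ := exists_cons_of_not_reduced h.red_p h.red_Q hr
  exact ⟨[a], X, [a], Y, [], rfl, rfl, by simp, Or.inl ⟨a, rfl, rfl, rfl, rfl⟩, Or.inl rfl,
    by simpa using (Reduced.right (u := [a]) h.red_p).wordInv,
    by simpa using Reduced.right (u := [a]) h.red_Q⟩

lemma Lad.face_step {p Q c c' : Word S} (h : Lad P p Q c c') (hv : Viol3 P (wordInv p) c Q) :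
    Step P p Q c := by
  obtain ⟨_, hρ, u, v, hu0, hv0, ⟨X, hX⟩, ⟨Y, rfl⟩, ⟨r, rfl⟩, hlt⟩ := hv
  have hp : p = wordInv u ++ wordInv X := by rw [← wordInv_append, hX, wordInv_wordInv]
  subst hp
  obtain ⟨x₂, X₂, y₂, Y₂, cn₂, e1, e2, e3, e4, e5, e6, e7, e8⟩ :=
    exists_max_cell (P := P) (c := c) _ (wordInv r) (wordInv u) (wordInv X) v Y le_rfl
      h.red_p.right h.red_Q.right (by simpa using hρ)
  simp only [length_wordInv, List.length_append] at e4 e5 e6 hlt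
  have hx0 : x₂ ≠ [] := by
    rintro rfl
    exact hu0 (List.length_eq_zero_iff.1 (by simpa using e4))
  have hinv := rel_inv_rot e3
  rw [wordInv_wordInv] at hinv
  simp only [wordInv_append, wordInv_wordInv, List.append_assoc] at hinv
  have hxpos := List.length_pos_of_ne_nil hx0
  have hc6 : 6 * c.length < x₂.length + y₂.length + cn₂.length + c.length := by
    by_cases hc : c = []
    · subst hc; simp only [List.length_nil]; omega
    have := h.arc.lt hc List.infix_rfl (by simpa using rel_rot e3) (List.prefix_append _ _)
    simp only [List.length_append, length_wordInv] at this; omega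
  refine ⟨x₂, X₂, y₂, Y₂, cn₂, e1, e2, hx0, Or.inr ⟨by simpa using hinv, ?_⟩, Or.inr ?_, e7, e8⟩
  · omega
  · refine ⟨_, by simpa using rel_rot hinv, ?_⟩
    simp only [List.length_append, length_wordInv]; omega

lemma viol3_inv {a b c : Word S} (h : Viol3 P a b c) :
    Viol3 P (wordInv c) (wordInv b) (wordInv a) := by
  obtain ⟨_, hρ, u, v, hu0, hv0, hu, hv, ⟨r, rfl⟩, hlt⟩ := h
  have h1 := rel_inv_rot hρ
  simp only [wordInv_append] at h1
  refine ⟨_, h1, wordInv v, wordInv u, by simpa using hv0, by simpa using hu0,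
    IsPrefix.wordInv hv, IsSuffix.wordInv hu, ⟨wordInv r, by simp⟩, ?_⟩
  simp only [List.length_append, length_wordInv] at hlt ⊢
  omega

lemma Lad.step {p Q c c' : Word S} (h : Lad P p Q c c') (hp : p ≠ []) :
    Step P p Q c ∨ Step P (wordInv p) (wordInv Q) c' ∨ Cell P p Q c c' := by
  by_cases hQ : Q = []
  · subst hQ
    exact (h.seg.no_gap hp h.arc h.arc' h.r1 h.r3 (by rw [h.elt_eq, elt_nil, mul_one])).elim
  by_cases q1 : Reduced (wordInv p ++ (c ++ Q))
  swap
  · exact Or.inl (h.edge_step q1)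
  by_cases q2 : Reduced (p ++ (c' ++ wordInv Q))
  swap
  · exact Or.inr (Or.inl (h.rev.edge_step (by rwa [wordInv_wordInv])))
  have hcyc := cyclicallyReduced_of (d := wordInv c') (by simpa using hp) hQ q1
    (by simpa using q2.wordInv)
  have hform : wordInv p ++ (c ++ (Q ++ wordInv c')) ∈ P.rels → Cell P p Q c c' := by
    intro hrel
    have h1 := rel_inv_rot hrel
    simp only [wordInv_append, wordInv_wordInv, List.append_assoc] at h1
    have hpos : 0 < p.length := List.length_pos_of_ne_nil hp
    refine Or.inr ⟨h1, ?_⟩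
    have l1 : 6 * c.length < p.length + c'.length + Q.length + c.length := by
      by_cases hc : c = []
      · subst hc; simp only [List.length_nil]; omega
      have := h.arc.lt hc List.infix_rfl (by simpa using rel_rot hrel) (List.prefix_append _ _)
      simp only [List.length_append, length_wordInv] at this; omega
    have l2 : 6 * c'.length < p.length + c'.length + Q.length + c.length := by
      by_cases hc : c' = []
      · subst hc; simp only [List.length_nil]; omega
      have := h.arc'.lt hc List.infix_rfl (by simpa using rel_rot h1) (List.prefix_append _ _)
      simp only [List.length_append, length_wordInv] at this; omega
    omega
  by_cases hrel : wordInv p ++ (c ++ (Q ++ wordInv c')) ∈ P.rels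
  · exact Or.inr (Or.inr (hform hrel))
  have b1 := h.arc.bd1
  have b2 := h.arc'.bd1_inv
  have hw : P.elt (wordInv p ++ (c ++ (Q ++ wordInv c'))) = 1 := by
    have := h.elt_eq
    simp only [elt_append, elt_wordInv]
    rw [← mul_assoc (P.elt c), ← this]; group
  have hface := h.face_step
  have hface' := h.rev.face_step
  obtain ⟨p₁, p₂, rfl, h1, h2, h3⟩ := h.seg
  have hassoc : wordInv (p₁ ++ p₂) ++ (c ++ (Q ++ wordInv c')) =
      wordInv p₂ ++ (wordInv p₁ ++ (c ++ (Q ++ wordInv c'))) := by simp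
  rw [hassoc] at hcyc hrel hw
  rcases exists_viol_five (by simp [hQ]) hcyc hw hrel with
    (g|g|g)|(g|g|g)|(g|g|g)|(g|g|g)|(g|g|g)
  · exact (h2.inv.not_viol1 g).elim
  · exact (h3.inv.not_viol2 g).elim
  · exact (h3.inv.not_viol3_right b1 g).elim
  · exact (h1.inv.not_viol1 g).elim
  · exact ((pairOK_of_bd1_right h1.inv b1).not_viol2 g).elim
  · refine Or.inl (hface ?_)
    obtain ⟨ρ, hρ, u, v, hu0, hv0, hu, hv, hpre, hlt⟩ := g
    exact ⟨ρ, hρ, u, v, hu0, hv0, hu.trans (by rw [wordInv_append]; exact List.suffix_append _ _),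
      hv, hpre, hlt⟩
  · exact (b1.sdehn.not_viol1 g).elim
  · exact ((pairOK_of_bd1_left b1 h.dehn).not_viol2 g).elim
  · exact ((pairOK_of_bd1_left b1 h.dehn).not_viol3_right b2 g).elim
  · exact (h.dehn.not_viol1 g).elim
  · exact ((pairOK_of_bd1_right h.dehn b2).not_viol2 g).elim
  · refine Or.inr (Or.inl (hface' ?_))
    have g' := viol3_inv g
    rw [wordInv_wordInv, wordInv_wordInv] at g'
    obtain ⟨ρ, hρ, u, v, hu0, hv0, hu, hv, hpre, hlt⟩ := g'
    exact ⟨ρ, hρ, u, v, hu0, hv0, hu.trans (by rw [wordInv_wordInv]; exact List.suffix_append _ _),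
      hv, hpre, hlt⟩
  · exact (b2.sdehn.not_viol1 g).elim
  · exact ((pairOK_of_bd1_left b2 h2.inv).not_viol2 g).elim
  · exact (h3.inv.not_viol3_left b2 g).elim

/-- Every edge of the top side of a ladder lies in a cell that also has a large part on the
bottom side. -/
theorem Lad.cov {p Q c c' : Word S} (h : Lad P p Q c c') {k : ℕ} (hk : k < p.length) :
    Cov P p Q c k := by
  obtain ⟨n, hn⟩ : ∃ n, p.length ≤ n := ⟨_, le_rfl⟩
  induction n generalizing p Q c c' k with
  | zero => omega
  | succ n ih =>
    have key : ∀ {p Q c c' : Word S} {k : ℕ}, Lad P p Q c c' → k < p.length → p.length ≤ n + 1 →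
        Step P p Q c → Cov P p Q c k := by
      intro p Q c c' k h hk hn hs
      obtain ⟨x, X, y, Y, cn, rfl, rfl, hx, hcell, ha, e1, e2⟩ := hs
      have hxl := List.length_pos_of_ne_nil hx
      rw [List.length_append] at hk hn
      by_cases hkx : k < x.length
      · exact ⟨[], x, X, [], y, Y, c, cn, rfl, rfl, by simp, by simpa using hkx,
          by simp [elt_nil], hcell⟩
      · have := (ih (h.advance hcell ha e1 e2) (k := k - x.length) (by omega) (by omega)).prepend
          hcell.elt_eq
        rwa [Nat.add_sub_cancel' (by omega)] at this
    rcases h.step (by rintro rfl; simp at hk) with hs | hs | hs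
    · exact key h hk hn hs
    · exact (key h.rev (by rw [length_wordInv]; omega) (by rwa [length_wordInv]) hs).rev hk h.elt_eq
    · exact ⟨[], p, [], [], Q, [], c, c', by simp, by simp, by simp, by simpa using hk,
        by simp [elt_nil], hs⟩

end Ladders
end GSC

namespace GSC

section Lengths

variable {S : Type} {P : C6Presentation S}

/-- A word of minimal length among those representing the same element. -/
def Geod (P : C6Presentation S) (w : Word S) : Prop :=
  ∀ w', P.elt w' = P.elt w → w.length ≤ w'.length

/-- Word length in the presented group. -/
noncomputable abbrev len (P : C6Presentation S) (g : P.Grp) : ℕ := wordLength P.gens g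

lemma exists_word_of_list (l : List P.Grp) (hl : ∀ x ∈ l, x ∈ P.gens ∨ x⁻¹ ∈ P.gens) :
    ∃ w : Word S, w.length = l.length ∧ P.elt w = l.prod := by
  induction l with
  | nil => exact ⟨[], rfl, by simp [elt_nil]⟩
  | cons x l ih =>
    obtain ⟨w, h1, h2⟩ := ih fun y hy => hl y (List.mem_cons_of_mem _ hy)
    have : ∃ a, P.elt [a] = x := by
      rcases hl x List.mem_cons_self with ⟨a, ha⟩ | ⟨a, ha⟩
      · exact ⟨(a, true), by simpa [C6Presentation.elt] using ha⟩
      · exact ⟨(a, false), by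
          simp only at ha
          simp [C6Presentation.elt, ha]⟩
    obtain ⟨a, rfl⟩ := this
    exact ⟨a :: w, by simp [h1], by rw [elt_cons, h2, List.prod_cons]⟩

lemma mem_lengths_iff (g : P.Grp) (n : ℕ) :
    n ∈ {n : ℕ | ∃ l : List P.Grp, l.length = n ∧ (∀ x ∈ l, x ∈ P.gens ∨ x⁻¹ ∈ P.gens) ∧
      l.prod = g} ↔ ∃ w : Word S, w.length = n ∧ P.elt w = g := by
  constructor
  · rintro ⟨l, rfl, hl, rfl⟩
    exact exists_word_of_list l hl
  · rintro ⟨w, rfl, rfl⟩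
    refine ⟨w.map fun l => (PresentedGroup.of l.1 : P.Grp) ^ (if l.2 then (1 : ℤ) else -1),
      by simp, ?_, rfl⟩
    intro x hx
    obtain ⟨⟨a, b⟩, -, rfl⟩ := List.mem_map.1 hx
    cases b
    · right; exact ⟨a, by simp⟩
    · left; exact ⟨a, by simp⟩

lemma len_elt_le (w : Word S) : len P (P.elt w) ≤ w.length :=
  Nat.sInf_le ((mem_lengths_iff _ _).2 ⟨w, rfl, rfl⟩)

lemma exists_word_len (g : P.Grp) : ∃ w : Word S, w.length = len P g ∧ P.elt w = g := by
  rw [← mem_lengths_iff]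
  refine Nat.sInf_mem ?_
  obtain ⟨w, -, hw⟩ := exists_elt P g
  exact ⟨w.length, (mem_lengths_iff _ _).2 ⟨w, rfl, hw⟩⟩

lemma Geod.len_eq {w : Word S} (h : Geod P w) : len P (P.elt w) = w.length := by
  obtain ⟨w', h1, h2⟩ := exists_word_len (P.elt w)
  exact le_antisymm (len_elt_le w) (h1 ▸ h w' h2)

lemma geod_of_len {w : Word S} (h : w.length ≤ len P (P.elt w)) : Geod P w := by
  intro w' hw'
  rw [← hw'] at h
  exact h.trans (len_elt_le w')

lemma exists_geod (g : P.Grp) : ∃ w : Word S, Geod P w ∧ P.elt w = g := by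
  obtain ⟨w, h1, rfl⟩ := exists_word_len g
  exact ⟨w, geod_of_len h1.le, rfl⟩

lemma len_mul_le (g h : P.Grp) : len P (g * h) ≤ len P g + len P h := by
  obtain ⟨u, hu, rfl⟩ := exists_word_len g
  obtain ⟨v, hv, rfl⟩ := exists_word_len h
  rw [← hu, ← hv, ← elt_append, ← List.length_append]
  exact len_elt_le _

lemma len_inv (g : P.Grp) : len P g⁻¹ = len P g := by
  have : ∀ g : P.Grp, len P g⁻¹ ≤ len P g := by
    intro g
    obtain ⟨u, hu, rfl⟩ := exists_word_len g
    rw [← hu, ← elt_wordInv, ← length_wordInv u]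
    exact len_elt_le _
  exact le_antisymm (this g) (by simpa using this g⁻¹)

lemma len_one : len P (1 : P.Grp) = 0 := by
  have := len_elt_le (P := P) []
  simpa [elt_nil] using this

lemma len_mul_ge (g h : P.Grp) : len P g ≤ len P (g * h) + len P h := by
  have := len_mul_le (g * h) h⁻¹
  rwa [mul_inv_cancel_right, len_inv] at this

lemma Geod.infix {u w : Word S} (h : Geod P w) (hu : u <:+: w) : Geod P u := by
  obtain ⟨a, b, rfl⟩ := hu
  intro u' hu'
  have := h (a ++ u' ++ b) (by simp only [elt_append, hu'])
  simp only [List.length_append] at this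
  omega

lemma Geod.left {u w : Word S} (h : Geod P (u ++ w)) : Geod P u :=
  h.infix (List.prefix_append _ _).isInfix

lemma Geod.right {u w : Word S} (h : Geod P (u ++ w)) : Geod P w :=
  h.infix (List.suffix_append _ _).isInfix

lemma Geod.inv {w : Word S} (h : Geod P w) : Geod P (wordInv w) := by
  intro u hu
  have := h (wordInv u) (by rw [elt_wordInv, hu, elt_wordInv, inv_inv])
  simpa [length_wordInv] using this

lemma Geod.reduced {w : Word S} (h : Geod P w) : Reduced w := by
  obtain ⟨u, h1, h2⟩ := exists_reduced_red w
  rwa [← h1.sublist.eq_of_length_le (h u (elt_red P h1).symm)]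

lemma Geod.sdehn {w : Word S} (h : Geod P w) : SDehn P w := by
  rintro _ hρ u hu ⟨t, rfl⟩
  have := (h.infix hu) (wordInv t) (by
    have := elt_rel P hρ
    rw [elt_append] at this
    rw [elt_wordInv, eq_comm]
    exact mul_eq_one_iff_eq_inv.1 this)
  rw [length_wordInv] at this
  rw [List.length_append]; omega

/-- Common parts of `q` with relators have length at most `K`. -/
def Ovl (P : C6Presentation S) (K : ℕ) (q : Word S) : Prop :=
  ∀ ρ ∈ P.rels, ∀ u, u <:+: q → u <+: ρ → u.length ≤ K

lemma Ovl.infix {K : ℕ} {u q : Word S} (h : Ovl P K q) (hu : u <:+: q) : Ovl P K u :=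
  fun ρ hρ v hv => h ρ hρ v (hv.trans hu)

lemma Ovl.inv {K : ℕ} {q : Word S} (h : Ovl P K q) : Ovl P K (wordInv q) := by
  rintro _ hρ u hu ⟨t, rfl⟩
  have h1 := IsInfix.wordInv hu
  rw [wordInv_wordInv] at h1
  have := h _ (rel_inv_rot hρ) _ h1 (List.prefix_append _ _)
  rwa [length_wordInv] at this

lemma infix_glue {u A b B : Word S} (h : u <:+: A ++ (b ++ B)) :
    u <:+: A ++ b ∨ u <:+: b ++ B ∨ b <:+: u := by
  obtain ⟨s, t, h⟩ := h
  rw [List.append_assoc] at h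
  rcases List.append_eq_append_iff.1 h with ⟨a, rfl, h'⟩ | ⟨a, rfl, h'⟩
  · rw [← List.append_assoc] at h'
    rcases List.append_eq_append_iff.1 h' with ⟨d, h', -⟩ | ⟨d, h', -⟩
    · exact Or.inl ⟨s, d, by simp [h']⟩
    · exact Or.inr (Or.inr ⟨a, d, h'.symm⟩)
  · exact Or.inr (Or.inl ⟨a, t, by simp [h']⟩)

lemma rel_infix_rot {u ρ : Word S} (hρ : ρ ∈ P.rels) (hu : u <:+: ρ) :
    ∃ σ ∈ P.rels, u <+: σ ∧ σ.length = ρ.length := by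
  obtain ⟨a, b, rfl⟩ := hu
  refine ⟨u ++ (b ++ a), ?_, List.prefix_append _ _, ?_⟩
  · have := rel_rot (u := a) (v := u ++ b) (by simpa using hρ)
    simpa using this
  · simp only [List.length_append]; omega

lemma Ovl.le_of_infix {K : ℕ} {q u ρ : Word S} (h : Ovl P K q) (hρ : ρ ∈ P.rels) (hu : u <:+: q)
    (huρ : u <:+: ρ) : u.length ≤ K := by
  obtain ⟨σ, hσ, h1, -⟩ := rel_infix_rot hρ huρ
  exact h σ hσ u hu h1

lemma SDehn.glue {K : ℕ} {A b B : Word S} (h1 : SDehn P (A ++ b)) (h2 : SDehn P (b ++ B))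
    (hb : Ovl P K b) (hK : K < b.length) : SDehn P (A ++ (b ++ B)) := by
  intro ρ hρ u hu hp
  rcases infix_glue hu with h | h | h
  · exact h1 ρ hρ u h hp
  · exact h2 ρ hρ u h hp
  · have := hb.le_of_infix hρ List.infix_rfl (h.trans hp.isInfix)
    omega

/-- If a geodesic word `A` can be continued without cancellation along either of two words
starting differently, then one of the two continuations has no bad junction. -/
lemma pairOK_or_pairOK {A b d : Word S} (hA : SDehn P A) (hb : SDehn P b) (hd : SDehn P d)
    (hbd : ∀ a ∈ b.head?, a ∉ d.head?) : PairOK P A b ∨ PairOK P A d := by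
  by_contra! hcon
  obtain ⟨h1, h2⟩ := hcon
  unfold PairOK at h1 h2
  push Not at h1 h2
  have key : ∀ {b d u v u' v' t t' : Word S}, SDehn P b →
      (∀ a ∈ b.head?, a ∉ d.head?) → u <:+ A → v <+: b → u ++ v ++ t ∈ P.rels →
      2 * (u ++ v ++ t).length < 3 * (u.length + v.length) → u' <:+ A → v' <+: d →
      u' ++ v' ++ t' ∈ P.rels → v' ≠ [] → v ≠ [] → u.length ≤ u'.length → False := by
    intro b d u v u' v' t t' hb hbd hu hv hρ hlt hu' hv' hρ' hv0' hv0 hle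
    obtain ⟨s, rfl⟩ := List.suffix_of_suffix_length_le hu hu' hle
    rw [List.append_assoc] at hρ
    have e1 := hb _ (rel_rot hρ) v hv.isInfix ⟨t ++ u, by simp⟩
    have h3 : u ++ (v' ++ (t' ++ s)) ∈ P.rels := by
      have := rel_rot (u := s) (v := u ++ (v' ++ t')) (by simpa using hρ')
      simpa using this
    have e2 := piece_lt_append hρ h3 (by
      intro he
      cases v with
      | nil => exact hv0 rfl
      | cons x v =>
        cases v' with
        | nil => exact hv0' rfl
        | cons y v' =>
          obtain ⟨_, rfl⟩ := hv
          obtain ⟨_, rfl⟩ := hv'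
          simp only [List.cons_append, List.cons.injEq] at he
          exact hbd x rfl (by simp [he.1]))
    simp only [List.length_append] at e1 e2 hlt
    omega
  obtain ⟨_, hρ, u, v, hu, hv, ⟨t, rfl⟩, hlt⟩ := h1
  obtain ⟨_, hρ', u', v', hu', hv', ⟨t', rfl⟩, hlt'⟩ := h2
  have ne : ∀ {u v t : Word S}, u <:+ A → u ++ v ++ t ∈ P.rels →
      2 * (u ++ v ++ t).length < 3 * (u.length + v.length) → v ≠ [] := by
    rintro u v t hu hρ hlt rfl
    have := hA _ hρ u hu.isInfix ⟨[] ++ t, by simp⟩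
    simp only [List.length_append, List.length_nil] at this hlt
    omega
  rcases le_total u.length u'.length with hle | hle
  · exact key hb hbd hu hv hρ hlt hu' hv' hρ' (ne hu' hρ' hlt') (ne hu hρ hlt) hle
  · exact key hd (fun a h1 h2 => hbd a h2 h1) hu' hv' hρ' hlt' hu hv hρ (ne hu hρ hlt)
      (ne hu' hρ' hlt') hle

end Lengths
end GSC

namespace GSC

section Contraction

variable {S : Type} {P : C6Presentation S}

/-- A bottom side of a cell has at most half of its boundary. -/
lemma two_mul_le_of_dehn {x y c₁ c₂ Q : Word S} (hQ : SDehn P Q) (hy : y <:+: Q)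
    (h : x ++ (c₂ ++ (wordInv y ++ wordInv c₁)) ∈ P.rels) :
    2 * y.length ≤ x.length + c₂.length + y.length + c₁.length := by
  obtain ⟨σ, hσ, h1, h2⟩ := rel_infix_rot (u := wordInv y) h ⟨x ++ c₂, wordInv c₁, by simp⟩
  have := hQ.inv σ hσ _ (IsInfix.wordInv hy) h1
  rw [h2] at this
  simp only [length_wordInv, List.length_append] at this
  omega

/-- The top side of a ladder comes close to the bottom side near the start of a segment `Z` with
small overlaps. -/
lemma Lad.exists_close {A Z B Q : Word S} {K : ℕ} (h : Lad P (A ++ (Z ++ B)) Q [] [])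
    (hZ : Ovl P K Z) (hK : K < Z.length) (hB : B = [] ∨ 2 * K < Z.length) :
    ∃ Z₁ Z₂ A' B' e, Z = Z₁ ++ Z₂ ∧ Z₁.length ≤ K ∧ Q = A' ++ B' ∧
      P.elt (A ++ Z₁) * P.elt e = P.elt A' ∧ e.length ≤ 6 * K := by
  obtain ⟨A₀, x, B₀, A', y, B', c₁, c₂, hp, hQ, h1, h2, h3, h4⟩ :=
    h.cov (k := A.length + K) (by simp only [List.length_append]; omega)
  rw [elt_nil, one_mul] at h3
  have hA : ∃ Z₁, A₀ = A ++ Z₁ := by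
    rcases List.append_eq_append_iff.1 hp with ⟨a, rfl, -⟩ | ⟨a, rfl, h5⟩
    · exact ⟨a, rfl⟩
    rw [List.length_append] at h2
    rcases h4 with ⟨b, rfl, rfl, rfl, rfl⟩ | ⟨hρ, -⟩
    · rw [List.length_singleton] at h2
      have : a = [] := List.length_eq_zero_iff.1 (by omega)
      exact ⟨[], by simp [this]⟩
    · have h6 : a ++ Z.take (K + 1) <+: x := by
        refine List.prefix_of_prefix_length_le (l₃ := x ++ B₀) ?_ (List.prefix_append _ _) ?_
        · rw [h5]
          exact (List.prefix_append_right_inj a).2 ((List.take_prefix _ _).trans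
            (List.prefix_append _ _))
        · rw [List.length_append, List.length_take]; omega
      have h7 := hZ.le_of_infix hρ (List.take_prefix (K + 1) Z).isInfix
        (((List.suffix_append a _).isInfix.trans h6.isInfix).trans (List.prefix_append _ _).isInfix)
      rw [List.length_take] at h7
      omega
  obtain ⟨Z₁, rfl⟩ := hA
  rw [List.append_assoc, List.append_cancel_left_eq] at hp
  rw [List.length_append] at h1 h2
  have hZ1 : Z₁ <+: Z := List.prefix_of_prefix_length_le (l₃ := Z ++ B)
    ⟨_, hp.symm⟩ (List.prefix_append _ _) (by omega)
  obtain ⟨Z₂, rfl⟩ := hZ1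
  rw [List.append_assoc, List.append_cancel_left_eq] at hp
  rw [List.length_append] at hK
  refine ⟨Z₁, Z₂, A', y ++ B', c₁, rfl, by omega, hQ, h3, ?_⟩
  rcases h4 with ⟨b, rfl, rfl, rfl, rfl⟩ | ⟨hρ, hlt⟩
  · simp
  have hxZ : x <+: Z₂ := by
    refine List.prefix_of_prefix_length_le (l₃ := Z₂ ++ B) ⟨_, hp.symm⟩ (List.prefix_append _ _) ?_
    rcases hB with rfl | hB
    · have := congrArg List.length hp
      simp only [List.length_append, List.length_nil] at this
      omega
    · by_contra! hlt
      have h6 : Z₂ <+: x := List.prefix_of_prefix_length_le (l₃ := x ++ B₀)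
        ⟨_, hp⟩ (List.prefix_append _ _) hlt.le
      have := hZ.le_of_infix hρ (List.suffix_append _ _).isInfix
        (h6.isInfix.trans (List.prefix_append _ _).isInfix)
      rw [List.length_append] at hB
      omega
  have h6 := hZ.le_of_infix hρ (hxZ.isInfix.trans (List.suffix_append _ _).isInfix)
    (List.prefix_append _ _).isInfix
  have h7 := two_mul_le_of_dehn h.dehn (y := y) ⟨A', B', by rw [hQ]; simp⟩ hρ
  omega

lemma lad_of_dehn {p Q : Word S} (hp : Reduced p) (hs : Seg P p) (hQ : Reduced Q) (hd : SDehn P Q)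
    (h : P.elt p = P.elt Q) : Lad P p Q [] [] where
  red_p := hp
  seg := hs
  red_Q := hQ
  dehn := hd
  arc := Or.inl rfl
  arc' := Or.inl rfl
  elt_eq := by rw [elt_nil, h]; simp
  r1 := by simpa using hp.wordInv
  r2 := by simpa using hQ
  r3 := by simpa using hp
  r4 := by simpa using hQ.wordInv

lemma lad_of_eq {p Q : Word S} (hp : Reduced p) (hs : Seg P p) (hQ : Geod P Q)
    (h : P.elt p = P.elt Q) : Lad P p Q [] [] :=
  lad_of_dehn hp hs hQ.reduced hQ.sdehn h

/-- A good junction between two geodesics makes the concatenation almost geodesic. -/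
lemma length_le_of_pairOK {B q : Word S} {K : ℕ} (hB : Geod P B) (hq : Geod P q)
    (hK : Ovl P K q) (hr : Reduced (B ++ q)) (hp : PairOK P B q) :
    B.length + q.length ≤ len P (P.elt (B ++ q)) + 14 * K := by
  by_cases hlen : q.length ≤ K
  · have := len_mul_ge (P.elt B) (P.elt q)
    rw [hB.len_eq, hq.len_eq, ← elt_append] at this
    omega
  obtain ⟨Q, hQ, hQe⟩ := exists_geod (P := P) (P.elt (B ++ q))
  have hL := lad_of_eq hr ⟨B, q, rfl, hB.sdehn, hq.sdehn, hp⟩ hQ hQe.symm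
  obtain ⟨Z₁, Z₂, A', B', e, rfl, h1, rfl, h2, h3⟩ := Lad.exists_close (B := []) (by simpa using hL)
    hK (by omega) (Or.inl rfl)
  rw [← hQe, hQ.len_eq]
  have g1 := hq.left.len_eq
  have g2 := hq.right.len_eq
  have e1 := len_elt_le (P := P) e
  have e2 := len_mul_ge (P.elt B) (P.elt Z₁)
  have e3 := len_mul_ge (P.elt (B ++ Z₁)) (P.elt e)
  rw [← elt_append, hB.len_eq, g1] at e2
  rw [h2, hQ.left.len_eq] at e3
  have e4 := len_mul_le (P.elt e) (P.elt B')
  have h4 : P.elt e * P.elt B' = P.elt Z₂ := by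
    rw [← List.append_assoc, elt_append P (B ++ Z₁), elt_append P A', ← h2,
      mul_assoc] at hQe
    exact mul_left_cancel hQe
  rw [h4, g2, hQ.right.len_eq] at e4
  simp only [List.length_append]
  omega

end Contraction
end GSC

namespace GSC

section Contraction

variable {S : Type} {P : C6Presentation S}

/-- Remove the common suffix of two reduced words. -/
lemma exists_common_suffix {A p : Word S} (hA : Reduced A) (hp : Reduced p) :
    ∃ A₁ p₁ z, A = A₁ ++ z ∧ p = p₁ ++ z ∧ Reduced (A₁ ++ wordInv p₁) := by
  induction A using List.reverseRecOn generalizing p with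
  | nil => exact ⟨[], p, [], by simp, by simp, by simpa using hp.wordInv⟩
  | append_singleton A a ih =>
    by_cases h : Reduced (A ++ [a] ++ wordInv p)
    · exact ⟨A ++ [a], p, [], by simp, by simp, h⟩
    · rw [← wordInv_wordInv (A ++ [a])] at h
      obtain ⟨b, X, Y, e1, e2⟩ := exists_cons_of_not_reduced hA.wordInv hp.wordInv h
      have e1' := congrArg wordInv e1
      have e2' := congrArg wordInv e2
      rw [wordInv_wordInv, wordInv_cons] at e1' e2'
      obtain ⟨rfl, h3⟩ := List.append_inj' e1' rfl
      obtain ⟨A₁, p₁, z, e3, e4, e5⟩ := ih hA.left (p := wordInv Y) (by rw [e2'] at hp; exact hp.left)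
      refine ⟨A₁, p₁, z ++ [li b], ?_, ?_, e5⟩
      · rw [h3, e3, List.append_assoc]
      · rw [e2', e4, List.append_assoc]

lemma SDehn.pairOK {z₀ z₁ : Word S} (h : SDehn P (z₀ ++ z₁)) : PairOK P z₀ z₁ := by
  rintro ρ hρ u v ⟨s, rfl⟩ ⟨t, rfl⟩ huv
  have := h ρ hρ (u ++ v) ⟨s, t, by simp⟩ huv
  rw [List.length_append] at this
  omega

variable {q : Word S} {a : P.Grp} {K C : ℕ}

lemma exists_forward_of_transversal (hq : Geod P q) (hK : Ovl P K q)
    {A p r : Word S} (hpr : q = p ++ r)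
    (hCp : len P a ≤ len P (a * P.elt p) + C)
    (hA : Geod P A) (hAe : P.elt A = a * P.elt p) (h2 : Reduced (A ++ wordInv p)) (hl : C + 14 * K < p.length) : PairOK P A r := by
  subst hpr
  rcases pairOK_or_pairOK (d := wordInv p) hA.sdehn hq.right.sdehn hq.left.inv.sdehn (by
    intro x hx hx'
    rw [head?_wordInv] at hx'
    obtain ⟨y, hy, rfl⟩ := Option.mem_map.1 hx'
    exact (reduced_append.1 hq.reduced).2.2 y hy _ hx rfl) with h | h
  · exact h
  · have := length_le_of_pairOK hA hq.left.inv (hK.infix (List.prefix_append _ _).isInfix).inv h2 h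
    rw [elt_append, hAe, elt_wordInv, mul_inv_cancel_right, length_wordInv] at this
    rw [← hAe, hA.len_eq] at hCp
    omega

/-- If the start of the geodesic `q` is almost as close to a point as the rest of `q`, then `q`
eventually goes away from the point. -/
lemma exists_forward (hq : Geod P q) (hK : Ovl P K q)
    (hC : ∀ q₀, q₀ <+: q → len P a ≤ len P (a * P.elt q₀) + C) (hN : 15 * K + C + 1 ≤ q.length) :
    ∃ p r A, q = p ++ r ∧ Geod P A ∧ P.elt A = a * P.elt p ∧ p.length ≤ 2 * (15 * K + C + 1) + C ∧
      Reduced (A ++ r) ∧ PairOK P A r := by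
  obtain ⟨p, r, hpr, hpl⟩ : ∃ p r, q = p ++ r ∧ p.length = 15 * K + C + 1 :=
    ⟨q.take (15 * K + C + 1), q.drop (15 * K + C + 1), (List.take_append_drop _ _).symm, by
      rw [List.length_take]; omega⟩
  obtain ⟨A, hA, hAe⟩ := exists_geod (P := P) (a * P.elt p)
  subst hpr
  obtain ⟨A₁, p₁, z, e1, e2, e3⟩ := exists_common_suffix hA.reduced hq.left.reduced
  by_cases hz : z = []
  · subst hz
    rw [List.append_nil] at e1 e2
    subst e1 e2
    obtain ⟨A₂, r₂, z', e4, e5, e6⟩ := exists_common_suffix hA.reduced hq.right.inv.reduced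
    have e5' : r = wordInv z' ++ wordInv r₂ := by rw [← wordInv_append, ← e5, wordInv_wordInv]
    subst e4 e5'
    have hA2 : P.elt A₂ = a * P.elt (p ++ wordInv z') := by
      rw [elt_append, ← mul_assoc, ← hAe, elt_append, elt_wordInv, mul_inv_cancel_right]
    have hCp := hC (p ++ wordInv z') ⟨wordInv r₂, by simp⟩
    refine ⟨p ++ wordInv z', wordInv r₂, A₂, by simp, hA.left, hA2, ?_, e6, ?_⟩
    · have h1 := len_mul_le a (P.elt p)
      have h2 := len_elt_le (P := P) p
      rw [← hAe, hA.len_eq, List.length_append] at h1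
      rw [← hA2, hA.left.len_eq] at hCp
      rw [List.length_append, length_wordInv]
      omega
    · refine exists_forward_of_transversal hq hK (by simp) hCp hA.left hA2
        (by simpa using e3) ?_
      rw [List.length_append]; omega
  · subst e1 e2
    have hr : Reduced (A₁ ++ z ++ r) := by
      have : Reduced (z ++ r) := by
        have := hq.reduced; rw [List.append_assoc] at this; exact this.right
      exact hA.reduced.append_overlap this hz
    by_cases hzl : z.length ≤ K
    · have hA1 : P.elt A₁ = a * P.elt p₁ := by
        rw [elt_append, elt_append, ← mul_assoc] at hAe
        exact mul_right_cancel hAe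
      have hCp := hC p₁ ⟨z ++ r, by simp⟩
      rw [List.length_append] at hpl
      refine ⟨p₁, z ++ r, A₁, by simp, hA.left, hA1, by omega, by simpa using hr, ?_⟩
      exact exists_forward_of_transversal hq hK (by simp) hCp hA.left hA1
        e3 (by omega)
    · refine ⟨p₁ ++ z, r, A₁ ++ z, rfl, hA, hAe, by omega, hr, ?_⟩
      have h1 : SDehn P (A₁ ++ (z ++ r)) := by
        refine SDehn.glue hA.sdehn ?_ (hK.infix (u := z) ⟨p₁, r, by simp⟩) (by omega)
        exact hq.sdehn.infix ⟨p₁, [], by simp⟩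
      exact SDehn.pairOK (by simpa using h1)

lemma length_add_le (hq : Geod P q) (hK : Ovl P K q)
    (hC : ∀ q₀, q₀ <+: q → len P a ≤ len P (a * P.elt q₀) + C) {q₀ : Word S} (h0 : q₀ <+: q) :
    len P a + q₀.length ≤ len P (a * P.elt q₀) + (4 * C + 44 * K + 2) := by
  have h1 := hC q₀ h0
  by_cases hN : 15 * K + C + 1 ≤ q.length
  swap
  · have := h0.length_le
    omega
  obtain ⟨p, r, A, rfl, hA, hAe, hp, hr, hpair⟩ := exists_forward hq hK hC hN
  by_cases hle : q₀.length ≤ p.length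
  · omega
  obtain ⟨r', rfl⟩ := List.prefix_of_prefix_length_le (List.prefix_append p r) h0 (by omega)
  rw [List.prefix_append_right_inj] at h0
  have h2 := length_le_of_pairOK hA (hq.right.infix h0.isInfix)
    (hK.infix (h0.isInfix.trans (List.suffix_append _ _).isInfix))
    (hr.infix ((List.prefix_append_right_inj A).2 h0).isInfix) (hpair.mono List.suffix_rfl h0)
  have h3 := hC p (List.prefix_append _ _)
  rw [← hAe, hA.len_eq] at h3
  rw [elt_append, hAe, mul_assoc, ← elt_append] at h2
  rw [List.length_append]
  omega

end Contraction
end GSC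

namespace GSC

section Core

variable {S : Type} {P : C6Presentation S} {q : Word S} {a a' : P.Grp} {K C : ℕ}

/-- A length after which a geodesic is certain to move away from a point. -/
def landing (K C : ℕ) : ℕ := (4 * C + 44 * K + 3) * (K + 1)

lemma exists_landing (hq : Geod P q) (hK : Ovl P K q)
    (hC : ∀ q₀, q₀ <+: q → len P a ≤ len P (a * P.elt q₀) + C) (hl : landing K C ≤ q.length) :
    ∃ A q₀ q₁ q₂, q = q₀ ++ (q₁ ++ q₂) ∧ q₁.length = K + 1 ∧
      q₀.length + q₁.length ≤ landing K C ∧ Geod P (A ++ q₁) ∧ P.elt A = a * P.elt q₀ := by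
  by_contra! hcon
  have key : ∀ i, i ≤ 4 * C + 44 * K + 3 →
      len P (a * P.elt (q.take (i * (K + 1)))) ≤ len P a + i * K := by
    intro i
    induction i with
    | zero => intro _; simp
    | succ i ih =>
      intro hi
      have h1 := ih (by omega)
      have h2 : (i + 1) * (K + 1) ≤ landing K C := Nat.mul_le_mul_right _ hi
      have h3 : (i + 1) * (K + 1) = i * (K + 1) + (K + 1) := by ring
      obtain ⟨A, hA, hAe⟩ := exists_geod (P := P) (a * P.elt (q.take (i * (K + 1))))
      set q₁ := (q.drop (i * (K + 1))).take (K + 1) with hq₁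
      have h4 : q.take ((i + 1) * (K + 1)) = q.take (i * (K + 1)) ++ q₁ := by
        rw [h3, List.take_add]
      have h5 : q = q.take (i * (K + 1)) ++ (q₁ ++ q.drop ((i + 1) * (K + 1))) := by
        rw [← List.append_assoc, ← h4, List.take_append_drop]
      have h6 : q₁.length = K + 1 := by
        rw [hq₁, List.length_take, List.length_drop]; omega
      have h7 : (q.take (i * (K + 1))).length = i * (K + 1) := by
        rw [List.length_take]; omega
      by_cases h : Geod P (A ++ q₁)
      · exact absurd hAe (hcon A _ q₁ _ h5 h6 (by omega) h)
      · have h8 : len P (P.elt (A ++ q₁)) < (A ++ q₁).length := by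
          by_contra! h'
          exact h (geod_of_len h')
        rw [elt_append, hAe, mul_assoc, ← elt_append, ← h4, List.length_append, h6] at h8
        rw [← hAe, hA.len_eq] at h1
        have : (i + 1) * K = i * K + K := by ring
        omega
  have h1 := key _ le_rfl
  have h2 := length_add_le hq hK hC (List.take_prefix ((4 * C + 44 * K + 3) * (K + 1)) q)
  rw [List.length_take, min_eq_left (show (4 * C + 44 * K + 3) * (K + 1) ≤ _ from hl)] at h2
  have : (4 * C + 44 * K + 3) * (K + 1) = (4 * C + 44 * K + 3) * K + (4 * C + 44 * K + 3) := by ring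
  omega

/-- Two points whose closest points on a geodesic without long overlaps with relators are far
apart are themselves far apart. -/
lemma add_length_add_le (hq : Geod P q) (hK : Ovl P K q)
    (hC : ∀ q₀, q₀ <+: q → len P a ≤ len P (a * P.elt q₀) + C)
    (hC' : ∀ q₀, q₀ <+: wordInv q → len P a' ≤ len P (a' * P.elt q₀) + C)
    (hl : 2 * landing K C ≤ q.length) :
    len P a + q.length + len P a' ≤
      len P (a * P.elt q * a'⁻¹) + (landing K C + 5 * C + 57 * K + 2) := by
  obtain ⟨A, q₀, q₁, q₂, e1, hq₁, hL, hA, hAe⟩ := exists_landing hq hK hC (by omega)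
  obtain ⟨A', q₀', q₁', q₂', e1', hq₁', hL', hA', hAe'⟩ :=
    exists_landing hq.inv hK.inv hC' (by rw [length_wordInv]; omega)
  have e2 : q = wordInv q₂' ++ (wordInv q₁' ++ wordInv q₀') := by
    rw [← wordInv_wordInv q, e1']; simp
  have hlq : q.length = q₂'.length + (q₁'.length + q₀'.length) := by
    rw [e2]; simp [length_wordInv]
  obtain ⟨m, hm⟩ : q₀ ++ q₁ <+: wordInv q₂' := by
    refine List.prefix_of_prefix_length_le (l₃ := q) ⟨q₂, by simp [e1]⟩ ⟨_, e2.symm⟩ ?_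
    rw [List.length_append, length_wordInv]; omega
  have e3 : q = q₀ ++ ((q₁ ++ (m ++ wordInv q₁')) ++ wordInv q₀') := by
    rw [e2, ← hm]; simp
  set Z := q₁ ++ (m ++ wordInv q₁') with hZ
  have hZq : Z <:+: q := ⟨q₀, wordInv q₀', by rw [e3]; simp⟩
  have hZl : Z.length = q₁.length + (m.length + q₁'.length) := by
    rw [hZ]; simp [length_wordInv]
  have hA'i := hA'.inv
  rw [wordInv_append] at hA'i
  have hne : q₁ ≠ [] := by rintro rfl; simp at hq₁
  have hne' : wordInv q₁' ≠ [] := by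
    rw [Ne, wordInv_eq_nil]; rintro rfl; simp at hq₁'
  have s1 : SDehn P (A ++ Z) :=
    SDehn.glue hA.sdehn (hq.sdehn.infix hZq)
      (hK.infix (List.IsInfix.trans (List.prefix_append _ _).isInfix hZq)) (by omega)
  have s2 : SDehn P (A ++ (Z ++ wordInv A')) := by
    have := SDehn.glue (A := A ++ (q₁ ++ m)) (b := wordInv q₁') (B := wordInv A') (K := K)
      (by simpa [hZ] using s1) hA'i.sdehn (hK.infix (List.IsInfix.trans ⟨q₁ ++ m, [], by simp [hZ]⟩ hZq))
      (by rw [length_wordInv]; omega)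
    simpa [hZ] using this
  have r1 : Reduced (A ++ Z) := by
    have := hA.reduced.append_overlap (hq.infix hZq).reduced hne
    simpa [hZ] using this
  have r2 : Reduced (A ++ (Z ++ wordInv A')) := by
    have : Reduced (A ++ (q₁ ++ m) ++ wordInv q₁') := by simpa [hZ] using r1
    simpa [hZ] using this.append_overlap hA'i.reduced hne'
  obtain ⟨Q, hQ, hQe⟩ := exists_geod (P := P) (a * P.elt q * a'⁻¹)
  have hpe : P.elt (A ++ (Z ++ wordInv A')) = P.elt Q := by
    rw [hQe, e3]
    simp only [elt_append, hAe, hAe', elt_wordInv]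
    group
  obtain ⟨Z₁, Z₂, A₁, B₁, e, e4, hZ₁, e5, e6, he⟩ :=
    (lad_of_eq r2 s2.seg hQ hpe).exists_close (hK.infix hZq) (by omega) (Or.inr (by omega))
  have hlZ : Z.length = Z₁.length + Z₂.length := by rw [e4, List.length_append]
  have hlq2 : q.length = q₀.length + (Z.length + q₀'.length) := by
    conv_lhs => rw [e3]
    simp [length_wordInv]
  have e7 : q = q₀ ++ Z₁ ++ (Z₂ ++ wordInv q₀') := by
    rw [e3, e4]; simp
  have f1 := hC (q₀ ++ Z₁) ⟨_, e7.symm⟩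
  have f2 := length_add_le hq.inv hK.inv hC' (q₀ := q₀' ++ wordInv Z₂)
    ⟨wordInv (q₀ ++ Z₁), by conv_rhs => rw [e7]
                            simp⟩
  have f3 : len P (a * P.elt (q₀ ++ Z₁)) ≤ A₁.length + 6 * K := by
    have := len_mul_ge (a * P.elt (q₀ ++ Z₁)) (P.elt e)
    have h2 : a * P.elt (q₀ ++ Z₁) * P.elt e = P.elt A₁ := by
      rw [← e6]; simp only [elt_append, hAe]; group
    rw [h2] at this
    have h3 := len_elt_le (P := P) e
    have h4 := len_elt_le (P := P) A₁
    omega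
  have f4 : len P (a' * P.elt (q₀' ++ wordInv Z₂)) ≤ B₁.length + 6 * K := by
    have := len_mul_ge (a' * P.elt (q₀' ++ wordInv Z₂)) (P.elt e)
    have h2 : a' * P.elt (q₀' ++ wordInv Z₂) * P.elt e = P.elt (wordInv B₁) := by
      have h5 : P.elt B₁ = (P.elt A₁)⁻¹ * P.elt Q := by
        rw [e5, elt_append]; group
      rw [elt_wordInv, h5, ← e6, ← hpe, e4]
      simp only [elt_append, elt_wordInv, hAe']
      group
    rw [h2] at this
    have h3 := len_elt_le (P := P) e
    have h4 := len_elt_le (P := P) (wordInv B₁)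
    rw [length_wordInv] at h4
    omega
  have f5 : len P (a * P.elt q * a'⁻¹) = A₁.length + B₁.length := by
    rw [← hQe, hQ.len_eq, e5, List.length_append]
  rw [List.length_append, length_wordInv] at f2
  omega

end Core
end GSC

namespace GSC

section Powers

variable {S : Type} {P : C6Presentation S}

/-- The power of a word. -/
def wpow (w : Word S) (n : ℕ) : Word S := (List.replicate n w).flatten

@[simp] lemma wpow_zero (w : Word S) : wpow w 0 = [] := rfl

lemma wpow_succ (w : Word S) (n : ℕ) : wpow w (n + 1) = w ++ wpow w n := rfl

lemma wpow_append (u v : Word S) (n : ℕ) : wpow (u ++ v) n ++ u = u ++ wpow (v ++ u) n := by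
  induction n with
  | zero => simp
  | succ n ih => rw [wpow_succ, List.append_assoc, ih, wpow_succ]; simp

lemma wpow_succ' (w : Word S) (n : ℕ) : wpow w (n + 1) = wpow w n ++ w := by
  have := wpow_append w [] n
  simp only [List.append_nil, List.nil_append] at this
  rw [this, wpow_succ]

lemma elt_wpow (w : Word S) (n : ℕ) : P.elt (wpow w n) = P.elt w ^ n := by
  induction n with
  | zero => simp
  | succ n ih => rw [wpow_succ, elt_append, ih, pow_succ']

/-- Subwords of a power of a word are prefixes of powers of a rotation of this word. -/
lemma exists_rotation {t w : Word S} {n : ℕ} (h : t <:+: wpow w n) :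
    ∃ u v, w = u ++ v ∧ t <+: wpow (v ++ u) n := by
  induction n generalizing t with
  | zero => exact ⟨w, [], by simp, h.eq_of_length_le (by simp) ▸ List.prefix_rfl⟩
  | succ n ih =>
    obtain ⟨s, s', h⟩ := h
    rw [wpow_succ, List.append_assoc] at h
    rcases List.append_eq_append_iff.1 h with ⟨v, rfl, h'⟩ | ⟨s₁, rfl, h'⟩
    · refine ⟨s, v, rfl, ?_⟩
      refine List.IsPrefix.trans ⟨s', h'⟩ ?_
      refine ⟨s, ?_⟩
      rw [List.append_assoc, wpow_append, wpow_succ, List.append_assoc]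
    · obtain ⟨u, v, h1, h2⟩ := ih ⟨s₁, s', by rw [h', List.append_assoc]⟩
      exact ⟨u, v, h1, h2.trans (by rw [wpow_succ']; exact List.prefix_append _ _)⟩

lemma prefix_wpow {p w : Word S} {n : ℕ} (h : p <+: wpow w n) (hl : p.length ≤ w.length) :
    p <+: w := by
  cases n with
  | zero =>
    have := h.eq_of_length_le (by simp)
    rw [this]; exact List.nil_prefix
  | succ n => exact List.prefix_of_prefix_length_le h (List.prefix_append _ _) hl

/-- A prefix of a power is close to a smaller power. -/
lemma exists_wpow_append {p w : Word S} {n : ℕ} (h : p <+: wpow w n) :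
    ∃ m r, p = wpow w m ++ r ∧ r.length ≤ w.length := by
  induction n generalizing p with
  | zero => exact ⟨0, p, rfl, by rw [h.eq_of_length_le (by simp)]; simp⟩
  | succ n ih =>
    by_cases hl : p.length ≤ w.length
    · exact ⟨0, p, rfl, hl⟩
    · obtain ⟨p', rfl⟩ := List.prefix_of_prefix_length_le (List.prefix_append w (wpow w n)) h
        (by omega)
      rw [wpow_succ, List.prefix_append_right_inj] at h
      obtain ⟨m, r, rfl, h2⟩ := ih h
      exact ⟨m + 1, r, by rw [wpow_succ, List.append_assoc], h2⟩

lemma CyclicallyReduced.wpow {w : Word S} (h : CyclicallyReduced w) (n : ℕ) :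
    Reduced (wpow w n) := by
  rcases eq_or_ne w [] with rfl | hw
  · have : GSC.wpow ([] : Word S) n = [] := by simp [GSC.wpow]
    rw [this]; exact reduced_nil
  · induction n with
    | zero => exact reduced_nil
    | succ n ih =>
      cases n with
      | zero => simpa [wpow_succ] using h.reduced
      | succ n =>
        rw [wpow_succ, wpow_succ, ← List.append_assoc]
        exact Reduced.append_overlap h ih hw

lemma CyclicallyReduced.rotation {u v : Word S} (h : CyclicallyReduced (u ++ v)) :
    CyclicallyReduced (v ++ u) := by
  have := cyclicallyReduced_rotate h u.length
  rwa [List.rotate_append_length_eq] at this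

lemma length_lt_two_mul (hnonrep : ∀ r ∈ P.rels, ∀ w : Word S, w ≠ [] → Reduced w → ¬ (w ++ w) <:+: r)
    {w : Word S} (hw : w ≠ []) (hc : CyclicallyReduced w) {n : ℕ} {u ρ : Word S}
    (hu : u <:+: wpow w n) (hρ : ρ ∈ P.rels) (huρ : u <:+: ρ) : u.length < 2 * w.length := by
  by_contra! hl
  obtain ⟨a, b, rfl, h⟩ := exists_rotation hu
  have hlw := List.length_pos_iff.2 hw
  have hl' : (b ++ a).length = (a ++ b).length := by simp [add_comm]
  have h2 : (b ++ a) ++ (b ++ a) <+: u := by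
    match n, h with
    | 0, h => have := h.length_le; simp only [wpow_zero, List.length_nil] at this; omega
    | 1, h =>
      have := h.length_le
      rw [wpow_succ, wpow_zero, List.append_nil] at this
      omega
    | n + 2, h =>
      refine List.prefix_of_prefix_length_le (l₃ := wpow (b ++ a) (n + 2)) ?_ h ?_
      · exact ⟨wpow (b ++ a) n, by rw [wpow_succ, wpow_succ]; simp only [List.append_assoc]⟩
      · rw [List.length_append]; omega
  refine hnonrep ρ hρ (b ++ a) ?_ hc.rotation.reduced (h2.isInfix.trans huρ)
  rw [Ne, ← List.length_eq_zero_iff]; omega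

end Powers

section Axis

variable {S : Type} {P : C6Presentation S}

lemma SDehn.eq_nil {v : Word S} (h : SDehn P v) (hv : Reduced v) (h1 : P.elt v = 1) : v = [] := by
  by_contra hne
  obtain ⟨A, x, B, A', y, B', c₁, c₂, e1, e2, -, h3, -, h4⟩ :=
    (lad_of_dehn hv h.seg reduced_nil SDehn.nil (by rw [h1, elt_nil])).cov
      (List.length_pos_iff.2 hne)
  obtain ⟨-, hy⟩ : A' = [] ∧ y ++ B' = [] := by simpa using e2.symm
  obtain ⟨rfl, -⟩ : y = [] ∧ B' = [] := by simpa using hy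
  rcases h4 with ⟨a, -, h5, -⟩ | ⟨h5, h6⟩
  · simp at h5
  · have := h _ h5 x ⟨A, B, by rw [e1, List.append_assoc]⟩ (List.prefix_append _ _)
    simp only [List.length_append, length_wordInv] at this h6
    simp only [List.length_nil] at this h6
    omega

lemma SDehn.prefix_eq {Q A B : Word S} (h : SDehn P Q) (hQ : Reduced Q) (hA : A <+: Q)
    (hB : B <+: Q) (he : P.elt A = P.elt B) : A = B := by
  wlog hl : A.length ≤ B.length generalizing A B
  · exact (this hB hA he.symm (by omega)).symm
  obtain ⟨v, rfl⟩ := List.prefix_of_prefix_length_le hA hB hl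
  have hv : v <:+: Q := List.IsInfix.trans (List.suffix_append _ _).isInfix hB.isInfix
  rw [(h.infix hv).eq_nil (hQ.infix hv) (by rwa [elt_append, left_eq_mul] at he), List.append_nil]

/-- A word all of whose powers are shortest with respect to Dehn's algorithm and have bounded
overlaps with relators. -/
structure DehnRoot (P : C6Presentation S) (w : Word S) : Prop where
  red : CyclicallyReduced w
  dehn : ∀ n, SDehn P (wpow w n)
  ovl : ∀ n, ∀ ρ ∈ P.rels, ∀ u, u <:+: wpow w n → u <:+: ρ → u.length ≤ 2 * w.length

variable {w : Word S}

lemma DehnRoot.cov (hw : DehnRoot P w) {q : Word S} {n : ℕ} (hq : Geod P q)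
    (h : P.elt q = P.elt (wpow w n)) {k : ℕ} (hk : k < q.length) :
    ∃ A x B A' y B' c₁, q = A ++ (x ++ B) ∧ wpow w n = A' ++ (y ++ B') ∧ A.length ≤ k ∧
      k < A.length + x.length ∧ P.elt A * P.elt c₁ = P.elt A' ∧
      ((∃ a, x = [a] ∧ y = [a] ∧ c₁ = []) ∨
      (x.length ≤ 6 * w.length ∧ c₁.length ≤ 12 * w.length ∧ ∃ ρ ∈ P.rels, x <+: ρ ∧
        ρ.length < 6 * x.length ∧ ρ.length < 12 * w.length)) := by
  obtain ⟨A, x, B, A', y, B', c₁, c₂, e1, e2, h1, h2, h3, h4⟩ :=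
    (lad_of_dehn hq.reduced hq.sdehn.seg (hw.red.wpow n) (hw.dehn n) h).cov hk
  rw [elt_nil, one_mul] at h3
  refine ⟨A, x, B, A', y, B', c₁, e1, e2, h1, h2, h3, ?_⟩
  rcases h4 with ⟨a, h5, h6, h7, -⟩ | ⟨h5, h6⟩
  · exact Or.inl ⟨a, h5, h6, h7⟩
  have hy : y <:+: wpow w n := ⟨A', B', by rw [e2, List.append_assoc]⟩
  have f1 := two_mul_le_of_dehn (hw.dehn n) hy h5
  have f2 := hq.sdehn _ h5 x ⟨A, B, by rw [e1, List.append_assoc]⟩ (List.prefix_append _ _)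
  have f3 : y.length ≤ 2 * w.length := by
    refine hw.ovl n _ (P.inv_mem _ h5) y hy ?_
    refine ⟨c₁, wordInv (x ++ c₂), ?_⟩
    simp
  have f4 : (x ++ (c₂ ++ (wordInv y ++ wordInv c₁))).length =
      x.length + c₂.length + y.length + c₁.length := by
    simp only [List.length_append, length_wordInv]; omega
  refine Or.inr ⟨?_, ?_, _, h5, List.prefix_append _ _, ?_, ?_⟩ <;> omega

/-- A geodesic between powers stays close to the powers. -/
lemma DehnRoot.exists_near (hw : DehnRoot P w) {q q₀ : Word S} {n : ℕ} (hq : Geod P q)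
    (h : P.elt q = P.elt (wpow w n)) (h0 : q₀ <+: q) :
    ∃ m : ℕ, len P ((P.elt q₀)⁻¹ * P.elt w ^ m) ≤ 19 * w.length + 1 := by
  obtain ⟨q₁, rfl⟩ := h0
  rcases eq_or_ne q₁ [] with rfl | hne
  · rw [List.append_nil] at h
    refine ⟨n, ?_⟩
    rw [h, elt_wpow, inv_mul_cancel, len_one]; omega
  have := List.length_pos_iff.2 hne
  obtain ⟨A, x, B, A', y, B', c₁, e1, e2, h1, h2, h3, h4⟩ :=
    hw.cov hq h (k := q₀.length) (by rw [List.length_append]; omega)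
  obtain ⟨d, rfl⟩ := List.prefix_of_prefix_length_le (l₃ := q₀ ++ q₁) ⟨_, e1.symm⟩
    (List.prefix_append q₀ q₁) h1
  obtain ⟨m, r, rfl, hr⟩ := exists_wpow_append (p := A') (w := w) (n := n) ⟨_, e2.symm⟩
  rw [List.length_append] at h2
  refine ⟨m, ?_⟩
  have h5 : (P.elt (A ++ d))⁻¹ * P.elt w ^ m = P.elt (wordInv d ++ c₁ ++ wordInv r) := by
    have h6 : P.elt w ^ m = P.elt A * P.elt c₁ * (P.elt r)⁻¹ := by
      rw [h3, elt_append, elt_wpow]; group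
    rw [h6]
    simp only [elt_append, elt_wordInv]
    group
  rw [h5]
  refine (len_elt_le _).trans ?_
  simp only [List.length_append, length_wordInv]
  rcases h4 with ⟨a, rfl, -, rfl⟩ | ⟨h4, h5, -⟩
  · simp only [List.length_singleton, List.length_nil] at *
    omega
  · omega

lemma DehnRoot.ovl_geod (hw : DehnRoot P w) {q : Word S} {n : ℕ} (hq : Geod P q)
    (h : P.elt q = P.elt (wpow w n)) : Ovl P (14 * w.length) q := by
  intro ρ hρ u hu huρ
  by_contra! hl
  have hu2 := hq.sdehn ρ hρ u hu huρ
  obtain ⟨s, s', rfl⟩ := hu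
  obtain ⟨u₁, v, u₂, rfl, hl1, hl2⟩ : ∃ u₁ v u₂, u = u₁ ++ (v ++ u₂) ∧
      u₁.length = 6 * w.length ∧ u₂.length = 6 * w.length := by
    refine ⟨u.take (6 * w.length), (u.drop (6 * w.length)).take (u.length - 12 * w.length),
      (u.drop (6 * w.length)).drop (u.length - 12 * w.length), by simp, ?_, ?_⟩
    · rw [List.length_take]; omega
    · simp only [List.length_drop]; omega
  have key : ∀ v₀ a v₁, v = v₀ ++ ([a] ++ v₁) →
      ∃ A', A' ++ [a] <+: wpow w n ∧ P.elt (s ++ (u₁ ++ v₀)) = P.elt A' := by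
    rintro v₀ a v₁ rfl
    obtain ⟨A, x, B, A', y, B', c₁, e1, e2, h1, h2, h3, h4⟩ :=
      hw.cov hq h (k := (s ++ (u₁ ++ v₀)).length) (by
        simp only [List.length_append, List.length_singleton]; omega)
    rcases h4 with ⟨b, rfl, rfl, rfl⟩ | ⟨h4, -, σ, hσ, h6, h7, h8⟩
    · have e3 : s ++ (u₁ ++ v₀) ++ (a :: (v₁ ++ u₂ ++ s')) = A ++ (b :: B) := by
        have : A ++ (b :: B) = A ++ ([b] ++ B) := rfl
        rw [this, ← e1]; simp
      rw [List.length_singleton] at h2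
      obtain ⟨rfl, h5⟩ := List.append_inj e3 (by omega)
      obtain ⟨rfl, -⟩ := List.cons.inj h5
      refine ⟨A', ⟨B', by rw [e2, List.append_assoc]⟩, ?_⟩
      rwa [elt_nil, mul_one] at h3
    · exfalso
      have hx : x <:+: u₁ ++ ((v₀ ++ ([a] ++ v₁)) ++ u₂) := by
        simp only [List.length_append, List.length_singleton] at h1 h2 hl
        obtain ⟨d, rfl⟩ : s <+: A := List.prefix_of_prefix_length_le
          (l₃ := A ++ (x ++ B)) ⟨_, by rw [← e1]; simp; rfl⟩ (List.prefix_append _ _) (by omega)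
        have e3 : d ++ x ++ B = (u₁ ++ ((v₀ ++ ([a] ++ v₁)) ++ u₂)) ++ s' := by
          have := e1.symm
          rw [List.append_assoc, List.append_assoc, List.append_cancel_left_eq] at this
          rw [List.append_assoc, this]
        have h9 : d ++ x <+: u₁ ++ ((v₀ ++ ([a] ++ v₁)) ++ u₂) := by
          refine List.prefix_of_prefix_length_le ⟨B, e3⟩ (List.prefix_append _ _) ?_
          simp only [List.length_append, List.length_singleton] at h1 h2 ⊢
          omega
        exact List.IsInfix.trans (List.suffix_append _ _).isInfix h9.isInfix
      obtain ⟨τ, hτ, h9, h10⟩ := rel_infix_rot hρ (hx.trans huρ.isInfix)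
      by_cases hne : σ = τ
      · subst hne; omega
      · have := piece_lt hσ hτ hne h6 h9
        omega
  have hv : v <:+: wpow w n := by
    have : ∀ v₀ v₁, v = v₀ ++ v₁ → v₀ = [] ∨
        ∃ A', A' ++ v₀ <+: wpow w n ∧ P.elt (s ++ u₁) = P.elt A' := by
      intro v₀
      induction v₀ using List.reverseRecOn with
      | nil => exact fun _ _ => Or.inl rfl
      | append_singleton v₀ a ih =>
        intro v₁ hv
        obtain ⟨A'', h1, h2⟩ := key v₀ a v₁ (by rw [hv, List.append_assoc])
        refine Or.inr ?_
        rcases ih ([a] ++ v₁) (by rw [hv, List.append_assoc]) with rfl | ⟨A', h3, h4⟩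
        · exact ⟨A'', h1, by simpa using h2⟩
        · refine ⟨A', ?_, h4⟩
          have : A'' = A' ++ v₀ := by
            refine (hw.dehn n).prefix_eq (hw.red.wpow n) ?_ h3 ?_
            · exact (List.prefix_append _ _).trans h1
            · rw [← h2, elt_append P A', ← h4]; simp only [elt_append]; group
          rwa [← List.append_assoc, ← this]
    rcases this v [] (by simp) with rfl | ⟨A', h1, -⟩
    · exact List.nil_infix
    · exact List.IsInfix.trans (List.suffix_append _ _).isInfix h1.isInfix
  have hvl := hw.ovl n ρ hρ v hv (List.IsInfix.trans ⟨u₁, u₂, by simp⟩ huρ.isInfix)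
  simp only [List.length_append] at hl
  omega

end Axis
end GSC

namespace GSC

section Alternating

variable {S : Type} {P : C6Presentation S}

/-- The alternating word `XYXY⋯` with `n` syllables. -/
def altWord (X Y : Word S) : ℕ → Word S
  | 0 => []
  | n + 1 => X ++ altWord Y X n

lemma wpow_eq_altWord (X Y : Word S) (n : ℕ) : wpow (X ++ Y) n = altWord X Y (2 * n) := by
  induction n with
  | zero => rfl
  | succ n ih => rw [wpow_succ, ih]; simp [altWord, Nat.mul_add]

lemma infix_append {u A B : Word S} (h : u <:+: A ++ B) :
    u <:+: A ∨ u <:+: B ∨ ∃ u₁ u₂, u₁ ≠ [] ∧ u₂ ≠ [] ∧ u = u₁ ++ u₂ ∧ u₁ <:+ A ∧ u₂ <+: B := by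
  obtain ⟨s, t, h⟩ := h
  rw [List.append_assoc] at h
  rcases List.append_eq_append_iff.1 h with ⟨a, rfl, h'⟩ | ⟨a, rfl, h'⟩
  · rcases List.append_eq_append_iff.1 h' with ⟨d, rfl, -⟩ | ⟨d, rfl, rfl⟩
    · exact Or.inl ⟨s, d, by simp⟩
    · by_cases ha : a = []
      · subst ha; exact Or.inr (Or.inl ⟨[], t, by simp⟩)
      by_cases hd : d = []
      · subst hd; exact Or.inl ⟨s, [], by simp⟩
      exact Or.inr (Or.inr ⟨a, d, ha, hd, rfl, List.suffix_append _ _, List.prefix_append _ _⟩)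
  · exact Or.inr (Or.inl ⟨a, t, by rw [h', List.append_assoc]⟩)

/-- Long words across a junction of the syllables `X` and `Y` are not common with relators. -/
def JunctionOK (P : C6Presentation S) (X Y : Word S) : Prop :=
  ∀ ρ ∈ P.rels, ∀ u v, u ≠ [] → v ≠ [] → u <:+ X → v <+: Y → u ++ v <+: ρ →
    6 * u.length < ρ.length ∧ 6 * v.length < ρ.length ∧ u ≠ X ∧ v ≠ Y

lemma sdehn_altWord (n : ℕ) {X Y : Word S} (hX : SDehn P X) (hY : SDehn P Y) (hX0 : X ≠ [])
    (hY0 : Y ≠ []) (h : JunctionOK P X Y) (h' : JunctionOK P Y X) : SDehn P (altWord X Y n) := by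
  induction n generalizing X Y with
  | zero => exact SDehn.nil
  | succ n ih =>
    intro ρ hρ u hu hup
    rcases infix_append hu with hu | hu | ⟨u₁, u₂, h1, h2, rfl, h3, h4⟩
    · exact hX ρ hρ u hu hup
    · exact ih hY hX hY0 hX0 h' h ρ hρ u hu hup
    · have h5 : u₂ <+: Y := by
        cases n with
        | zero => exact absurd (List.prefix_nil.1 h4) h2
        | succ n =>
          rcases List.prefix_or_prefix_of_prefix h4 (List.prefix_append Y (altWord X Y n)) with h5 | h5
          · exact h5
          · have := h ρ hρ u₁ Y h1 hY0 h3 List.prefix_rfl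
              (((List.prefix_append_right_inj u₁).2 h5).trans hup)
            exact absurd rfl this.2.2.2
      have := h ρ hρ u₁ u₂ h1 h2 h3 h5 hup
      rw [List.length_append]; omega

lemma junctionOK {p X Y : Word S} (hp : p ≠ []) (h : p ++ (X ++ (p ++ wordInv Y)) ∈ P.rels)
    (hX : (p ++ (X ++ (p ++ wordInv Y))).length ≤ 6 * X.length)
    (hY : (p ++ (X ++ (p ++ wordInv Y))).length ≤ 6 * Y.length) : JunctionOK P X Y := by
  rintro _ hρ u v hu hv ⟨s, rfl⟩ ⟨s', rfl⟩ ⟨m, rfl⟩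
  have hc := P.cyclically_reduced _ h
  have hr : Reduced ((p ++ ((s ++ u) ++ (p ++ wordInv (v ++ s')))) ++ p) :=
    hc.infix ⟨[], (s ++ u) ++ (p ++ wordInv (v ++ s')), by simp⟩
  have e1 : u ++ (p ++ wordInv (v ++ s') ++ p ++ s) ∈ P.rels := by
    have := rel_rot (u := p ++ s) (v := u ++ (p ++ wordInv (v ++ s'))) (by simpa using h)
    simpa using this
  have e2 : v ++ (s' ++ wordInv p ++ wordInv (s ++ u) ++ wordInv p) ∈ P.rels := by
    have := P.inv_mem _ h
    simpa using this
  have e3 : u ++ (v ++ m) ∈ P.rels := by simpa using hρ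
  have e4 : v ++ (m ++ u) ∈ P.rels := by simpa using rel_rot e3
  have n1 : v ++ m ≠ p ++ wordInv (v ++ s') ++ p ++ s := by
    obtain ⟨b, v, rfl⟩ := List.exists_cons_of_ne_nil hv
    obtain ⟨a, p, rfl⟩ := List.exists_cons_of_ne_nil hp
    intro heq
    simp only [List.cons_append, List.cons.injEq] at heq
    obtain ⟨rfl, -⟩ := heq
    have : Reduced ([li b] ++ [b]) := by
      refine hr.infix ⟨b :: p ++ ((s ++ u) ++ (b :: p ++ wordInv (v ++ s'))), p, ?_⟩
      simp [wordInv_cons]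
    rw [reduced_append] at this
    exact this.2.2 (li b) (by simp) b (by simp) (by simp)
  have n2 : m ++ u ≠ s' ++ wordInv p ++ wordInv (s ++ u) ++ wordInv p := by
    obtain ⟨u, b, rfl⟩ := List.eq_nil_or_concat'  u |>.resolve_left hu
    obtain ⟨a, p, rfl⟩ := List.exists_cons_of_ne_nil hp
    intro heq
    rw [wordInv_cons, ← List.append_assoc, ← List.append_assoc] at heq
    have h1 := (List.append_inj' heq rfl).2
    simp only [List.cons.injEq, and_true] at h1
    have : Reduced ([b] ++ [a]) := by
      refine hr.infix ⟨a :: p ++ (s ++ u), p ++ (wordInv (v ++ s') ++ a :: p), ?_⟩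
      simp
    rw [reduced_append] at this
    exact this.2.2 b (by simp) a (by simp) (eq_li_comm.1 h1)
  have f1 := piece_lt_append e3 e1 n1
  have f2 := piece_lt_append e4 e2 n2
  have f3 := piece_lt_append e1 e3 n1.symm
  have f4 := piece_lt_append e2 e4 n2.symm
  simp only [List.length_append, length_wordInv] at f1 f2 f3 f4 hX hY ⊢
  refine ⟨by omega, by omega, fun hcon => ?_, fun hcon => ?_⟩
  · have := congrArg List.length hcon
    rw [List.length_append] at this; omega
  · have := congrArg List.length hcon
    rw [List.length_append] at this; omega

lemma sdehn_of_rel {X t : Word S} (h : X ++ t ∈ P.rels) (hl : X.length ≤ t.length) : SDehn P X := by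
  rintro ρ hρ u ⟨a, b, rfl⟩ hu
  have h1 : u ++ (b ++ t ++ a) ∈ P.rels := by
    have := rel_rot (u := a) (v := u ++ (b ++ t)) (by simpa using h)
    simpa using this
  have : 6 * u.length < ρ.length ∨ ρ = u ++ (b ++ t ++ a) := by
    by_contra! hcon
    have := piece_lt hρ h1 hcon.2 hu (List.prefix_append _ _)
    omega
  rcases this with h2 | rfl
  · omega
  · simp only [List.length_append] at hl ⊢; omega

lemma sdehn_altWord_of_rel {p X Y : Word S} (hp : p ≠ []) (hX0 : X ≠ []) (hY0 : Y ≠ [])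
    (h : p ++ (X ++ (p ++ wordInv Y)) ∈ P.rels)
    (hX : (p ++ (X ++ (p ++ wordInv Y))).length ≤ 6 * X.length)
    (hY : (p ++ (X ++ (p ++ wordInv Y))).length ≤ 6 * Y.length)
    (hX' : 2 * X.length ≤ (p ++ (X ++ (p ++ wordInv Y))).length)
    (hY' : 2 * Y.length ≤ (p ++ (X ++ (p ++ wordInv Y))).length) (n : ℕ) :
    SDehn P (altWord X Y n) := by
  have h' : wordInv p ++ (Y ++ (wordInv p ++ wordInv X)) ∈ P.rels := by
    have := rel_rot (u := Y ++ (wordInv p ++ wordInv X)) (v := wordInv p)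
      (by simpa using P.inv_mem _ h)
    exact this
  simp only [List.length_append, length_wordInv] at hX hY hX' hY'
  refine sdehn_altWord n ?_ ?_ hX0 hY0 (junctionOK hp h ?_ ?_) (junctionOK (by simpa using hp) h' ?_ ?_)
  · refine sdehn_of_rel (t := p ++ wordInv Y ++ p) ?_ ?_
    · simpa using rel_rot h
    · simp only [List.length_append, length_wordInv]; omega
  · refine sdehn_of_rel (t := wordInv p ++ wordInv X ++ wordInv p) ?_ ?_
    · simpa using rel_rot h'
    · simp only [List.length_append, length_wordInv]; omega
  all_goals simp only [List.length_append, length_wordInv]; omega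

end Alternating
end GSC

namespace GSC

section Conjugacy

variable {S : Type} {P : C6Presentation S} {g : P.Grp} {w : Word S}

/-- A shortest word representing a conjugate of `g`. -/
structure ConjMin (P : C6Presentation S) (g : P.Grp) (w : Word S) : Prop where
  conj : ∃ k, k * P.elt w * k⁻¹ = g
  le : ∀ w' k, k * P.elt w' * k⁻¹ = g → w.length ≤ w'.length

lemma exists_conjMin (g : P.Grp) : ∃ w, ConjMin P g w := by
  classical
  have h : ∃ n, ∃ w : Word S, w.length = n ∧ ∃ k, k * P.elt w * k⁻¹ = g := by
    obtain ⟨w, -, hw⟩ := exists_elt P g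
    exact ⟨_, w, rfl, 1, by simpa using hw⟩
  obtain ⟨w, h1, h2⟩ := Nat.find_spec h
  refine ⟨w, h2, fun w' k hk => ?_⟩
  rw [h1]
  exact Nat.find_min' h ⟨w', rfl, k, hk⟩

lemma ConjMin.le_of_eq (h : ConjMin P g w) (k : P.Grp) {w' : Word S}
    (hk : k * P.elt w' * k⁻¹ = P.elt w) : w.length ≤ w'.length := by
  obtain ⟨l, rfl⟩ := h.conj
  exact h.le w' (l * k) (by rw [← hk]; group)

lemma ConjMin.of_eq (h : ConjMin P g w) (k : P.Grp) {w' : Word S}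
    (hk : k * P.elt w' * k⁻¹ = P.elt w) (hl : w'.length ≤ w.length) : ConjMin P g w' := by
  obtain ⟨l, hl'⟩ := h.conj
  exact ⟨⟨l * k, by rw [← hl', ← hk]; group⟩, fun w'' k'' hk'' => hl.trans (h.le w'' k'' hk'')⟩

lemma ConjMin.rotation {u v : Word S} (h : ConjMin P g (u ++ v)) : ConjMin P g (v ++ u) :=
  h.of_eq (P.elt u) (by simp only [elt_append]; group) (by simp [add_comm])

lemma ConjMin.reduced (h : ConjMin P g w) : Reduced w := by
  obtain ⟨u, h1, h2⟩ := exists_reduced_red w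
  rwa [← h1.sublist.eq_of_length_le (h.le_of_eq 1 (by simp [elt_red P h1]))]

lemma ConjMin.cyclicallyReduced (h : ConjMin P g w) : CyclicallyReduced w := by
  cases w with
  | nil => exact reduced_nil
  | cons a v =>
    have h1 : Reduced ([a] ++ v) := h.reduced
    have h2 : Reduced (v ++ [a]) := (ConjMin.rotation (u := [a]) h).reduced
    have h3 : Reduced ([a] ++ v ++ [a]) := by
      rcases eq_or_ne v [] with rfl | hv
      · simp only [List.append_nil, List.singleton_append]
        rw [reduced_cons_cons]
        exact ⟨fun e => li_ne a e.symm, reduced_singleton a⟩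
      · exact h1.append_overlap h2 hv
    simpa [CyclicallyReduced] using h3.append_overlap h1 (by simp)

/-- A subword of a power of a shortest word of its conjugacy class which is longer than half of a
relator. -/
def LongArc (P : C6Presentation S) (g : P.Grp) (w t z : Word S) : Prop :=
  ConjMin P g w ∧ (∃ n, t <:+: wpow w n) ∧ t ++ z ∈ P.rels ∧ z.length < t.length

lemma dehnRoot_of_no_longArc
    (hnonrep : ∀ r ∈ P.rels, ∀ w : Word S, w ≠ [] → Reduced w → ¬ (w ++ w) <:+: r)
    (hw : w ≠ []) (hc : ConjMin P g w) (h : ∀ t z, ¬ LongArc P g w t z) : DehnRoot P w where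
  red := hc.cyclicallyReduced
  ovl n ρ hρ u hu huρ := (length_lt_two_mul hnonrep hw hc.cyclicallyReduced hu hρ huρ).le
  dehn n := by
    rintro _ hρ u hu ⟨z, rfl⟩
    by_contra! hl
    rw [List.length_append] at hl
    exact h u z ⟨hc, ⟨n, hu⟩, hρ, by omega⟩

lemma LongArc.exists_form
    (hnonrep : ∀ r ∈ P.rels, ∀ w : Word S, w ≠ [] → Reduced w → ¬ (w ++ w) <:+: r)
    (hw : w ≠ []) {t z : Word S} (h : LongArc P g w t z) :
    ∃ p q, p ≠ [] ∧ q ≠ [] ∧ t = p ++ (q ++ p) ∧ ConjMin P g (p ++ q) := by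
  obtain ⟨hc, ⟨n, ht⟩, hr, hl⟩ := h
  have hlt := length_lt_two_mul hnonrep hw hc.cyclicallyReduced ht hr (List.prefix_append _ _).isInfix
  obtain ⟨u, v, rfl, h⟩ := exists_rotation ht
  have hc' := hc.rotation
  have hlv : (v ++ u).length = (u ++ v).length := by simp [add_comm]
  have hgt : (v ++ u).length < t.length := by
    by_contra! hle
    obtain ⟨s, hs⟩ := prefix_wpow h hle
    have := hc'.le_of_eq (w' := wordInv z ++ s) 1 (by
      have h1 := elt_rel P hr
      rw [elt_append] at h1
      rw [← hs, elt_append, elt_append, elt_wordInv, ← mul_eq_one_iff_eq_inv.1 h1]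
      group)
    rw [← hs] at this
    simp only [List.length_append, length_wordInv] at this
    omega
  cases n with
  | zero => have := h.length_le; simp only [wpow_zero, List.length_nil] at this; omega
  | succ n =>
    obtain ⟨p, rfl⟩ := List.prefix_of_prefix_length_le (l₁ := v ++ u) (by
      rw [wpow_succ]; exact List.prefix_append _ _) h hgt.le
    rw [wpow_succ, List.prefix_append_right_inj] at h
    rw [List.length_append] at hlt hgt
    obtain ⟨q, hq⟩ := prefix_wpow h (by omega)
    rw [← hq] at hc' hgt hlt hlv ⊢
    refine ⟨p, q, ?_, ?_, by simp, hc'⟩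
    · rintro rfl
      have := congrArg List.length hq
      simp only [List.nil_append, List.append_nil, List.length_append] at this hgt
      omega
    · rintro rfl
      simp only [List.append_nil] at hlv hlt
      omega

/-- If a relator has a long arc along the powers of an element, the square of the element has a
conjugate all of whose powers are shortest with respect to Dehn's algorithm. -/
lemma exists_dehnRoot_of_longArc
    (hnonrep : ∀ r ∈ P.rels, ∀ w : Word S, w ≠ [] → Reduced w → ¬ (w ++ w) <:+: r)
    (hw : w ≠ []) {t z : Word S} (h : LongArc P g w t z)
    (hmax : ∀ w' t' z', LongArc P g w' t' z' → t'.length ≤ t.length) :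
    ∃ W k, k * P.elt W * k⁻¹ = g ^ 2 ∧ DehnRoot P W := by
  obtain ⟨p, q, hp, hq, rfl, hc⟩ := h.exists_form hnonrep hw
  obtain ⟨-, -, hr, hl⟩ := h
  have hr' : p ++ (q ++ (p ++ z)) ∈ P.rels := by simpa using hr
  have hlp := List.length_pos_iff.2 hp
  have hlq := List.length_pos_iff.2 hq
  have hqz : q.length ≤ z.length := by
    have h1 := elt_rel P hr'
    have := hc.le_of_eq (w' := wordInv (p ++ z)) 1 (by
      rw [← List.append_assoc, elt_append] at h1
      rw [elt_wordInv, ← mul_eq_one_iff_eq_inv.1 h1]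
      group)
    simp only [List.length_append, length_wordInv] at this
    omega
  have hz : z ≠ [] := by rintro rfl; simp only [List.length_nil] at hqz; omega
  have hpl : 6 * p.length < (p ++ (q ++ (p ++ z))).length := by
    refine piece_lt_append hr' (v' := z ++ (p ++ q)) ?_ ?_
    · have := rel_rot (u := p ++ q) (v := p ++ z) (by simpa using hr)
      simpa using this
    · intro heq
      have h1 : p ++ q <+: p ++ z := by
        rw [List.prefix_append_right_inj]
        exact List.prefix_of_prefix_length_le ⟨p ++ z, heq⟩ (List.prefix_append _ _) hqz
      refine hnonrep _ hr' (p ++ q) (by simp [hp]) hc.reduced ?_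
      refine List.IsPrefix.isInfix ?_
      have := (List.prefix_append_right_inj (p ++ q)).2 h1
      simpa using this
  simp only [List.length_append] at hl hpl
  have hrel : p ++ (q ++ (p ++ wordInv (wordInv z))) ∈ P.rels := by rwa [wordInv_wordInv]
  have hd := sdehn_altWord_of_rel hp hq (by simpa using hz) hrel (by
    simp only [List.length_append, length_wordInv]; omega) (by
    simp only [List.length_append, length_wordInv]; omega) (by
    simp only [List.length_append, length_wordInv]; omega) (by
    simp only [List.length_append, length_wordInv]; omega)
  have hcr := P.cyclically_reduced _ hr
  have hrq : Reduced q := hc.reduced.right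
  have hrz : Reduced (wordInv z) := (Reduced.right hcr.reduced).wordInv
  have j1 : Reduced (wordInv z ++ q) := by
    by_contra hcon
    obtain ⟨a, z', q', rfl, rfl⟩ := exists_cons_of_not_reduced (rel_reduced hr).right hrq hcon
    have := hmax (p ++ (a :: q')) (p ++ (a :: q' ++ p) ++ [a]) z' ⟨hc, ⟨3, ?_⟩, by simpa using hr, ?_⟩
    · simp only [List.length_append, List.length_singleton] at this
      omega
    · exact ⟨[], q' ++ (p ++ a :: q'), by simp [wpow]⟩
    · simp only [List.length_append, List.length_cons, List.length_nil] at hl ⊢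
      omega
  have j2 : Reduced (q ++ wordInv z) := by
    by_contra hcon
    rw [← wordInv_wordInv q] at hcon
    obtain ⟨a, q', z', e1, e2⟩ := exists_cons_of_not_reduced hrq.wordInv hrz hcon
    have e1' := congrArg wordInv e1
    have e2' := congrArg wordInv e2
    rw [wordInv_wordInv, wordInv_cons] at e1' e2'
    have := hmax (p ++ q) ([li a] ++ (p ++ (q ++ p))) (wordInv z') ⟨hc, ⟨3, ?_⟩, ?_, ?_⟩
    · simp only [List.length_append, List.length_singleton] at this
      omega
    · refine ⟨p ++ wordInv q', q, ?_⟩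
      have : wpow (p ++ q) 3 = p ++ q ++ (p ++ q ++ (p ++ q)) := by simp [wpow]
      rw [this]
      nth_rewrite 3 [e1']
      simp
    · have := rel_rot (u := p ++ (q ++ p) ++ wordInv z') (v := [li a])
        (by rw [e2'] at hr; simpa using hr)
      simpa using this
    · rw [e2'] at hl
      simp only [List.length_append, List.length_cons, List.length_nil] at hl ⊢
      omega
  have hcW : CyclicallyReduced (q ++ wordInv z) := by
    have := (j2.append_overlap j1 (by simpa using hz)).append_overlap j2 hq
    simpa [CyclicallyReduced] using this
  obtain ⟨k, hk⟩ := hc.conj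
  refine ⟨q ++ wordInv z, k * P.elt p, ?_, hcW, fun n => ?_, fun n ρ hρ u hu huρ =>
    (length_lt_two_mul hnonrep (by simp [hq]) hcW hu hρ huρ).le⟩
  · have h1 := elt_rel P hr'
    simp only [elt_append] at h1
    have h2 : (P.elt z)⁻¹ = P.elt p * P.elt q * P.elt p := by
      rw [eq_comm, ← mul_eq_one_iff_eq_inv, ← h1]; group
    rw [← hk, elt_append, elt_append, elt_wordInv, h2, pow_two]
    group
  · rw [wpow_eq_altWord]; exact hd _

lemma exists_dehnRoot
    (hnonrep : ∀ r ∈ P.rels, ∀ w : Word S, w ≠ [] → Reduced w → ¬ (w ++ w) <:+: r) (hg : g ≠ 1) :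
    ∃ W k, ∃ e : ℕ, 0 < e ∧ k * P.elt W * k⁻¹ = g ^ e ∧ DehnRoot P W := by
  classical
  have hne : ∀ {w}, ConjMin P g w → w ≠ [] := by
    rintro w ⟨⟨k, hk⟩, -⟩ rfl
    rw [elt_nil, mul_one, mul_inv_cancel] at hk
    exact hg hk.symm
  obtain ⟨w₀, hw₀⟩ := exists_conjMin g
  by_cases h : ∃ w t z, LongArc P g w t z
  · have hb : ∀ w t z, LongArc P g w t z → t.length ≤ 2 * w₀.length := by
      rintro w t z ⟨hc, ⟨n, ht⟩, hr, -⟩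
      have h1 := length_lt_two_mul hnonrep (hne hc) hc.cyclicallyReduced ht hr
        (List.prefix_append _ _).isInfix
      obtain ⟨k, hk⟩ := hw₀.conj
      have := hc.le w₀ k hk
      omega
    obtain ⟨w, t, z, h⟩ := h
    have hex : ∃ n, ∃ w t z, LongArc P g w t z ∧ t.length = n := ⟨_, w, t, z, h, rfl⟩
    obtain ⟨w, t, z, h1, h2⟩ := Nat.findGreatest_spec
      (P := fun n => ∃ w t z, LongArc P g w t z ∧ t.length = n) (hb w t z h) ⟨w, t, z, h, rfl⟩
    obtain ⟨W, k, hk, hW⟩ := exists_dehnRoot_of_longArc hnonrep (hne h1.1) h1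
      (fun w' t' z' h' => h2 ▸ Nat.le_findGreatest (hb w' t' z' h') ⟨w', t', z', h', rfl⟩)
    exact ⟨W, k, 2, by norm_num, hk, hW⟩
  · push Not at h
    obtain ⟨k, hk⟩ := hw₀.conj
    exact ⟨w₀, k, 1, by norm_num, by rw [hk, pow_one],
      dehnRoot_of_no_longArc hnonrep (hne hw₀) hw₀ (h w₀)⟩

end Conjugacy
end GSC

namespace GSC

section Projection

variable {S : Type} {P : C6Presentation S}

lemma DehnRoot.geod_zpow {W q : Word S} (hW : DehnRoot P W) (hq : Geod P q) {n : ℤ}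
    (h : P.elt q = P.elt W ^ n) : Ovl P (14 * W.length) q ∧
      ∀ q₀, q₀ <+: q → ∃ m : ℤ, len P ((P.elt q₀)⁻¹ * P.elt W ^ m) ≤ 19 * W.length + 1 := by
  obtain ⟨n, rfl | rfl⟩ := n.eq_nat_or_neg
  · rw [zpow_natCast, ← elt_wpow] at h
    refine ⟨hW.ovl_geod hq h, fun q₀ h0 => ?_⟩
    obtain ⟨m, hm⟩ := hW.exists_near hq h h0
    exact ⟨m, by rwa [zpow_natCast]⟩
  · have h' : P.elt (wordInv q) = P.elt (wpow W n) := by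
      rw [elt_wordInv, h, elt_wpow]; simp
    refine ⟨by simpa using (hW.ovl_geod hq.inv h').inv, fun q₀ h0 => ?_⟩
    obtain ⟨q₁, rfl⟩ := h0
    obtain ⟨m, hm⟩ := hW.exists_near hq.inv h' (q₀ := wordInv q₁) (by simp)
    refine ⟨-n + m, ?_⟩
    rw [zpow_add, ← h, zpow_natCast]
    rw [elt_wordInv, inv_inv] at hm
    rwa [elt_append, ← mul_assoc, inv_mul_cancel_left]

/-- `y` is a closest point of `Y` to `x`. -/
def Closest (P : C6Presentation S) (Y : Set P.Grp) (x y : P.Grp) : Prop :=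
  y ∈ Y ∧ ∀ z ∈ Y, len P (x⁻¹ * y) ≤ len P (x⁻¹ * z)

lemma exists_closest {Y : Set P.Grp} (hY : Y.Nonempty) (x : P.Grp) : ∃ y, Closest P Y x y := by
  obtain ⟨y, h1, h2⟩ := WellFounded.has_min (measure fun y => len P (x⁻¹ * y)).wf Y hY
  exact ⟨y, h1, fun z hz => not_lt.1 (h2 z hz)⟩

lemma Closest.setDist_eq {Y : Set P.Grp} {x y : P.Grp} (h : Closest P Y x y) :
    setDist P.gens x Y = len P (x⁻¹ * y) := by
  refine IsLeast.csInf_eq ⟨⟨y, h.1, rfl⟩, ?_⟩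
  rintro _ ⟨z, hz, rfl⟩
  exact Nat.cast_le.2 (h.2 z hz)

lemma closest_of_mem_proj {Y : Set P.Grp} {x y : P.Grp} (h : y ∈ proj P.gens Y x) :
    Closest P Y x y := by
  refine ⟨h.1, fun z hz => ?_⟩
  have h1 : setDist P.gens x Y ≤ wdist P.gens x z := by
    refine csInf_le ⟨0, ?_⟩ ⟨z, hz, rfl⟩
    rintro _ ⟨z, -, rfl⟩
    exact Nat.cast_nonneg _
  have h2 : wdist P.gens x y = setDist P.gens x Y := h.2
  rw [← h2] at h1
  exact Nat.cast_le.1 h1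

lemma len_triangle (x y z : P.Grp) : len P (x⁻¹ * z) ≤ len P (x⁻¹ * y) + len P (y⁻¹ * z) := by
  have := len_mul_le (x⁻¹ * y) (y⁻¹ * z)
  rwa [mul_assoc, mul_inv_cancel_left] at this

lemma len_comm (x y : P.Grp) : len P (x⁻¹ * y) = len P (y⁻¹ * x) := by
  rw [← len_inv]; simp

lemma exists_near_zpow {g h k : P.Grp} {e : ℕ} (he : 0 < e) (hk : k * h * k⁻¹ = g ^ e) :
    ∃ E, (∀ i : ℤ, ∃ y ∈ Subgroup.zpowers g, len P (y⁻¹ * (k * h ^ i)) ≤ E) ∧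
      ∀ y ∈ Subgroup.zpowers g, ∃ i : ℤ, len P (y⁻¹ * (k * h ^ i)) ≤ E := by
  have hpow : ∀ i : ℤ, k * h ^ i = g ^ (e * i) * k := by
    intro i
    rw [zpow_mul, zpow_natCast, ← hk, conj_zpow]; group
  refine ⟨∑ r ∈ Finset.range e, len P (g ^ r) + len P k, fun i => ?_, ?_⟩
  · refine ⟨g ^ (e * i), ⟨_, rfl⟩, ?_⟩
    rw [hpow, inv_mul_cancel_left]; omega
  · rintro _ ⟨j, rfl⟩
    refine ⟨j / e, ?_⟩
    have he' : (e : ℤ) ≠ 0 := by omega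
    obtain ⟨r, hr⟩ := Int.eq_ofNat_of_zero_le (Int.emod_nonneg j he')
    have hre : r < e := by
      have := Int.emod_lt_of_pos j (show (0 : ℤ) < e by omega)
      omega
    have h1 : (g ^ j)⁻¹ * (k * h ^ (j / e)) = (g ^ r)⁻¹ * k := by
      rw [hpow, ← mul_assoc, ← zpow_neg, ← zpow_add, ← zpow_natCast, ← zpow_neg]
      congr 2
      have := Int.mul_ediv_add_emod j e
      omega
    have h2 : len P (g ^ r) ≤ ∑ r ∈ Finset.range e, len P (g ^ r) :=
      Finset.single_le_sum (f := fun r => len P (g ^ r)) (fun _ _ => Nat.zero_le _)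
        (Finset.mem_range.2 hre)
    have h3 := len_mul_le (g ^ r)⁻¹ k
    rw [len_inv] at h3
    show len P ((g ^ j)⁻¹ * (k * h ^ (j / e))) ≤ _
    rw [h1]; omega

lemma exists_bound
    (hnonrep : ∀ r ∈ P.rels, ∀ w : Word S, w ≠ [] → Reduced w → ¬ (w ++ w) <:+: r)
    {g : P.Grp} (hg : g ≠ 1) :
    ∃ B, ∀ x x' y y', Closest P (Subgroup.zpowers g : Set P.Grp) x y →
      Closest P (Subgroup.zpowers g : Set P.Grp) x' y' →
      len P (x⁻¹ * x') ≤ len P (x⁻¹ * y) → len P (y⁻¹ * y') ≤ B := by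
  obtain ⟨W, k, e, he, hk, hW⟩ := exists_dehnRoot hnonrep hg
  obtain ⟨E, hE, hE'⟩ := exists_near_zpow he hk
  set K := 14 * W.length with hK
  set C := 2 * E + (19 * W.length + 1) with hC
  refine ⟨2 * E + (2 * landing K C + (landing K C + 5 * C + 57 * K + 2) + E), ?_⟩
  intro x x' y y' hy hy' hxx
  obtain ⟨i, hi⟩ := hE' y hy.1
  obtain ⟨i', hi'⟩ := hE' y' hy'.1
  have key : ∀ (x y : P.Grp) (i n : ℤ) (q : Word S),
      Closest P (Subgroup.zpowers g : Set P.Grp) x y → len P (y⁻¹ * (k * P.elt W ^ i)) ≤ E →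
      Geod P q → P.elt q = P.elt W ^ n → ∀ q₀, q₀ <+: q →
        len P (x⁻¹ * (k * P.elt W ^ i)) ≤ len P (x⁻¹ * (k * P.elt W ^ i) * P.elt q₀) + C := by
    intro x y i n q hy hi hq hqn q₀ h0
    obtain ⟨m, hm⟩ := (hW.geod_zpow hq hqn).2 q₀ h0
    obtain ⟨z, hz, hzE⟩ := hE (i + m)
    have h1 := len_triangle x y (k * P.elt W ^ i)
    have h2 := hy.2 z hz
    have h3 := len_triangle x (k * P.elt W ^ i * P.elt q₀) z
    have h4 := len_triangle (k * P.elt W ^ i * P.elt q₀) (k * P.elt W ^ (i + m)) z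
    have h5 : (k * P.elt W ^ i * P.elt q₀)⁻¹ * (k * P.elt W ^ (i + m)) =
        (P.elt q₀)⁻¹ * P.elt W ^ m := by
      rw [zpow_add]; group
    rw [h5] at h4
    rw [len_comm (k * P.elt W ^ (i + m)) z] at h4
    rw [mul_assoc x⁻¹]
    omega
  obtain ⟨q, hq, hqe⟩ := exists_geod (P := P) (P.elt W ^ (i' - i))
  have hqe' : P.elt (wordInv q) = P.elt W ^ (-(i' - i)) := by
    rw [elt_wordInv, hqe, zpow_neg]
  have h1 := add_length_add_le (K := K) (C := C) hq (hW.geod_zpow hq hqe).1 (key x y i _ q hy hi hq hqe)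
    (key x' y' i' _ _ hy' hi' hq.inv hqe')
  have h2 : x⁻¹ * (k * P.elt W ^ i) * P.elt q * (x'⁻¹ * (k * P.elt W ^ i'))⁻¹ = x⁻¹ * x' := by
    rw [hqe, zpow_sub]; group
  rw [h2] at h1
  have h3 := len_triangle x (k * P.elt W ^ i) y
  rw [len_comm (k * P.elt W ^ i) y] at h3
  have h4 : len P ((k * P.elt W ^ i)⁻¹ * (k * P.elt W ^ i')) = q.length := by
    rw [← hq.len_eq, hqe, zpow_sub]
    congr 1
    group
  have h5 := len_triangle y (k * P.elt W ^ i) y'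
  have h6 := len_triangle (k * P.elt W ^ i) (k * P.elt W ^ i') y'
  rw [len_comm (k * P.elt W ^ i') y', h4] at h6
  by_cases hl : 2 * landing K C ≤ q.length
  · have := h1 hl
    omega
  · omega

end Projection

lemma admissible_const {C : ℝ} (hC : 0 ≤ C) : Admissible (fun r => r) (fun _ => C) := by
  refine ⟨monotone_id, monotone_const, Filter.eventually_ge_atTop 0,
    Filter.Eventually.of_forall fun _ => hC, fun _ => le_rfl, fun M => ⟨M, le_rfl⟩, ?_⟩
  exact Filter.Tendsto.const_div_atTop Filter.tendsto_id C

end GSC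

namespace GSC

/-- If a classical C'(1/6) presentation over a finite alphabet is in
addition non-repetitive — no nonempty reduced word `ww` occurs as a subword of any cyclic
permutation of any relator — then every infinite cyclic subgroup of the presented group
is strongly contracting. -/
theorem statement14 {S : Type} [Finite S] (P : C6Presentation S)
    (hnonrep : ∀ r ∈ P.rels, ∀ w : Word S, w ≠ [] → Reduced w → ¬ (w ++ w) <:+: r) :
    ∀ g : P.Grp, ¬ IsOfFinOrder g →
      StronglyContracting P.gens ((Subgroup.zpowers g : Subgroup P.Grp) : Set P.Grp) := by
  intro g hg
  have hg1 : g ≠ 1 := by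
    rintro rfl
    exact hg IsOfFinOrder.one
  obtain ⟨B, hB⟩ := exists_bound hnonrep hg1
  have hne : ((Subgroup.zpowers g : Subgroup P.Grp) : Set P.Grp).Nonempty := ⟨1, one_mem _⟩
  refine ⟨((2 * B : ℕ) : ℝ), admissible_const (Nat.cast_nonneg _), ?_⟩
  intro x _ x' _ hxx y hy y' hy'
  refine Nat.cast_le.2 ?_
  show len P (y⁻¹ * y') ≤ 2 * B
  obtain ⟨z, hz⟩ := exists_closest hne x
  obtain ⟨z', hz'⟩ := exists_closest hne x'
  have hcl : ∀ {y}, Closest P (Subgroup.zpowers g : Set P.Grp) x y →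
      len P (x⁻¹ * x') ≤ len P (x⁻¹ * y) := by
    intro y hy
    rw [hy.setDist_eq] at hxx
    exact Nat.cast_le.1 hxx
  have near : ∀ {y y'}, Closest P (Subgroup.zpowers g : Set P.Grp) x y →
      Closest P (Subgroup.zpowers g : Set P.Grp) x' y' → len P (y⁻¹ * y') ≤ B :=
    fun h h' => hB x x' _ _ h h' (hcl h)
  rcases hy with hy | hy <;> rcases hy' with hy' | hy' <;>
    replace hy := closest_of_mem_proj hy <;> replace hy' := closest_of_mem_proj hy'
  · have h1 := near hy hz'
    have h2 := near hy' hz'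
    rw [len_comm] at h2
    have := len_triangle y z' y'
    omega
  · have := near hy hy'
    omega
  · have := near hy' hy
    rw [len_comm] at this
    omega
  · have h1 := near hz hy
    have h2 := near hz hy'
    rw [len_comm] at h1
    have := len_triangle y z y'
    omega
end GSC
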